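/- (In-probability law of large numbers for G-equation travel times.) Assume the G-equation hypotheses on (c,v) over a probability space (Ω,F,P), assume each travel time τ^{t_0}(x_0, x, ·) is measurable in ω, and assume only lim_{s→∞} φ_H(s) = 0 for H := (c,v). Then there is M ≥ 1 such that for each unit vector e ∈ S^{d-1} there exists τ̄(e) ∈ [M^{-1}, M] with max{ |τ̄(e) − τ̄(e')|, |1/τ̄(e) − 1/τ̄(e')| } ≤ M^3|e − e'| for all e, e' ∈ S^{d-1}, and such that for every (t_0, x_0) ∈ ℝ^{d+1}: τ^{t_0}(x_0, x_0 + re, ·)/r → τ̄(e) in probability as r → ∞, and lim_{r→∞} E[τ^{t_0}(x_0, x_0 + re, ·)]/r = τ̄(e). -/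

import Mathlib

open MeasureTheory Filter Metric

noncomputable section

/-- `ℝ^d` with the Euclidean norm. -/
abbrev Euc (d : ℕ) : Type := EuclideanSpace ℝ (Fin d)

/-- `(t₁, x₁)` is reachable from `(t₀, x₀)`: there is an absolutely continuous path
`γ : [t₀,t₁] → ℝ^d` (given by the integral of its a.e. derivative `g`) with `γ(t₀) = x₀`,
`γ(t₁) = x₁`, and `|γ'(t) − v(t,γ(t))| ≤ c(t,γ(t))` for a.e. `t ∈ [t₀,t₁]`. -/
def Reachable {d : ℕ} (c : ℝ → Euc d → ℝ) (v : ℝ → Euc d → Euc d)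
    (t0 : ℝ) (x0 : Euc d) (t1 : ℝ) (x1 : Euc d) : Prop :=
  t0 ≤ t1 ∧ ∃ γ g : ℝ → Euc d,
    IntervalIntegrable g volume t0 t1 ∧
    (∀ t ∈ Set.Icc t0 t1, γ t = x0 + ∫ s in t0..t, g s) ∧
    γ t1 = x1 ∧
    ∀ᵐ s ∂(volume.restrict (Set.Icc t0 t1)), ‖g s - v s (γ s)‖ ≤ c s (γ s)

/-- The reachable set `Γ(t; t₀, x₀)`. -/
def reachSet {d : ℕ} (c : ℝ → Euc d → ℝ) (v : ℝ → Euc d → Euc d)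
    (t t0 : ℝ) (x0 : Euc d) : Set (Euc d) :=
  {x | Reachable c v t0 x0 (t0 + t) x}

/-- The travel time `τ^{t₀}(x₀, x) = inf { t ≥ 0 : x ∈ Γ(t; t₀, x₀) }`. -/
def travelTime {d : ℕ} (c : ℝ → Euc d → ℝ) (v : ℝ → Euc d → Euc d)
    (t0 : ℝ) (x0 x : Euc d) : ℝ :=
  sInf {t | 0 ≤ t ∧ x ∈ reachSet c v t t0 x0}

/-- The σ-algebra `F_t^+(H)` generated by `H(s,x,·) = (c(s,x,·), v(s,x,·))` for `s ≥ t`. -/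
def sigmaPlus {d : ℕ} {Ω : Type*} [MeasurableSpace Ω]
    (c : ℝ → Euc d → Ω → ℝ) (v : ℝ → Euc d → Ω → Euc d) (t : ℝ) : MeasurableSpace Ω :=
  ⨆ (s : ℝ) (_ : t ≤ s) (x : Euc d),
    MeasurableSpace.comap (fun ω => (c s x ω, v s x ω)) inferInstance

/-- The σ-algebra `F_t^-(H)` generated by `H(s,x,·) = (c(s,x,·), v(s,x,·))` for `s ≤ t`. -/
def sigmaMinus {d : ℕ} {Ω : Type*} [MeasurableSpace Ω]
    (c : ℝ → Euc d → Ω → ℝ) (v : ℝ → Euc d → Ω → Euc d) (t : ℝ) : MeasurableSpace Ω :=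
  ⨆ (s : ℝ) (_ : s ≤ t) (x : Euc d),
    MeasurableSpace.comap (fun ω => (c s x ω, v s x ω)) inferInstance

/-- The mixing coefficient `φ_H(s)` of `H = (c,v)`. -/
def phiH {d : ℕ} {Ω : Type*} [MeasurableSpace Ω] (P : Measure Ω)
    (c : ℝ → Euc d → Ω → ℝ) (v : ℝ → Euc d → Ω → Euc d) (s : ℝ) : ℝ :=
  sSup {r | ∃ t : ℝ, ∃ Ev Fv : Set Ω,
    MeasurableSet[sigmaMinus c v t] Ev ∧ MeasurableSet[sigmaPlus c v (t + s)] Fv ∧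
    0 < P Ev ∧ r = |(P (Fv ∩ Ev)).toReal / (P Ev).toReal - (P Fv).toReal|}

lemma integrable_of_bdd_cpt {d : ℕ} {F : Type*} [NormedAddCommGroup F]
    {f : Euc d → F} (hm : AEStronglyMeasurable f volume)
    {C : ℝ} (hC : ∀ x, ‖f x‖ ≤ C) {S : Set (Euc d)} (hS : IsCompact S) (h0 : ∀ x, x ∉ S → f x = 0) :
    Integrable f := by
  rw [← integrableOn_iff_integrable_of_support_subset (s := S)]
  · exact Measure.integrableOn_of_bounded hS.measure_lt_top.ne hm (ae_of_all _ hC)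
  · intro x hx; by_contra h; exact hx (h0 x h)

abbrev eb {d : ℕ} (i : Fin d) : Euc d := EuclideanSpace.single i 1

lemma sum_eb {d : ℕ} (x : Euc d) : x = ∑ i, x i • eb i := by
  ext j
  simp [eb, Pi.single_apply]

lemma lip_coord {d : ℕ} {D : NNReal} {Y : Euc d → Euc d} (hY : LipschitzWith D Y) (i : Fin d) :
    LipschitzWith D (fun x => Y x i) := by
  apply LipschitzWith.of_dist_le_mul
  intro x y
  refine le_trans ?_ (hY.dist_le_mul x y)
  rw [dist_eq_norm, dist_eq_norm]
  exact (PiLp.norm_apply_le (Y x - Y y) i)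

lemma fderiv_zero_off {d : ℕ} {F : Type*} [NormedAddCommGroup F] [NormedSpace ℝ F] {φ : Euc d → F}
    {x : Euc d} (hx : x ∉ tsupport φ) : fderiv ℝ φ x = 0 := by
  by_contra h
  exact hx (support_fderiv_subset ℝ (Function.mem_support.2 h))

lemma ibp {d : ℕ} {C D : NNReal} {φ : Euc d → ℝ} {Y : Euc d → Euc d}
    (hφ : LipschitzWith C φ) (hc : HasCompactSupport φ) (hY : LipschitzWith D Y) :
    ∫ x, fderiv ℝ φ x (Y x) = - ∫ x, φ x * ∑ i, (fderiv ℝ Y x (eb i)) i := by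
  have h1 : ∀ i : Fin d, ∫ x, fderiv ℝ φ x (eb i) * Y x i
      = - ∫ x, φ x * (fderiv ℝ Y x (eb i)) i := by
    intro i
    have := LipschitzWith.integral_lineDeriv_mul_eq (μ := volume) (lip_coord hY i) hφ hc (eb i)
    have e1 : ∫ x, lineDeriv ℝ (fun x => Y x i) x (eb i) * φ x
        = ∫ x, φ x * (fderiv ℝ Y x (eb i)) i := by
      apply integral_congr_ae
      filter_upwards [hY.ae_differentiableAt] with x hx
      have : HasFDerivAt (fun x => Y x i)
          ((EuclideanSpace.proj i : Euc d →L[ℝ] ℝ).comp (fderiv ℝ Y x)) x :=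
        (EuclideanSpace.proj i : Euc d →L[ℝ] ℝ).hasFDerivAt.comp x hx.hasFDerivAt
      rw [this.differentiableAt.lineDeriv_eq_fderiv, this.fderiv]
      simp [mul_comm]
    have e2 : ∫ x, lineDeriv ℝ φ x (-eb i) * Y x i = - ∫ x, fderiv ℝ φ x (eb i) * Y x i := by
      rw [← integral_neg]
      apply integral_congr_ae
      filter_upwards [hφ.ae_differentiableAt] with x hx
      rw [hx.lineDeriv_eq_fderiv]
      simp
    linarith
  have hYc : Continuous Y := hY.continuous
  have hYm : ∀ i, Continuous fun x => Y x i := fun i => (lip_coord hY i).continuous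
  obtain ⟨B, hB⟩ := (hc.isCompact.image hYc).isBounded.exists_norm_le
  have hB' : ∀ x ∈ tsupport φ, ‖Y x‖ ≤ B := fun x hx => hB _ ⟨x, hx, rfl⟩
  have i1 : ∀ i : Fin d, Integrable (fun x => fderiv ℝ φ x (eb i) * Y x i) := by
    intro i
    refine integrable_of_bdd_cpt (C := C * |B|) (S := tsupport φ) ?_ ?_ hc.isCompact ?_
    · exact ((measurable_fderiv_apply_const ℝ φ (eb i)).mul (hYm i).measurable).aestronglyMeasurable
    · intro x
      by_cases hx : x ∈ tsupport φ
      · rw [norm_mul]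
        gcongr
        · refine (ContinuousLinearMap.le_opNorm _ _).trans ?_
          simpa [eb] using norm_fderiv_le_of_lipschitz ℝ hφ
        · exact (PiLp.norm_apply_le (Y x) i).trans ((hB' x hx).trans (le_abs_self _))
      · rw [fderiv_zero_off hx]; simp; positivity
    · intro x hx
      rw [fderiv_zero_off hx]; simp
  have i2 : ∀ i : Fin d, Integrable (fun x => φ x * (fderiv ℝ Y x (eb i)) i) := by
    intro i
    obtain ⟨A, hA⟩ := (hc.isCompact.image hφ.continuous).isBounded.exists_norm_le
    have hA' : ∀ x, ‖φ x‖ ≤ |A| := by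
      intro x
      by_cases hx : x ∈ tsupport φ
      · exact (hA _ ⟨x, hx, rfl⟩).trans (le_abs_self _)
      · rw [image_eq_zero_of_notMem_tsupport hx]; simp
    refine integrable_of_bdd_cpt (C := |A| * D) (S := tsupport φ) ?_ ?_ hc.isCompact ?_
    · refine (hφ.continuous.measurable.mul ?_).aestronglyMeasurable
      exact (EuclideanSpace.proj i : Euc d →L[ℝ] ℝ).measurable.comp
        (measurable_fderiv_apply_const ℝ Y (eb i))
    · intro x
      rw [norm_mul]
      gcongr
      · exact hA' x
      · refine (PiLp.norm_apply_le _ i).trans ((ContinuousLinearMap.le_opNorm _ _).trans ?_)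
        simpa [eb] using norm_fderiv_le_of_lipschitz ℝ hY
    · intro x hx
      rw [image_eq_zero_of_notMem_tsupport hx]; simp
  calc ∫ x, fderiv ℝ φ x (Y x) = ∫ x, ∑ i, fderiv ℝ φ x (eb i) * Y x i := by
        congr 1; ext x
        conv_lhs => rw [sum_eb (Y x)]
        rw [map_sum]
        apply Finset.sum_congr rfl; intro i _
        rw [map_smul, smul_eq_mul, mul_comm]
    _ = ∑ i, ∫ x, fderiv ℝ φ x (eb i) * Y x i := integral_finsetSum _ (fun i _ => i1 i)
    _ = ∑ i, - ∫ x, φ x * (fderiv ℝ Y x (eb i)) i := by simp_rw [h1]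
    _ = - ∫ x, ∑ i, φ x * (fderiv ℝ Y x (eb i)) i := by
        rw [integral_finsetSum _ (fun i _ => i2 i), Finset.sum_neg_distrib]
    _ = _ := by simp_rw [Finset.mul_sum]

lemma trace_eq_sum {d : ℕ} (A : Euc d →L[ℝ] Euc d) :
    LinearMap.trace ℝ (Euc d) A.toLinearMap = ∑ i, (A (eb i)) i := by
  rw [LinearMap.trace_eq_sum_inner _ (EuclideanSpace.basisFun (Fin d) ℝ)]
  apply Finset.sum_congr rfl; intro i _
  simp [eb, EuclideanSpace.inner_single_left]

lemma div_free {d : ℕ} {C D : NNReal} {φ : Euc d → ℝ} {w : Euc d → Euc d}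
    (hφ : LipschitzWith C φ) (hc : HasCompactSupport φ) (hw : LipschitzWith D w)
    (hdiv : ∀ᵐ x, LinearMap.trace ℝ (Euc d) (fderiv ℝ w x).toLinearMap = 0) :
    ∫ x, fderiv ℝ φ x (w x) = 0 := by
  rw [ibp hφ hc hw, neg_eq_zero]
  apply integral_eq_zero_of_ae
  filter_upwards [hdiv] with x hx
  rw [trace_eq_sum] at hx
  simp [hx]

/-- Translation estimate -/
lemma trans_est {d : ℕ} {C : NNReal} {F : Type*} [NormedAddCommGroup F] [InnerProductSpace ℝ F]
    [FiniteDimensional ℝ F] [MeasurableSpace F] [BorelSpace F]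
    {W σ : _} (hW : LipschitzWith C (W : Euc d → F))
    (hσ : Integrable (σ : Euc d → F)) (hWb : ∃ B, ∀ x, ‖W x‖ ≤ B) (z : Euc d) (B : ℝ)
    (hB : ∀ s ∈ Set.Icc (0:ℝ) 1, ∫ x, ‖σ x‖ * ‖fderiv ℝ W (x + s • z)‖ ≤ B) :
    |∫ x, inner ℝ (σ x) (W (x + z)) - inner ℝ (σ x) (W x)| ≤ ‖z‖ * B := by
  obtain ⟨B0, hB0⟩ := hWb
  have key : ∀ s : ℝ, HasDerivAt (fun s : ℝ => ∫ x, inner ℝ (σ x) (W (x + s • z)))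
      (∫ x, inner ℝ (σ x) (fderiv ℝ W (x + s • z) z)) s := by
    intro s
    have hWm : ∀ s : ℝ, Measurable fun x : Euc d => W (x + s • z) := fun s =>
      (hW.continuous.comp (by fun_prop)).measurable
    have hfm : Measurable fun x : Euc d => fderiv ℝ W (x + s • z) z :=
      (measurable_fderiv_apply_const ℝ W z).comp (by fun_prop)
    refine (hasDerivAt_integral_of_dominated_loc_of_lip (μ := volume) (s := Set.univ)
      (F := fun s x => inner ℝ (σ x) (W (x + s • z)))
      (F' := fun x => inner ℝ (σ x) (fderiv ℝ W (x + s • z) z))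
      (bound := fun x => ‖σ x‖ * (C * ‖z‖)) Filter.univ_mem ?_ ?_ ?_ ?_ ?_ ?_).2
    · exact Eventually.of_forall fun s =>
        hσ.aestronglyMeasurable.inner (hWm s).aestronglyMeasurable
    · refine Integrable.mono' (g := fun x => ‖σ x‖ * B0) (hσ.norm.mul_const _)
        (hσ.aestronglyMeasurable.inner (hWm s).aestronglyMeasurable) (ae_of_all _ fun x => ?_)
      exact (norm_inner_le_norm _ _).trans (by gcongr; exact hB0 _)
    · exact hσ.aestronglyMeasurable.inner hfm.aestronglyMeasurable
    · refine ae_of_all _ fun x => ?_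
      apply LipschitzOnWith.of_dist_le_mul
      intro a _ b _
      rw [dist_eq_norm, ← inner_sub_right]
      refine (norm_inner_le_norm _ _).trans ?_
      have : ‖W (x + a • z) - W (x + b • z)‖ ≤ C * ‖(a - b) • z‖ := by
        have := hW.norm_sub_le (x + a • z) (x + b • z)
        rwa [show x + a • z - (x + b • z) = (a - b) • z by rw [sub_smul]; abel] at this
      rw [norm_smul] at this
      have h2 : ((Real.nnabs (‖σ x‖ * (C * ‖z‖)) : NNReal) : ℝ) = ‖σ x‖ * (C * ‖z‖) := by
        simp only [Real.coe_nnabs]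
        rw [abs_of_nonneg (by positivity)]
      rw [h2, dist_eq_norm]
      calc _ ≤ ‖σ x‖ * (C * (‖a - b‖ * ‖z‖)) := by gcongr
        _ = _ := by ring
    · exact hσ.norm.mul_const _
    · have hd : ∀ᵐ x : Euc d, DifferentiableAt ℝ W (x + s • z) := by
        have := hW.ae_differentiableAt (μ := (volume : Measure (Euc d)))
        exact (measurePreserving_add_right volume (s • z)).quasiMeasurePreserving.ae this
      filter_upwards [hd] with x hx
      have h1 : HasDerivAt (fun s : ℝ => x + s • z) z s := by
        simpa using ((hasDerivAt_id s).smul_const z).const_add x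
      have h2 : HasDerivAt (fun s : ℝ => W (x + s • z)) (fderiv ℝ W (x + s • z) z) s :=
        hx.hasFDerivAt.comp_hasDerivAt s h1
      simpa using (hasDerivAt_const s (σ x)).inner ℝ h2
  have bound : ∀ s ∈ Set.Icc (0:ℝ) 1,
      ‖∫ x, inner ℝ (σ x) (fderiv ℝ W (x + s • z) z)‖ ≤ ‖z‖ * B := by
    intro s hs
    have hfm : Measurable fun x : Euc d => fderiv ℝ W (x + s • z) :=
      (measurable_fderiv ℝ W).comp (by fun_prop)
    calc _ ≤ ∫ x, ‖z‖ * (‖σ x‖ * ‖fderiv ℝ W (x + s • z)‖) := by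
          refine norm_integral_le_of_norm_le ?_ (ae_of_all _ fun x => ?_)
          · refine Integrable.const_mul ?_ _
            refine Integrable.mono' (g := fun x => ‖σ x‖ * C) (hσ.norm.mul_const _)
              (hσ.aestronglyMeasurable.norm.mul hfm.norm.aestronglyMeasurable)
              (ae_of_all _ fun x => ?_)
            rw [norm_mul, norm_norm, norm_norm]
            gcongr
            exact norm_fderiv_le_of_lipschitz ℝ hW
          · refine (norm_inner_le_norm _ _).trans ?_
            calc _ ≤ ‖σ x‖ * (‖fderiv ℝ W (x + s • z)‖ * ‖z‖) := by
                  gcongr; exact ContinuousLinearMap.le_opNorm _ _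
              _ = _ := by ring
      _ = ‖z‖ * ∫ x, (‖σ x‖ * ‖fderiv ℝ W (x + s • z)‖) := integral_const_mul _ _
      _ ≤ _ := by gcongr; exact hB s hs
  have mv := norm_image_sub_le_of_norm_deriv_le_segment_01'
    (f := fun s : ℝ => ∫ x, inner ℝ (σ x) (W (x + s • z)))
    (fun s _ => (key s).hasDerivWithinAt) (C := ‖z‖ * B) (fun s hs => bound s ⟨hs.1, hs.2.le⟩)
  have hint : ∀ y : Euc d, Integrable fun x => inner ℝ (σ x) (W (x + y)) := fun y => by
    refine Integrable.mono' (g := fun x => ‖σ x‖ * B0) (hσ.norm.mul_const _)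
        (hσ.aestronglyMeasurable.inner (hW.continuous.comp (by fun_prop)).aestronglyMeasurable)
        (ae_of_all _ fun x => ?_)
    exact (norm_inner_le_norm _ _).trans (by gcongr; exact hB0 _)
  rw [integral_sub (hint z) (by simpa using hint 0)]
  simpa using mv

def rho {d : ℕ} (x : Euc d) : ℝ := Real.sqrt (1 + ‖x‖ ^ 2)
def eta {d : ℕ} (x : Euc d) : ℝ := Real.exp (- rho x)
def Yf {d : ℕ} (x : Euc d) : Euc d := (eta x / rho x) • x

lemma rho_sq {d : ℕ} (x : Euc d) : rho x ^ 2 = 1 + ‖x‖ ^ 2 := Real.sq_sqrt (by positivity)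
lemma rho_ge_one {d : ℕ} (x : Euc d) : 1 ≤ rho x := by
  exact Real.one_le_sqrt.2 (by nlinarith [sq_nonneg ‖x‖])
lemma rho_pos {d : ℕ} (x : Euc d) : 0 < rho x := lt_of_lt_of_le one_pos (rho_ge_one x)
lemma norm_le_rho {d : ℕ} (x : Euc d) : ‖x‖ ≤ rho x :=
  Real.le_sqrt_of_sq_le (by linarith)
lemma rho_le {d : ℕ} (x : Euc d) : rho x ≤ 1 + ‖x‖ := by
  rw [rho, Real.sqrt_le_left (by positivity)]; nlinarith [norm_nonneg x]
lemma eta_pos {d : ℕ} (x : Euc d) : 0 < eta x := Real.exp_pos _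
lemma eta_le_one {d : ℕ} (x : Euc d) : eta x ≤ 1 := by
  rw [eta, Real.exp_le_one_iff]; linarith [rho_pos x]
lemma eta_ge {d : ℕ} (x : Euc d) : Real.exp (-(1 + ‖x‖)) ≤ eta x :=
  Real.exp_le_exp.2 (by linarith [rho_le x])

lemma hasFDerivAt_rho {d : ℕ} (x : Euc d) :
    HasFDerivAt rho ((rho x)⁻¹ • innerSL ℝ x) x := by
  have h1 : HasFDerivAt (fun x : Euc d => 1 + ‖x‖ ^ 2) ((2 : ℝ) • innerSL ℝ x) x := by
    have := (hasStrictFDerivAt_norm_sq x).hasFDerivAt.const_add 1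
    simpa [ofNat_smul_eq_nsmul] using this
  have h2 := h1.sqrt (by positivity)
  convert! h2 using 1
  ext h
  simp [rho]
  field_simp

lemma hasFDerivAt_eta {d : ℕ} (x : Euc d) :
    HasFDerivAt eta (-(innerSL ℝ (Yf x))) x := by
  have := (hasFDerivAt_rho x).neg.exp
  convert! this using 1
  ext h
  simp [Yf, eta, inner_smul_left, div_eq_mul_inv]
  ring

def DY {d : ℕ} (x : Euc d) : Euc d →L[ℝ] Euc d :=
  (eta x / rho x) • ContinuousLinearMap.id ℝ (Euc d)
    - (eta x / rho x ^ 2 + eta x / rho x ^ 3) • (innerSL ℝ x).smulRight x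

lemma hasFDerivAt_Y {d : ℕ} (x : Euc d) : HasFDerivAt Yf (DY x) x := by
  have h0 := rho_pos x
  have h1 : HasFDerivAt (fun x : Euc d => eta x * (rho x)⁻¹) _ x :=
    (hasFDerivAt_eta x).mul ((hasDerivAt_inv h0.ne').comp_hasFDerivAt x (hasFDerivAt_rho x))
  have h2 := h1.smul (hasFDerivAt_id x)
  convert! h2 using 1
  ext1 h
  simp [DY, Yf, inner_smul_left]
  rw [sub_eq_add_neg, ← neg_smul, smul_smul]
  congr 2
  field_simp
  ring

lemma norm_Y_le {d : ℕ} (x : Euc d) : ‖Yf x‖ ≤ eta x := by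
  rw [Yf, norm_smul, Real.norm_eq_abs, abs_of_nonneg (div_pos (eta_pos x) (rho_pos x)).le,
    div_mul_eq_mul_div, div_le_iff₀ (rho_pos x)]
  exact mul_le_mul_of_nonneg_left (norm_le_rho x) (eta_pos x).le

lemma norm_DY_le {d : ℕ} (x : Euc d) : ‖DY x‖ ≤ 3 * eta x := by
  have h0 := rho_pos x
  have h1 := rho_ge_one x
  have he := eta_pos x
  have hn := norm_le_rho x
  have e2 : ‖x‖ ^ 2 ≤ rho x ^ 2 := by rw [rho_sq]; linarith
  have h3 : rho x ^ 2 ≤ rho x ^ 3 := by nlinarith [sq_nonneg (rho x)]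
  refine ContinuousLinearMap.opNorm_le_bound _ (by positivity) fun h => ?_
  simp only [DY, ContinuousLinearMap.sub_apply, ContinuousLinearMap.smul_apply,
    ContinuousLinearMap.id_apply, ContinuousLinearMap.smulRight_apply, innerSL_apply_apply]
  have a1 : ‖(eta x / rho x) • h‖ ≤ eta x * ‖h‖ := by
    rw [norm_smul, Real.norm_eq_abs, abs_of_pos (by positivity)]
    gcongr
    exact div_le_self he.le h1
  have a2 : ‖(eta x / rho x ^ 2 + eta x / rho x ^ 3) • (inner ℝ x h • x)‖ ≤ 2 * eta x * ‖h‖ := by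
    rw [norm_smul, norm_smul, Real.norm_eq_abs, abs_of_pos (by positivity)]
    have : ‖inner ℝ x h‖ ≤ ‖x‖ * ‖h‖ := norm_inner_le_norm _ _
    calc _ ≤ (eta x / rho x ^ 2 + eta x / rho x ^ 3) * (‖x‖ * ‖h‖ * ‖x‖) := by gcongr
      _ = (eta x / rho x ^ 2 + eta x / rho x ^ 3) * (‖x‖^2) * ‖h‖ := by ring
      _ ≤ (eta x / rho x ^ 2 + eta x / rho x ^ 2) * (rho x^2) * ‖h‖ := by gcongr
      _ = _ := by field_simp; ring
  calc _ ≤ _ := norm_sub_le _ _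
    _ ≤ eta x * ‖h‖ + 2 * eta x * ‖h‖ := add_le_add a1 a2
    _ = _ := by ring

lemma lip_eta {d : ℕ} : LipschitzWith 1 (eta : Euc d → ℝ) := by
  apply lipschitzWith_of_nnnorm_fderiv_le (𝕜 := ℝ) (fun x => (hasFDerivAt_eta x).differentiableAt)
  intro x
  rw [(hasFDerivAt_eta x).fderiv, ← NNReal.coe_le_coe]
  simpa using (norm_Y_le x).trans (eta_le_one x)

lemma lip_Y {d : ℕ} : LipschitzWith 3 (Yf : Euc d → Euc d) := by
  apply lipschitzWith_of_nnnorm_fderiv_le (𝕜 := ℝ) (fun x => (hasFDerivAt_Y x).differentiableAt)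
  intro x
  rw [(hasFDerivAt_Y x).fderiv, ← NNReal.coe_le_coe]
  have := norm_DY_le x
  have h2 := eta_le_one x
  simp; linarith

lemma sum_DY {d : ℕ} (x : Euc d) : ∑ i, (DY x (eb i)) i
    = (eta x / rho x) * d - (eta x / rho x ^ 2 + eta x / rho x ^ 3) * ‖x‖ ^ 2 := by
  have : ∀ i : Fin d, (DY x (eb i)) i
      = (eta x / rho x) - (eta x / rho x ^ 2 + eta x / rho x ^ 3) * (x i) ^ 2 := by
    intro i
    simp [DY, eb, EuclideanSpace.inner_single_right]
    left; ring
  simp_rw [this]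
  rw [Finset.sum_sub_distrib, ← Finset.mul_sum, EuclideanSpace.norm_sq_eq]
  simp [mul_comm]

lemma integrable_eta {d : ℕ} : Integrable (eta : Euc d → ℝ) := by
  have h := integrable_one_add_norm (E := Euc d) (μ := volume) (r := ((d + 1 : ℕ) : ℝ)) (by simp)
  refine (h.const_mul ((d+1).factorial * 2 ^ (d+1))).mono' lip_eta.continuous.aestronglyMeasurable
    (ae_of_all _ fun x => ?_)
  rw [Real.norm_eq_abs, abs_of_pos (eta_pos x), Real.rpow_neg (by positivity), Real.rpow_natCast]
  have h1 := Real.pow_div_factorial_le_exp (rho x) (rho_pos x).le (d+1)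
  have h2 : 1 + ‖x‖ ≤ 2 * rho x := by linarith [rho_ge_one x, norm_le_rho x]
  have h3 : (1 + ‖x‖) ^ (d+1) ≤ (2 * rho x) ^ (d+1) := by gcongr
  rw [mul_pow] at h3
  rw [eta, Real.exp_neg]
  rw [div_le_iff₀ (by positivity)] at h1
  rw [← div_eq_mul_inv, inv_eq_one_div, div_le_div_iff₀ (Real.exp_pos _) (by positivity)]
  calc _ ≤ 2 ^ (d+1) * rho x ^ (d+1) := by simpa using h3
    _ ≤ 2 ^ (d+1) * (Real.exp (rho x) * (d+1).factorial) := by gcongr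
    _ = _ := by ring

lemma int_eta_pos {d : ℕ} : 0 < ∫ x : Euc d, eta x := by
  rw [integral_pos_iff_support_of_nonneg (fun x => (eta_pos x).le) integrable_eta]
  have : Function.support (eta : Euc d → ℝ) = Set.univ := by
    ext x; simp [(eta_pos x).ne']
  rw [this]; exact isOpen_univ.measure_pos _ Set.univ_nonempty

/-- integrability of `‖Df‖ η`. -/
lemma integrable_fderiv_eta {d : ℕ} {F : Type*} [NormedAddCommGroup F] [NormedSpace ℝ F]
    [CompleteSpace F] {C : NNReal} {U : Euc d → F} (hU : LipschitzWith C U) :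
    Integrable (fun x => ‖fderiv ℝ U x‖ * eta x) := by
  refine (integrable_eta.const_mul (C:ℝ)).mono'
    ((measurable_fderiv ℝ U).norm.mul lip_eta.continuous.measurable).aestronglyMeasurable
    (ae_of_all _ fun x => ?_)
  rw [norm_mul, norm_norm, Real.norm_eq_abs, abs_of_pos (eta_pos x)]
  exact mul_le_mul_of_nonneg_right (norm_fderiv_le_of_lipschitz ℝ hU) (eta_pos x).le

lemma lyapunov {d : ℕ} {C : NNReal} {g : Euc d → ℝ} (hg : LipschitzWith C g)
    (hc : HasCompactSupport g) (h0 : ∀ x, 0 ≤ g x) :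
    (1/2) * ∫ x, g x * eta x ≤ (∫ x, ‖fderiv ℝ g x‖ * eta x) +
      (d + 2) * ∫ x in closedBall (0 : Euc d) (2 * (d + 1)), g x := by
  classical
  have hgi : Integrable g := hg.continuous.integrable_of_hasCompactSupport hc
  have hgei : Integrable fun x => g x * eta x :=
    (hg.continuous.mul lip_eta.continuous).integrable_of_hasCompactSupport hc.mul_right
  have h1 := ibp hg hc (lip_Y (d := d))
  have e1 : ∫ x, g x * ∑ i, (fderiv ℝ Yf x (eb i)) i =
      ∫ x, g x * ((eta x / rho x) * d - (eta x / rho x ^ 2 + eta x / rho x ^ 3) * ‖x‖ ^ 2) := by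
    congr 1; ext x; rw [(hasFDerivAt_Y x).fderiv, sum_DY]
  have e2 : ∫ x, fderiv ℝ g x (Yf x) ≤ ∫ x, ‖fderiv ℝ g x‖ * eta x := by
    refine (Real.le_norm_self _).trans (norm_integral_le_of_norm_le (integrable_fderiv_eta hg)
      (ae_of_all _ fun x => ?_))
    exact (ContinuousLinearMap.le_opNorm _ _).trans (by gcongr; exact norm_Y_le x)
  have e3 : (1/2) * ∫ x, g x * eta x ≤
      (∫ x, -(g x * ((eta x / rho x) * d - (eta x / rho x ^ 2 + eta x / rho x ^ 3) * ‖x‖ ^ 2)))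
      + (d + 2) * ∫ x in closedBall (0 : Euc d) (2 * (d + 1)), g x := by
    rw [← integral_indicator isClosed_closedBall.measurableSet, ← integral_const_mul,
      ← integral_const_mul, ← integral_add]
    · refine integral_mono (hgei.const_mul _) ?_ ?_
      · refine Integrable.add ?_ ((hgi.indicator isClosed_closedBall.measurableSet).const_mul _)
        refine (Integrable.neg ?_)
        have hr : Continuous (rho : Euc d → ℝ) := by unfold rho; fun_prop
        have hee : Continuous (eta : Euc d → ℝ) := lip_eta.continuous
        refine Continuous.integrable_of_hasCompactSupport ?_ hc.mul_right
        refine hg.continuous.mul ?_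
        refine ((hee.div hr fun x => (rho_pos x).ne').mul_const _).sub
          (((hee.div (hr.pow 2) fun x => (pow_pos (rho_pos x) _).ne').add
            (hee.div (hr.pow 3) fun x => (pow_pos (rho_pos x) _).ne')).mul (by fun_prop))
      · intro x
        have hr := rho_pos x
        have hr1 := rho_ge_one x
        have he := eta_pos x
        have he1 := eta_le_one x
        have hs := rho_sq x
        have hx2 : ‖x‖ ^ 2 = rho x ^ 2 - 1 := by linarith
        have key : (1/2) * eta x - (if x ∈ closedBall (0 : Euc d) (2 * (d + 1)) then (d+2:ℝ) else 0)
            ≤ -((eta x / rho x) * d - (eta x / rho x ^ 2 + eta x / rho x ^ 3) * ‖x‖ ^ 2) := by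
          have p3 : 0 ≤ eta x / rho x ^ 3 * ‖x‖ ^ 2 := by positivity
          have p2 : eta x / rho x ^ 2 * ‖x‖ ^ 2 = eta x - eta x / rho x ^ 2 := by
            rw [hx2]; field_simp
          have p4 : eta x / rho x ^ 2 ≤ eta x / rho x := by
            apply div_le_div_of_nonneg_left he.le hr; nlinarith
          have p5 : eta x / rho x ≤ eta x := div_le_self he.le hr1
          split_ifs with hx
          · have : eta x / rho x * d ≤ 1 * d := by gcongr; linarith
            nlinarith
          · have hx' : 2 * (d+1:ℝ) ≤ rho x := by
              have : 2 * (d+1:ℝ) < ‖x‖ := by simpa using hx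
              linarith [norm_le_rho x]
            have : eta x / rho x * (d + 1) ≤ eta x / 2 := by
              rw [div_mul_eq_mul_div, div_le_div_iff₀ hr (by norm_num)]
              nlinarith
            nlinarith
        have := mul_le_mul_of_nonneg_left key (h0 x)
        simp only [Set.indicator]
        split_ifs at this ⊢ <;> nlinarith
    · have hr : Continuous (rho : Euc d → ℝ) := by unfold rho; fun_prop
      have hee : Continuous (eta : Euc d → ℝ) := lip_eta.continuous
      refine (Continuous.integrable_of_hasCompactSupport ?_ hc.mul_right).neg
      refine hg.continuous.mul ?_
      refine ((hee.div hr fun x => (rho_pos x).ne').mul_const _).sub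
          (((hee.div (hr.pow 2) fun x => (pow_pos (rho_pos x) _).ne').add
            (hee.div (hr.pow 3) fun x => (pow_pos (rho_pos x) _).ne')).mul (by fun_prop))
    · exact (hgi.indicator isClosed_closedBall.measurableSet).const_mul _
  rw [integral_neg, ← e1, ← h1] at e3
  linarith

def chi {d : ℕ} (n : ℕ) (x : Euc d) : ℝ := max 0 (min 1 (2 - ‖x‖ / (n + 1)))

lemma chi_nonneg {d : ℕ} (n : ℕ) (x : Euc d) : 0 ≤ chi n x := le_max_left _ _
lemma chi_le_one {d : ℕ} (n : ℕ) (x : Euc d) : chi n x ≤ 1 :=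
  max_le zero_le_one (min_le_left _ _)
lemma chi_lip {d : ℕ} (n : ℕ) :
    LipschitzWith (1 / ((n : NNReal) + 1)) (chi n : Euc d → ℝ) := by
  unfold chi
  apply LipschitzWith.const_max
  apply LipschitzWith.const_min
  apply LipschitzWith.of_dist_le_mul
  intro x y
  rw [Real.dist_eq, dist_eq_norm]
  have : (2 - ‖x‖ / ((n:ℝ) + 1)) - (2 - ‖y‖ / ((n:ℝ) + 1)) = (1 / ((n:ℝ)+1)) * (‖y‖ - ‖x‖) := by
    ring
  rw [this, abs_mul, abs_of_pos (by positivity)]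
  push_cast
  gcongr
  rw [norm_sub_rev]
  exact abs_norm_sub_norm_le y x
lemma chi_supp {d : ℕ} (n : ℕ) : HasCompactSupport (chi n : Euc d → ℝ) := by
  apply HasCompactSupport.intro (isCompact_closedBall (0 : Euc d) (2 * (n + 1)))
  intro x hx
  have : 2 * ((n:ℝ)+1) < ‖x‖ := by simpa using hx
  have : 2 < ‖x‖ / ((n:ℝ)+1) := by rwa [lt_div_iff₀ (by positivity)]
  exact max_eq_left ((min_le_right _ _).trans (by linarith))
lemma chi_one {d : ℕ} (x : Euc d) : ∀ᶠ n in atTop, chi n x = 1 := by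
  obtain ⟨m, hm⟩ := exists_nat_ge ‖x‖
  filter_upwards [eventually_ge_atTop m] with n hn
  have : ‖x‖ / ((n:ℝ)+1) ≤ 1 := by
    rw [div_le_one (by positivity)]
    have : (m:ℝ) ≤ n := by exact_mod_cast hn
    linarith
  rw [chi, min_eq_left (by linarith), max_eq_right zero_le_one]
lemma chi_tendsto {d : ℕ} (x : Euc d) : Tendsto (fun n => chi n x) atTop (nhds 1) :=
  tendsto_const_nhds.congr' ((chi_one x).mono fun _ h => h.symm)
lemma chi_fderiv {d : ℕ} (n : ℕ) (x : Euc d) : ‖fderiv ℝ (chi n) x‖ ≤ 1 / ((n:ℝ) + 1) := by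
  simpa using norm_fderiv_le_of_lipschitz ℝ (chi_lip (d := d) n) (x₀ := x)
lemma chi_fderiv_le_one {d : ℕ} (n : ℕ) (x : Euc d) : ‖fderiv ℝ (chi n) x‖ ≤ 1 :=
  (chi_fderiv n x).trans (by rw [div_le_one (by positivity)]; linarith [(n.cast_nonneg : (0:ℝ) ≤ n)])

lemma lip_mul {d : ℕ} {C D : NNReal} {f g : Euc d → ℝ} (hf : LipschitzWith C f)
    (hg : LipschitzWith D g) {A B : NNReal} (hA : ∀ x, |f x| ≤ A) (hB : ∀ x, |g x| ≤ B) :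
    LipschitzWith (A * D + C * B) (fun x => f x * g x) := by
  apply LipschitzWith.of_dist_le_mul
  intro x y
  have h1 := hf.dist_le_mul x y
  have h2 := hg.dist_le_mul x y
  rw [Real.dist_eq] at *
  have : f x * g x - f y * g y = f x * (g x - g y) + (f x - f y) * g y := by ring
  rw [this]
  refine (abs_add_le _ _).trans ?_
  rw [abs_mul, abs_mul]
  push_cast
  rw [add_mul]
  calc _ ≤ A * (D * dist x y) + (C * dist x y) * B := by gcongr <;> [exact hA x; exact hB y]
    _ = _ := by ring

lemma lip_smul {d : ℕ} {C D : NNReal} {f : Euc d → ℝ} {g : Euc d → Euc d} (hf : LipschitzWith C f)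
    (hg : LipschitzWith D g) {A B : NNReal} (hA : ∀ x, |f x| ≤ A) (hB : ∀ x, ‖g x‖ ≤ B) :
    LipschitzWith (A * D + C * B) (fun x => f x • g x) := by
  apply LipschitzWith.of_dist_le_mul
  intro x y
  have h1 := hf.dist_le_mul x y
  have h2 := hg.dist_le_mul x y
  rw [Real.dist_eq] at h1
  rw [dist_eq_norm] at h2 ⊢
  have : f x • g x - f y • g y = f x • (g x - g y) + (f x - f y) • g y := by
    rw [smul_sub, sub_smul]; abel
  rw [this]
  refine (norm_add_le _ _).trans ?_
  rw [norm_smul, norm_smul, Real.norm_eq_abs, Real.norm_eq_abs]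
  push_cast
  rw [add_mul]
  calc _ ≤ A * (D * ‖x - y‖) + (C * dist x y) * B := by
        refine add_le_add (mul_le_mul (hA x) h2 (norm_nonneg _) A.2)
          (mul_le_mul h1 (hB y) (norm_nonneg _) (by positivity))
    _ = _ := by rw [dist_eq_norm]; ring

lemma meas_fderiv_apply {d : ℕ} {f : Euc d → ℝ} {w : Euc d → Euc d} (hw : Measurable w) :
    Measurable fun x => fderiv ℝ f x (w x) := by
  exact (ContinuousLinearMap.measurable_apply₂).comp ((measurable_fderiv ℝ f).prodMk hw)

/-- divergence-free test against weighted functions -/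
lemma div_free' {d : ℕ} {C D M : NNReal} {φ : Euc d → ℝ} {w : Euc d → Euc d}
    (hφ : LipschitzWith C φ) (hM : ∀ x, |φ x| ≤ M * eta x) (hw : LipschitzWith D w)
    {M' : ℝ} (hM' : ∀ᵐ x, ‖fderiv ℝ φ x‖ ≤ M' * eta x)
    {K : ℝ} (hK : ∀ x, ‖w x‖ ≤ K)
    (hdiv : ∀ᵐ x, LinearMap.trace ℝ (Euc d) (fderiv ℝ w x).toLinearMap = 0) :
    ∫ x, fderiv ℝ φ x (w x) = 0 := by
  have hM1 : ∀ x, |φ x| ≤ M := fun x => (hM x).trans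
    (mul_le_of_le_one_right M.2 (eta_le_one x))
  have hK0 : 0 ≤ K := (norm_nonneg _).trans (hK 0)
  have hn : ∀ n : ℕ, ∫ x, fderiv ℝ (fun x => φ x * chi n x) x (w x) = 0 := by
    intro n
    refine div_free (lip_mul hφ (chi_lip n) (A := M) (B := 1) hM1 fun x => ?_) (chi_supp n).mul_left
      hw hdiv
    rw [abs_of_nonneg (chi_nonneg n x)]; exact chi_le_one n x
  have hlim : Tendsto (fun n : ℕ => ∫ x, fderiv ℝ (fun x => φ x * chi n x) x (w x)) atTop
      (nhds (∫ x, fderiv ℝ φ x (w x))) := by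
    have hder : ∀ᵐ x, ∀ n : ℕ, fderiv ℝ (fun x => φ x * chi n x) x (w x)
        = φ x * fderiv ℝ (chi n) x (w x) + chi n x * fderiv ℝ φ x (w x) := by
      filter_upwards [hφ.ae_differentiableAt,
        ae_all_iff.2 fun n : ℕ => (chi_lip (d := d) n).ae_differentiableAt] with x h1 h2 n
      rw [fderiv_fun_mul h1 (h2 n)]
      simp
    apply tendsto_integral_of_dominated_convergence (fun x => (M + M') * K * eta x)
    · intro n
      exact (meas_fderiv_apply hw.continuous.measurable).aestronglyMeasurable
    · exact integrable_eta.const_mul _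
    · intro n
      filter_upwards [hder, hM'] with x hx hm
      rw [hx n]
      have a1 : ‖fderiv ℝ (chi n) x (w x)‖ ≤ 1 * K :=
        (ContinuousLinearMap.le_opNorm _ _).trans
          (mul_le_mul (chi_fderiv_le_one n x) (hK x) (norm_nonneg _) zero_le_one)
      have a2 : ‖fderiv ℝ φ x (w x)‖ ≤ M' * eta x * K :=
        (ContinuousLinearMap.le_opNorm _ _).trans
          (mul_le_mul hm (hK x) (norm_nonneg _) ((norm_nonneg _).trans hm))
      calc _ ≤ ‖φ x‖ * ‖fderiv ℝ (chi n) x (w x)‖ + ‖chi n x‖ * ‖fderiv ℝ φ x (w x)‖ := by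
            rw [← norm_mul, ← norm_mul]; exact norm_add_le _ _
        _ ≤ (M * eta x) * (1 * K) + 1 * (M' * eta x * K) := by
            refine add_le_add (mul_le_mul (hM x) a1 (norm_nonneg _) ?_)
              (mul_le_mul ?_ a2 (norm_nonneg _) zero_le_one)
            · exact mul_nonneg M.2 (eta_pos x).le
            · rw [Real.norm_eq_abs, abs_of_nonneg (chi_nonneg n x)]; exact chi_le_one n x
        _ = _ := by ring
    · filter_upwards [hder] with x hx
      simp_rw [hx]
      have t1 : Tendsto (fun n : ℕ => fderiv ℝ (chi n) x (w x)) atTop (nhds 0) := by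
        apply squeeze_zero_norm (a := fun n : ℕ => 1 / ((n:ℝ)+1) * K)
        · intro n
          exact (ContinuousLinearMap.le_opNorm _ _).trans
            (mul_le_mul (chi_fderiv n x) (hK x) (norm_nonneg _) (by positivity))
        · simpa using tendsto_one_div_add_atTop_nhds_zero_nat.mul_const K
      have := (t1.const_mul (φ x)).add ((chi_tendsto x).mul_const (fderiv ℝ φ x (w x)))
      simpa using this
  simp_rw [hn] at hlim
  exact (tendsto_nhds_unique hlim tendsto_const_nhds)

lemma lyapunov' {d : ℕ} {C M : NNReal} {g : Euc d → ℝ} (hg : LipschitzWith C g)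
    (hM : ∀ x, g x ≤ M) (h0 : ∀ x, 0 ≤ g x) :
    (1/2) * ∫ x, g x * eta x ≤ (∫ x, ‖fderiv ℝ g x‖ * eta x) +
      (d + 2) * ∫ x in closedBall (0 : Euc d) (2 * (d + 1)), g x := by
  have hgi : Integrable fun x => g x * eta x := by
    refine (integrable_eta.const_mul (M:ℝ)).mono' (hg.continuous.mul lip_eta.continuous).aestronglyMeasurable
      (ae_of_all _ fun x => ?_)
    rw [norm_mul, Real.norm_eq_abs, Real.norm_eq_abs, abs_of_nonneg (h0 x), abs_of_pos (eta_pos x)]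
    exact mul_le_mul_of_nonneg_right (hM x) (eta_pos x).le
  have hgB : IntegrableOn g (closedBall (0 : Euc d) (2 * (d + 1))) :=
    hg.continuous.continuousOn.integrableOn_compact (isCompact_closedBall _ _)
  have hn : ∀ n : ℕ, (1/2) * ∫ x, (g x * chi n x) * eta x ≤ ((∫ x, ‖fderiv ℝ g x‖ * eta x)
       + (1 / ((n:ℝ)+1)) * (M * ∫ x : Euc d, eta x)) +
      (d + 2) * ∫ x in closedBall (0 : Euc d) (2 * (d + 1)), g x := by
    intro n
    have hgM : ∀ x, |g x| ≤ M := fun x => by rw [abs_of_nonneg (h0 x)]; exact hM x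
    have hl := lip_mul hg (chi_lip n) (A := M) (B := 1) hgM fun x => by
      rw [abs_of_nonneg (chi_nonneg n x)]; exact chi_le_one n x
    refine (lyapunov hl (chi_supp n).mul_left
      (fun x => mul_nonneg (h0 x) (chi_nonneg n x))).trans ?_
    refine add_le_add ?_ ?_
    · rw [← integral_const_mul, ← integral_const_mul, ← integral_add (integrable_fderiv_eta hg)
        ((integrable_eta.const_mul _).const_mul _)]
      apply integral_mono_ae (integrable_fderiv_eta hl)
        ((integrable_fderiv_eta hg).add ((integrable_eta.const_mul _).const_mul _))
      filter_upwards [hg.ae_differentiableAt, (chi_lip (d := d) n).ae_differentiableAt] with x h1 h2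
      rw [fderiv_fun_mul h1 h2]
      have : ‖g x • fderiv ℝ (chi n) x + chi n x • fderiv ℝ g x‖ ≤
          M * (1 / ((n:ℝ)+1)) + 1 * ‖fderiv ℝ g x‖ := by
        refine (norm_add_le _ _).trans ?_
        rw [norm_smul, norm_smul]
        gcongr
        · exact hgM x
        · exact chi_fderiv n x
        · rw [Real.norm_eq_abs, abs_of_nonneg (chi_nonneg n x)]; exact chi_le_one n x
      refine (mul_le_mul_of_nonneg_right this (eta_pos x).le).trans (le_of_eq ?_)
      simp only [Pi.add_apply]; ring
    · refine mul_le_mul_of_nonneg_left (setIntegral_mono ?_ hgB ?_) (by positivity)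
      · exact (hl.continuous.continuousOn.integrableOn_compact (isCompact_closedBall _ _))
      · intro x
        exact mul_le_of_le_one_right (h0 x) (chi_le_one n x)
  have t1 : Tendsto (fun n : ℕ => (1/2) * ∫ x, (g x * chi n x) * eta x) atTop
      (nhds ((1/2) * ∫ x, g x * eta x)) := by
    apply Tendsto.const_mul
    refine tendsto_integral_of_dominated_convergence _ (fun n => ?_) hgi (fun n => ?_) ?_
    · exact ((hg.continuous.mul (chi_lip n).continuous).mul lip_eta.continuous).aestronglyMeasurable
    · refine ae_of_all _ fun x => ?_
      rw [Real.norm_eq_abs, abs_of_nonneg (mul_nonneg (mul_nonneg (h0 x) (chi_nonneg n x)) (eta_pos x).le)]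
      exact mul_le_mul_of_nonneg_right (mul_le_of_le_one_right (h0 x) (chi_le_one n x)) (eta_pos x).le
    · refine ae_of_all _ fun x => ?_
      simpa using ((chi_tendsto x).const_mul (g x)).mul_const (eta x)
  have t2 : Tendsto (fun n : ℕ => ((∫ x, ‖fderiv ℝ g x‖ * eta x)
       + (1 / ((n:ℝ)+1)) * (M * ∫ x : Euc d, eta x)) +
      (d + 2) * ∫ x in closedBall (0 : Euc d) (2 * (d + 1)), g x) atTop (nhds
      ((∫ x, ‖fderiv ℝ g x‖ * eta x)  +
      (d + 2) * ∫ x in closedBall (0 : Euc d) (2 * (d + 1)), g x)) := by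
    apply Tendsto.add_const
    simpa using (tendsto_one_div_add_atTop_nhds_zero_nat.mul_const (M * ∫ x : Euc d, eta x)).const_add
      (∫ x, ‖fderiv ℝ g x‖ * eta x)
  exact le_of_tendsto_of_tendsto' t1 t2 hn

lemma fderiv_abs_le {d : ℕ} {f : Euc d → ℝ} {x : Euc d} (h1 : DifferentiableAt ℝ f x)
    (h2 : DifferentiableAt ℝ (fun y => |f y|) x) :
    ‖fderiv ℝ (fun y => |f y|) x‖ ≤ ‖fderiv ℝ f x‖ := by
  refine le_of_forall_pos_le_add fun ε hε => ?_
  refine h2.hasFDerivAt.le_of_lip' (by positivity) ?_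
  have := h1.hasFDerivAt.isLittleO.def hε
  filter_upwards [this] with y hy
  have e1 : ‖|f y| - |f x|‖ ≤ ‖f y - f x‖ := by
    rw [Real.norm_eq_abs, Real.norm_eq_abs]; exact abs_abs_sub_abs_le _ _
  refine e1.trans ?_
  have : f y - f x = (f y - f x - fderiv ℝ f x (y - x)) + fderiv ℝ f x (y - x) := by ring
  rw [this]
  refine (norm_add_le _ _).trans ?_
  have := (fderiv ℝ f x).le_opNorm (y - x)
  rw [add_mul]; linarith

lemma ball_trans {d : ℕ} {C : NNReal} {U : Euc d → ℝ} (hU : LipschitzWith C U)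
    (hb : ∀ x, |U x| ≤ 1) (R : ℝ) (hR : 0 ≤ R) (z : Euc d) (hz : ‖z‖ ≤ 2 * R) :
    ∫ x in closedBall (0 : Euc d) R, |U (x + z) - U x| ≤
      2 * R * (Real.exp (1 + 3 * R) * ∫ x, ‖fderiv ℝ U x‖ * eta x) := by
  classical
  set B := closedBall (0 : Euc d) R
  have hBm : MeasurableSet B := isClosed_closedBall.measurableSet
  set s : Euc d → ℝ := fun x => SignType.sign (U (x + z) - U x)
  have hUc := hU.continuous
  have hsm : Measurable s := by
    have : s = fun x => (if 0 < U (x+z) - U x then 1 else if U (x+z) - U x < 0 then -1 else 0) := by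
      ext x; simp only [s, sign_apply]; split_ifs <;> simp
    rw [this]
    refine Measurable.ite ?_ measurable_const (Measurable.ite ?_ measurable_const measurable_const)
    · exact measurableSet_lt measurable_const (by fun_prop)
    · exact measurableSet_lt (by fun_prop) measurable_const
  have hs1 : ∀ x, ‖s x‖ ≤ 1 := by
    intro x
    simp only [s]
    rcases SignType.sign (U (x + z) - U x) <;> simp
  set σ : Euc d → ℝ := B.indicator s
  have hσi : Integrable σ := by
    rw [integrable_indicator_iff hBm]
    exact Measure.integrableOn_of_bounded (isCompact_closedBall _ _).measure_lt_top.ne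
      hsm.aestronglyMeasurable (ae_of_all _ hs1)
  have hA : 0 ≤ ∫ x, ‖fderiv ℝ U x‖ * eta x :=
    integral_nonneg fun x => mul_nonneg (norm_nonneg _) (eta_pos x).le
  have key := trans_est hU hσi ⟨1, hb⟩ z (Real.exp (1 + 3 * R) * ∫ x, ‖fderiv ℝ U x‖ * eta x) ?_
  · have e : ∫ x in B, |U (x + z) - U x| = ∫ x, inner ℝ (σ x) (U (x + z)) - inner ℝ (σ x) (U x) := by
      rw [← integral_indicator hBm]
      congr 1; ext x
      by_cases hx : x ∈ B
      · simp only [σ, Set.indicator_of_mem hx, s]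
        rw [← inner_sub_right, real_inner_eq_re_inner]
        simp
      · simp [σ, Set.indicator_of_notMem hx]
    rw [e]
    refine (le_abs_self _).trans (key.trans ?_)
    gcongr
  · intro r hr
    have h1 : ∫ x, ‖fderiv ℝ U x‖ * eta x = ∫ x, ‖fderiv ℝ U (x + r • z)‖ * eta (x + r • z) :=
      (integral_add_right_eq_self (fun x => ‖fderiv ℝ U x‖ * eta x) (r • z)).symm
    rw [h1, ← integral_const_mul]
    have hi := (integrable_fderiv_eta hU).comp_add_right (r • z)
    refine integral_mono_of_nonneg (ae_of_all _ fun x => by positivity) (hi.const_mul _)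
      (ae_of_all _ fun x => ?_)
    simp only
    by_cases hx : x ∈ B
    · have hx' : ‖x‖ ≤ R := by simpa [B] using hx
      have hn : ‖x + r • z‖ ≤ 3 * R := by
        refine (norm_add_le _ _).trans ?_
        rw [norm_smul, Real.norm_eq_abs, abs_of_nonneg hr.1]
        nlinarith [hr.2, norm_nonneg z]
      have h2 : 1 ≤ Real.exp (1 + 3 * R) * eta (x + r • z) := by
        have := eta_ge (x + r • z)
        have h3 : Real.exp (-(1 + 3 * R)) ≤ Real.exp (-(1 + ‖x + r • z‖)) :=
          Real.exp_le_exp.2 (by linarith)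
        calc (1:ℝ) = Real.exp (1 + 3 * R) * Real.exp (-(1 + 3 * R)) := by
              rw [← Real.exp_add]; simp
          _ ≤ _ := by gcongr; linarith
      have hσ1 : ‖σ x‖ ≤ 1 := by simp only [σ, Set.indicator_of_mem hx]; exact hs1 x
      calc ‖σ x‖ * ‖fderiv ℝ U (x + r • z)‖ ≤ 1 * ‖fderiv ℝ U (x + r • z)‖ := by gcongr
        _ ≤ (Real.exp (1 + 3 * R) * eta (x + r • z)) * ‖fderiv ℝ U (x + r • z)‖ := by gcongr
        _ = _ := by ring
    · simp only [σ, Set.indicator_of_notMem hx]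
      simp
      have := eta_pos (x + r • z)
      positivity

lemma poincare_ball {d : ℕ} (R : ℝ) (hR : 0 < R) : ∃ CP : ℝ, 0 ≤ CP ∧ ∀ (C : NNReal) (U : Euc d → ℝ),
    LipschitzWith C U → (∀ x, U x ∈ Set.Icc (0:ℝ) 1) → ∃ p ∈ Set.Icc (0:ℝ) 1,
    ∫ x in closedBall (0 : Euc d) R, |U x - p| ≤ CP * ∫ x, ‖fderiv ℝ U x‖ * eta x := by
  set B := closedBall (0 : Euc d) R with hB
  set B2 := closedBall (0 : Euc d) (2 * R) with hB2
  have hBm : MeasurableSet B := isClosed_closedBall.measurableSet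
  have hBc : IsCompact B := isCompact_closedBall _ _
  have hB2c : IsCompact B2 := isCompact_closedBall _ _
  set V := volume.real B with hV
  have hVpos : 0 < V := ENNReal.toReal_pos (measure_closedBall_pos _ _ hR).ne' hBc.measure_lt_top.ne
  refine ⟨V⁻¹ * (volume.real B2 * (2 * R * Real.exp (1 + 3 * R))), by positivity, ?_⟩
  intro C U hU hb
  have hUc := hU.continuous
  have hb1 : ∀ x, |U x| ≤ 1 := fun x => by rw [abs_of_nonneg (hb x).1]; exact (hb x).2
  have hUi : IntegrableOn U B := hUc.continuousOn.integrableOn_compact hBc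
  refine ⟨V⁻¹ * ∫ x in B, U x, ⟨?_, ?_⟩, ?_⟩
  · have : 0 ≤ ∫ x in B, U x := integral_nonneg fun x => (hb x).1
    positivity
  · rw [inv_mul_le_iff₀ hVpos, mul_one]
    calc ∫ x in B, U x ≤ ∫ x in B, (1:ℝ) :=
          integral_mono hUi (integrableOn_const hBc.measure_lt_top.ne) fun x => (hb x).2
      _ = V := by simp [V]
  set A := ∫ x, ‖fderiv ℝ U x‖ * eta x with hAdef
  -- product integrability
  have hint : Integrable (Function.uncurry fun x z => |U (x + z) - U x|)
      ((volume.restrict B).prod (volume.restrict B2)) := by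
    rw [Measure.prod_restrict]
    refine ContinuousOn.integrableOn_compact (hBc.prod hB2c) (Continuous.continuousOn ?_)
    simp only [Function.uncurry_def]; fun_prop
  have step1 : ∀ x ∈ B, |U x - V⁻¹ * ∫ y in B, U y| ≤ V⁻¹ * ∫ z in B2, |U (x + z) - U x| := by
    intro x hx
    have e1 : U x - V⁻¹ * ∫ y in B, U y = V⁻¹ * ∫ y in B, (U x - U y) := by
      have hci : IntegrableOn (fun _ : Euc d => U x) B := integrableOn_const hBc.measure_lt_top.ne
      rw [integral_sub hci hUi, setIntegral_const, smul_eq_mul, mul_sub, ← hV,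
        inv_mul_cancel_left₀ hVpos.ne']
    rw [e1, abs_mul, abs_of_pos (inv_pos.2 hVpos)]
    gcongr
    refine abs_integral_le_integral_abs.trans ?_
    have e2 : ∫ y in B, |U x - U y| = ∫ z, B.indicator (fun y => |U x - U y|) (x + z) := by
      rw [← integral_indicator hBm]
      exact (integral_add_left_eq_self (fun y => B.indicator (fun y => |U x - U y|) y) x).symm
    rw [e2, ← integral_indicator isClosed_closedBall.measurableSet]
    have hint2 : Integrable (B2.indicator fun z => |U (x + z) - U x|) := by
      rw [integrable_indicator_iff isClosed_closedBall.measurableSet]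
      exact ContinuousOn.integrableOn_compact hB2c (Continuous.continuousOn (by fun_prop))
    refine integral_mono_of_nonneg (ae_of_all _ fun z => ?_) hint2 (ae_of_all _ fun z => ?_)
    · exact Set.indicator_nonneg (fun _ _ => abs_nonneg _) _
    · simp only
      by_cases hz : x + z ∈ B
      · have hz2 : z ∈ B2 := by
          simp only [hB, hB2, mem_closedBall_zero_iff] at *
          calc ‖z‖ = ‖(x + z) - x‖ := by simp
            _ ≤ _ := norm_sub_le _ _
            _ ≤ _ := by linarith
        rw [Set.indicator_of_mem hz, Set.indicator_of_mem hz2, abs_sub_comm]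
      · rw [Set.indicator_of_notMem hz]
        exact Set.indicator_nonneg (fun _ _ => abs_nonneg _) _
  calc ∫ x in B, |U x - V⁻¹ * ∫ y in B, U y| ≤ ∫ x in B, V⁻¹ * ∫ z in B2, |U (x + z) - U x| := by
        refine setIntegral_mono_on ?_ ?_ hBm step1
        · exact ContinuousOn.integrableOn_compact hBc (Continuous.continuousOn (by fun_prop))
        · exact hint.integral_prod_left.const_mul _
    _ = V⁻¹ * ∫ x in B, ∫ z in B2, |U (x + z) - U x| := integral_const_mul _ _
    _ = V⁻¹ * ∫ z in B2, ∫ x in B, |U (x + z) - U x| := by rw [integral_integral_swap hint]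
    _ ≤ V⁻¹ * ∫ z in B2, 2 * R * (Real.exp (1 + 3 * R) * A) := by
        refine mul_le_mul_of_nonneg_left ?_ (by positivity)
        refine setIntegral_mono_on hint.integral_prod_right
          (integrableOn_const hB2c.measure_lt_top.ne) isClosed_closedBall.measurableSet ?_
        intro z hz
        exact ball_trans hU hb1 R hR.le z (by simpa [hB2] using hz)
    _ = _ := by simp [Measure.real]; ring

lemma poincare (d : ℕ) : ∃ CP : ℝ, 0 < CP ∧ ∀ (C : NNReal) (U : Euc d → ℝ),
    LipschitzWith C U → (∀ x, U x ∈ Set.Icc (0:ℝ) 1) → ∃ p ∈ Set.Icc (0:ℝ) 1,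
    ∫ x, |U x - p| * eta x ≤ CP * ∫ x, ‖fderiv ℝ U x‖ * eta x := by
  obtain ⟨CP, h0, h⟩ := poincare_ball (d := d) (2 * (d + 1)) (by positivity)
  refine ⟨2 * (1 + (d + 2) * CP), by positivity, fun C U hU hb => ?_⟩
  obtain ⟨p, hp, hle⟩ := h C U hU hb
  refine ⟨p, hp, ?_⟩
  have hg : LipschitzWith C fun x => |U x - p| := by
    have h2 : LipschitzWith C fun x => U x - p := by
      apply LipschitzWith.of_dist_le_mul
      intro x y; simpa using hU.dist_le_mul x y
    apply LipschitzWith.of_dist_le_mul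
    intro x y
    refine le_trans ?_ (h2.dist_le_mul x y)
    rw [Real.dist_eq, Real.dist_eq]; exact abs_abs_sub_abs_le _ _
  have ly := lyapunov' (M := 1) hg (fun x => by
    rw [abs_le]; constructor <;> simp <;> linarith [hp.1, hp.2, (hb x).1, (hb x).2])
    (fun x => abs_nonneg _)
  have hd : ∫ x, ‖fderiv ℝ (fun x => |U x - p|) x‖ * eta x ≤ ∫ x, ‖fderiv ℝ U x‖ * eta x := by
    refine integral_mono_ae (integrable_fderiv_eta hg) (integrable_fderiv_eta hU) ?_
    filter_upwards [hU.ae_differentiableAt, hg.ae_differentiableAt] with x h1 h2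
    have := fderiv_abs_le (h1.sub_const p) h2
    rw [fderiv_sub_const] at this
    exact mul_le_mul_of_nonneg_right this (eta_pos x).le
  have h3 := mul_le_mul_of_nonneg_left hle (by positivity : (0:ℝ) ≤ d + 2)
  nlinarith

def boxQ (d : ℕ) (ℓ : ℝ) : Set (Euc d) := {y : Euc d | ∀ i, y i ∈ Set.Icc (0:ℝ) ℓ}

lemma boxQ_eq (d : ℕ) (ℓ : ℝ) : boxQ d ℓ =
    (@WithLp.ofLp 2 (Fin d → ℝ)) ⁻¹' (Set.Icc (fun _ => (0:ℝ)) (fun _ => ℓ)) := by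
  ext y
  simp [boxQ, Pi.le_def, forall_and]

lemma boxQ_meas (d : ℕ) (ℓ : ℝ) : MeasurableSet (boxQ d ℓ) := by
  rw [boxQ_eq]; exact (PiLp.volume_preserving_ofLp (Fin d)).measurable measurableSet_Icc

lemma boxQ_vol (d : ℕ) (ℓ : ℝ) (hℓ : 0 ≤ ℓ) : volume.real (boxQ d ℓ) = ℓ ^ d := by
  rw [boxQ_eq, Measure.real, (PiLp.volume_preserving_ofLp (Fin d)).measure_preimage
    measurableSet_Icc.nullMeasurableSet, Real.volume_Icc_pi]
  simp [ENNReal.toReal_ofReal hℓ]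

lemma boxQ_norm (d : ℕ) (ℓ : ℝ) (hℓ : 0 ≤ ℓ) (y : Euc d) (hy : y ∈ boxQ d ℓ) : ‖y‖ ≤ d * ℓ := by
  conv_lhs => rw [sum_eb y]
  refine (norm_sum_le _ _).trans ?_
  calc ∑ i, ‖y i • eb i‖ ≤ ∑ i : Fin d, ℓ := by
        apply Finset.sum_le_sum; intro i _
        rw [norm_smul]
        simp [eb]
        rw [abs_of_nonneg (hy i).1]; exact (hy i).2
    _ = _ := by simp

lemma boxQ_compact (d : ℕ) (ℓ : ℝ) (hℓ : 0 ≤ ℓ) : volume (boxQ d ℓ) ≠ ⊤ := by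
  refine ((measure_mono (fun y hy => ?_)).trans_lt
    (isCompact_closedBall (0 : Euc d) (d * ℓ)).measure_lt_top).ne
  simpa using boxQ_norm d ℓ hℓ y hy

section core
variable {d : ℕ} {C D : NNReal} {U : Euc d → ℝ} {w : Euc d → Euc d} {K p : ℝ}

lemma test_id (hU : LipschitzWith C U) (hb : ∀ x, U x ∈ Set.Icc (0:ℝ) 1) (hp : p ∈ Set.Icc (0:ℝ) 1)
    (hw : LipschitzWith D w) (hK : ∀ x, ‖w x‖ ≤ K)
    (hdiv : ∀ᵐ x, LinearMap.trace ℝ (Euc d) (fderiv ℝ w x).toLinearMap = 0) :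
    ∫ x, fderiv ℝ U x (w x) * eta x = ∫ x, inner ℝ (w x) ((U x - p) • Yf x) := by
  have hUp : LipschitzWith C fun x => U x - p := by
    apply LipschitzWith.of_dist_le_mul
    intro x y; simpa using hU.dist_le_mul x y
  have hUp1 : ∀ x, |U x - p| ≤ (1 : NNReal) := by
    intro x
    rw [abs_le]; constructor <;> simp <;> linarith [hp.1, hp.2, (hb x).1, (hb x).2]
  have he1 : ∀ x : Euc d, |eta x| ≤ (1 : NNReal) := fun x => by
    rw [abs_of_pos (eta_pos x)]; exact eta_le_one x
  have hφ := lip_mul hUp lip_eta hUp1 he1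
  have hder : ∀ᵐ x, fderiv ℝ (fun x => (U x - p) * eta x) x
      = (U x - p) • (-(innerSL ℝ (Yf x))) + eta x • fderiv ℝ U x := by
    filter_upwards [hU.ae_differentiableAt] with x hx
    rw [fderiv_fun_mul (hx.sub_const p) (hasFDerivAt_eta x).differentiableAt,
      (hasFDerivAt_eta x).fderiv, fderiv_sub_const]
  have h := div_free' (M := 1) hφ (fun x => by
      rw [abs_mul, abs_of_pos (eta_pos x)]
      exact mul_le_mul_of_nonneg_right (hUp1 x) (eta_pos x).le) hw (M' := 1 + C) ?_ hK hdiv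
  · have e : ∀ᵐ x, fderiv ℝ (fun x => (U x - p) * eta x) x (w x)
        = fderiv ℝ U x (w x) * eta x - inner ℝ (w x) ((U x - p) • Yf x) := by
      filter_upwards [hder] with x hx
      rw [hx]
      simp [inner_smul_right, real_inner_comm]
      ring
    rw [integral_congr_ae e, integral_sub] at h
    · linarith
    · refine (integrable_eta.const_mul (C * K)).mono' ((meas_fderiv_apply
        hw.continuous.measurable).mul lip_eta.continuous.measurable).aestronglyMeasurable
        (ae_of_all _ fun x => ?_)
      rw [norm_mul, Real.norm_eq_abs (eta x), abs_of_pos (eta_pos x)]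
      gcongr
      · exact (eta_pos x).le
      · exact (ContinuousLinearMap.le_opNorm _ _).trans (mul_le_mul
          (norm_fderiv_le_of_lipschitz ℝ hU) (hK x) (norm_nonneg _) C.2)
    · refine (integrable_eta.const_mul K).mono' (Continuous.aestronglyMeasurable
        (hw.continuous.inner (hUp.continuous.smul lip_Y.continuous))) (ae_of_all _ fun x => ?_)
      refine (norm_inner_le_norm _ _).trans ?_
      refine mul_le_mul (hK x) ?_ (norm_nonneg _) ((norm_nonneg _).trans (hK x))
      rw [norm_smul]
      calc _ ≤ 1 * eta x := mul_le_mul (hUp1 x) (norm_Y_le x) (norm_nonneg _) zero_le_one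
        _ = _ := one_mul _
  · filter_upwards [hder] with x hx
    rw [hx]
    refine (norm_add_le _ _).trans ?_
    rw [norm_smul, norm_smul, norm_neg, innerSL_apply_norm, add_mul, Real.norm_eq_abs (eta x),
      abs_of_pos (eta_pos x), mul_comm (eta x)]
    refine add_le_add ?_ ?_
    · exact mul_le_mul (hUp1 x) (norm_Y_le x) (norm_nonneg _) zero_le_one
    · exact mul_le_mul_of_nonneg_right (norm_fderiv_le_of_lipschitz ℝ hU) (eta_pos x).le

/-- translation estimate with bounded `σ` and integrable `W`. -/
lemma trans_est' {W : Euc d → Euc d} (hW : LipschitzWith C W) (hWi : Integrable W)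
    (hWb : ∃ B, ∀ x, ‖W x‖ ≤ B) (hDW : Integrable fun x => ‖fderiv ℝ W x‖)
    (hw : Continuous w) (hK : ∀ x, ‖w x‖ ≤ K) (z : Euc d) :
    |∫ x, inner ℝ (w x) (W (x + z)) - inner ℝ (w x) (W x)| ≤ ‖z‖ * (K * ∫ x, ‖fderiv ℝ W x‖) := by
  have hK0 : 0 ≤ K := (norm_nonneg _).trans (hK 0)
  have hn : ∀ n : ℕ, |∫ x, inner ℝ (chi n x • w x) (W (x + z)) - inner ℝ (chi n x • w x) (W x)|
      ≤ ‖z‖ * (K * ∫ x, ‖fderiv ℝ W x‖) := by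
    intro n
    have hcn : ∀ x, ‖chi n x • w x‖ ≤ K := fun x => by
      rw [norm_smul, Real.norm_eq_abs, abs_of_nonneg (chi_nonneg n x)]
      calc _ ≤ 1 * K := mul_le_mul (chi_le_one n x) (hK x) (norm_nonneg _) zero_le_one
        _ = K := one_mul _
    refine trans_est hW ?_ hWb z _ ?_
    · exact ((chi_lip n).continuous.smul hw).integrable_of_hasCompactSupport (chi_supp n).smul_right
    · intro s hs
      rw [← integral_add_right_eq_self (fun x => ‖fderiv ℝ W x‖) (s • z), ← integral_const_mul]
      refine integral_mono_of_nonneg (ae_of_all _ fun x => by positivity)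
        ((hDW.comp_add_right (s • z)).const_mul K) (ae_of_all _ fun x => ?_)
      exact mul_le_mul_of_nonneg_right (hcn x) (norm_nonneg _)
  have hlim : Tendsto (fun n : ℕ => ∫ x, inner ℝ (chi n x • w x) (W (x + z)) -
      inner ℝ (chi n x • w x) (W x)) atTop
      (nhds (∫ x, inner ℝ (w x) (W (x + z)) - inner ℝ (w x) (W x))) := by
    have hWc := hW.continuous
    have hi : Integrable fun x => K * (‖W (x + z)‖ + ‖W x‖) :=
      ((hWi.comp_add_right z).norm.add hWi.norm).const_mul K
    refine tendsto_integral_of_dominated_convergence _ (fun n => ?_) hi (fun n => ?_) ?_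
    · have := (chi_lip (d := d) n).continuous
      exact Continuous.aestronglyMeasurable (by fun_prop)
    · refine ae_of_all _ fun x => ?_
      rw [← inner_sub_right]
      refine (norm_inner_le_norm _ _).trans ?_
      refine mul_le_mul ?_ (norm_sub_le _ _) (norm_nonneg _) hK0
      rw [norm_smul, Real.norm_eq_abs, abs_of_nonneg (chi_nonneg n x)]
      calc _ ≤ 1 * K := mul_le_mul (chi_le_one n x) (hK x) (norm_nonneg _) zero_le_one
        _ = K := one_mul _
    · refine ae_of_all _ fun x => ?_
      refine tendsto_const_nhds.congr' ?_
      filter_upwards [chi_one x] with n h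
      rw [h, one_smul]
  exact le_of_tendsto hlim.abs (Eventually.of_forall hn)

lemma core1 (d : ℕ) (K a b : ℝ) (hK0 : 0 ≤ K) (hab : a < b) : ∃ ℓ : ℝ, 0 < ℓ ∧ ∃ κ : ℝ, 0 < κ ∧
    ∀ (C D : NNReal) (U : Euc d → ℝ) (w : Euc d → Euc d), LipschitzWith C U →
      (∀ x, U x ∈ Set.Icc (0:ℝ) 1) → LipschitzWith D w → (∀ x, ‖w x‖ ≤ K) →
      (∀ᵐ x, LinearMap.trace ℝ (Euc d) (fderiv ℝ w x).toLinearMap = 0) →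
      (∀ x, ‖(ℓ ^ d)⁻¹ • ∫ y in boxQ d ℓ, w (x + y)‖ ≤ a) →
      ∃ p ∈ Set.Icc (0:ℝ) 1, κ * ∫ x, |U x - p| * eta x ≤
        ∫ x, (b * ‖fderiv ℝ U x‖ - fderiv ℝ U x (w x)) * eta x := by
  obtain ⟨CP, hCP, hpo⟩ := poincare d
  set ℓ := (b - a) / 2 / ((d + 1) * (K + 1) * (1 + 3 * CP)) with hℓ
  have hℓ0 : 0 < ℓ := by have : 0 < b - a := by linarith
                         positivity
  have hℓK : d * ℓ * (K * (1 + 3 * CP)) ≤ (b - a) / 2 := by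
    have h1 : ℓ * ((d + 1) * (K + 1) * (1 + 3 * CP)) = (b - a) / 2 := by
      rw [hℓ]; field_simp
    rw [← h1]
    have : (d:ℝ) * K ≤ (d + 1) * (K + 1) := by nlinarith [(d.cast_nonneg : (0:ℝ) ≤ d)]
    calc d * ℓ * (K * (1 + 3 * CP)) = ℓ * (d * K * (1 + 3 * CP)) := by ring
      _ ≤ _ := by gcongr
  refine ⟨ℓ, hℓ0, (b - a) / 2 / CP, by have : 0 < b - a := by linarith
                                       positivity, ?_⟩
  intro C D U w hU hb hw hK hdiv havg
  obtain ⟨p, hp, hN⟩ := hpo C U hU hb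
  refine ⟨p, hp, ?_⟩
  set A := ∫ x, ‖fderiv ℝ U x‖ * eta x with hA
  set N := ∫ x, |U x - p| * eta x with hNdef
  set Q := boxQ d ℓ
  have hUp : LipschitzWith C fun x => U x - p := by
    apply LipschitzWith.of_dist_le_mul
    intro x y; simpa using hU.dist_le_mul x y
  have hUp1 : ∀ x, |U x - p| ≤ (1 : NNReal) := by
    intro x
    rw [abs_le]; constructor <;> simp <;> linarith [hp.1, hp.2, (hb x).1, (hb x).2]
  set W : Euc d → Euc d := fun x => (U x - p) • Yf x with hWdef
  have hW := lip_smul hUp lip_Y hUp1 (B := 1) (fun x => (norm_Y_le x).trans (eta_le_one x))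
  have hWn : ∀ x, ‖W x‖ ≤ eta x := fun x => by
    rw [hWdef, norm_smul]
    calc _ ≤ 1 * eta x := mul_le_mul (hUp1 x) (norm_Y_le x) (norm_nonneg _) zero_le_one
        _ = _ := one_mul _
  have hWi : Integrable W := integrable_eta.mono' hW.continuous.aestronglyMeasurable (ae_of_all _ hWn)
  have hNi : Integrable fun x => |U x - p| * eta x := by
    refine integrable_eta.mono' (hUp.continuous.abs.mul lip_eta.continuous).aestronglyMeasurable
      (ae_of_all _ fun x => ?_)
    rw [norm_mul, Real.norm_eq_abs, abs_abs, Real.norm_eq_abs, abs_of_pos (eta_pos x)]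
    exact mul_le_of_le_one_left (eta_pos x).le (hUp1 x)
  have hAi := integrable_fderiv_eta hU
  have hDWle : ∀ᵐ x, ‖fderiv ℝ W x‖ ≤ ‖fderiv ℝ U x‖ * eta x + 3 * (|U x - p| * eta x) := by
    filter_upwards [hU.ae_differentiableAt] with x hx
    have := ((hx.hasFDerivAt.sub_const p).smul (hasFDerivAt_Y x)).fderiv
    rw [hWdef]
    simp only at this ⊢
    erw [this]
    refine (norm_add_le _ _).trans ?_
    rw [norm_smul, add_comm, Real.norm_eq_abs]
    refine add_le_add ?_ ?_
    · rw [ContinuousLinearMap.norm_smulRight_apply]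
      exact mul_le_mul_of_nonneg_left (norm_Y_le x) (norm_nonneg _)
    · have := mul_le_mul_of_nonneg_left (norm_DY_le x) (abs_nonneg (U x - p))
      linarith
  have hDWi : Integrable fun x => ‖fderiv ℝ W x‖ := by
    refine (hAi.add (hNi.const_mul 3)).mono' (measurable_fderiv ℝ W).norm.aestronglyMeasurable ?_
    simpa using hDWle
  have hDW : ∫ x, ‖fderiv ℝ W x‖ ≤ A + 3 * N := by
    rw [hA, hNdef, ← integral_const_mul, ← integral_add hAi (hNi.const_mul 3)]
    exact integral_mono_ae hDWi (hAi.add (hNi.const_mul 3)) hDWle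
  have hA0 : 0 ≤ A := integral_nonneg fun x => mul_nonneg (norm_nonneg _) (eta_pos x).le
  set J : Euc d → ℝ := fun y => ∫ x, fderiv ℝ U x (w (x + y)) * eta x with hJ
  have hwy : ∀ y : Euc d, LipschitzWith D fun x => w (x + y) := by
    intro y
    apply LipschitzWith.of_dist_le_mul
    intro x x'; simpa using hw.dist_le_mul (x + y) (x' + y)
  have hdivy : ∀ y : Euc d, ∀ᵐ x, LinearMap.trace ℝ (Euc d)
      (fderiv ℝ (fun x => w (x + y)) x).toLinearMap = 0 := by
    intro y
    have := (measurePreserving_add_right (volume : Measure (Euc d)) y).quasiMeasurePreserving.ae hdiv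
    filter_upwards [this] with x hx
    rwa [fderiv_comp_add_right]
  have hJy : ∀ y ∈ Q, J 0 ≤ J y + d * ℓ * (K * (A + 3 * N)) := by
    intro y hy
    have e1 : ∀ y, J y = ∫ x, inner ℝ (w (x + y)) (W x) := fun y =>
      test_id hU hb hp (hwy y) (fun x => hK _) (hdivy y)
    have e2 : J y = ∫ x, inner ℝ (w x) (W (x + -y)) := by
      rw [e1, ← integral_add_right_eq_self (fun x => inner ℝ (w x) (W (x + -y))) y]
      simp
    have hi : ∀ z, Integrable fun x => inner ℝ (w x) (W (x + z)) := by
      intro z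
      have hc1 := hw.continuous
      have hc2 := hW.continuous
      refine ((hWi.comp_add_right z).norm.const_mul K).mono' (Continuous.aestronglyMeasurable
        (hc1.inner (hc2.comp (by fun_prop)))) (ae_of_all _ fun x => ?_)
      exact (norm_inner_le_norm _ _).trans (mul_le_mul_of_nonneg_right (hK x) (norm_nonneg _))
    have e3 : J 0 = ∫ x, inner ℝ (w x) (W x) := by rw [e1]; simp
    have h0 : Integrable fun x => inner ℝ (w x) (W x) := by simpa using hi 0
    have h := trans_est' hW hWi ⟨1, fun x => (hWn x).trans (eta_le_one x)⟩ hDWi hw.continuous hK (-y)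
    rw [integral_sub (hi (-y)) h0, ← e2, ← e3, norm_neg] at h
    have h2 : ‖y‖ * (K * ∫ x, ‖fderiv ℝ W x‖) ≤ d * ℓ * (K * (A + 3 * N)) := by
      have := boxQ_norm d ℓ hℓ0.le y hy
      have : 0 ≤ ∫ x, ‖fderiv ℝ W x‖ := integral_nonneg fun x => norm_nonneg _
      gcongr
    have := abs_le.1 (h.trans h2)
    linarith
  have hfub : Integrable (Function.uncurry fun y x => fderiv ℝ U x (w (x + y)) * eta x)
      ((volume.restrict Q).prod volume) := by
    have hfin : IsFiniteMeasure (volume.restrict Q) :=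
      ⟨by rw [Measure.restrict_apply_univ]; exact (boxQ_compact d ℓ hℓ0.le).lt_top⟩
    have hd : Integrable (fun q : Euc d × Euc d => (C * K) * eta q.2)
        ((volume.restrict Q).prod volume) := by
      have := (integrable_const (μ := volume.restrict Q) (C * K : ℝ)).mul_prod (integrable_eta (d := d))
      simpa using this
    have hc1 := hw.continuous
    refine hd.mono' (Measurable.aestronglyMeasurable ?_) (ae_of_all _ fun q => ?_)
    · refine Measurable.mul ?_ (lip_eta.continuous.measurable.comp measurable_snd)
      refine (ContinuousLinearMap.measurable_apply₂).comp
        (((measurable_fderiv ℝ U).comp measurable_snd).prodMk ?_)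
      exact Continuous.measurable (by fun_prop)
    · rcases q with ⟨y, x⟩
      simp only [Function.uncurry]
      rw [norm_mul, Real.norm_eq_abs (eta x), abs_of_pos (eta_pos x)]
      refine mul_le_mul_of_nonneg_right ?_ (eta_pos x).le
      exact (ContinuousLinearMap.le_opNorm _ _).trans (mul_le_mul
          (norm_fderiv_le_of_lipschitz ℝ hU) (hK _) (norm_nonneg _) C.2)
  have hJi : IntegrableOn J Q := hfub.integral_prod_left
  have hpow : 0 < ℓ ^ d := by positivity
  have hsum : ∫ y in Q, J y ≤ ℓ ^ d * (a * A) := by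
    rw [hJ, integral_integral_swap hfub, hA, ← integral_const_mul, ← integral_const_mul]
    refine integral_mono hfub.integral_prod_right ((hAi.const_mul _).const_mul _) fun x => ?_
    simp only [Function.uncurry]
    have hwi : IntegrableOn (fun y => w (x + y)) Q :=
      Measure.integrableOn_of_bounded (boxQ_compact d ℓ hℓ0.le)
        (hw.continuous.comp (by fun_prop)).aestronglyMeasurable (ae_of_all _ fun y => hK (x + y))
    rw [integral_mul_const, ContinuousLinearMap.integral_comp_comm _ hwi]
    have h1 := havg x
    rw [norm_smul, norm_inv, Real.norm_eq_abs, abs_of_pos hpow, inv_mul_le_iff₀ hpow] at h1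
    calc _ ≤ (‖fderiv ℝ U x‖ * ‖∫ y in Q, w (x + y)‖) * eta x := by
          refine mul_le_mul_of_nonneg_right ?_ (eta_pos x).le
          exact (Real.le_norm_self _).trans (ContinuousLinearMap.le_opNorm _ _)
      _ ≤ (‖fderiv ℝ U x‖ * (ℓ ^ d * a)) * eta x := by
          refine mul_le_mul_of_nonneg_right ?_ (eta_pos x).le
          exact mul_le_mul_of_nonneg_left h1 (norm_nonneg _)
      _ = _ := by ring
  have hfinal : J 0 ≤ a * A + d * ℓ * (K * (A + 3 * N)) := by
    have h1 : ∫ y in Q, J 0 ≤ ∫ y in Q, (J y + d * ℓ * (K * (A + 3 * N))) :=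
      setIntegral_mono_on (integrableOn_const (boxQ_compact d ℓ hℓ0.le))
        (hJi.add (integrableOn_const (boxQ_compact d ℓ hℓ0.le))) (boxQ_meas d ℓ) hJy
    rw [integral_add hJi (integrableOn_const (boxQ_compact d ℓ hℓ0.le)), setIntegral_const,
      setIntegral_const, boxQ_vol d ℓ hℓ0.le, smul_eq_mul, smul_eq_mul] at h1
    have h2 : ℓ ^ d * J 0 ≤ ℓ ^ d * (a * A + d * ℓ * (K * (A + 3 * N))) := by linarith
    exact le_of_mul_le_mul_left h2 hpow
  have hint0 : Integrable fun x => fderiv ℝ U x (w x) * eta x := by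
    refine (integrable_eta.const_mul (C * K)).mono' ((meas_fderiv_apply
        hw.continuous.measurable).mul lip_eta.continuous.measurable).aestronglyMeasurable
        (ae_of_all _ fun x => ?_)
    rw [norm_mul, Real.norm_eq_abs (eta x), abs_of_pos (eta_pos x)]
    refine mul_le_mul_of_nonneg_right ?_ (eta_pos x).le
    exact (ContinuousLinearMap.le_opNorm _ _).trans (mul_le_mul
          (norm_fderiv_le_of_lipschitz ℝ hU) (hK x) (norm_nonneg _) C.2)
  have hres : ∫ x, (b * ‖fderiv ℝ U x‖ - fderiv ℝ U x (w x)) * eta x = b * A - J 0 := by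
    simp_rw [sub_mul, mul_assoc]
    rw [integral_sub (hAi.const_mul b) hint0, integral_const_mul]
    simp [hJ, hA]
  rw [hres]
  have h5 : d * ℓ * (K * (A + 3 * N)) ≤ d * ℓ * (K * (A + 3 * (CP * A))) := by gcongr
  have h6 : d * ℓ * (K * (A + 3 * (CP * A))) = (d * ℓ * (K * (1 + 3 * CP))) * A := by ring
  have h7 : (d * ℓ * (K * (1 + 3 * CP))) * A ≤ (b - a) / 2 * A := by gcongr
  have h8 : (b - a) / 2 / CP * N ≤ (b - a) / 2 * A := by
    have hba : 0 < b - a := by linarith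
    calc (b - a) / 2 / CP * N ≤ (b - a) / 2 / CP * (CP * A) := by gcongr
      _ = _ := by field_simp
  linarith

end core

lemma coreL (d : ℕ) (K a b L : ℝ) (hK0 : 0 ≤ K) (hab : a < b) (hL : 0 < L) :
    ∃ ζ : Euc d → ℝ, Continuous ζ ∧ (∀ x, 0 < ζ x) ∧ (∀ x, ζ x ≤ 1) ∧ Integrable ζ ∧
      (∃ β : ℝ, 0 < β ∧ ∀ x, Real.exp (-(1 + β * ‖x‖)) ≤ ζ x) ∧ ∃ κ : ℝ, 0 < κ ∧
    ∀ (C D : NNReal) (U : Euc d → ℝ) (w : Euc d → Euc d), LipschitzWith C U →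
      (∀ x, U x ∈ Set.Icc (0:ℝ) 1) → LipschitzWith D w → (∀ x, ‖w x‖ ≤ K) →
      (∀ᵐ x, LinearMap.trace ℝ (Euc d) (fderiv ℝ w x).toLinearMap = 0) →
      (∀ x, ‖(L ^ d)⁻¹ • ∫ y in boxQ d L, w (x + y)‖ ≤ a) →
      ∃ p ∈ Set.Icc (0:ℝ) 1, κ * ∫ x, |U x - p| * ζ x ≤
        ∫ x, (b * ‖fderiv ℝ U x‖ - fderiv ℝ U x (w x)) * ζ x := by
  obtain ⟨ℓ, hℓ, κ, hκ, h⟩ := core1 d K a b hK0 hab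
  set r := L / ℓ with hr
  have hr0 : 0 < r := by positivity
  refine ⟨fun x => eta (r⁻¹ • x), lip_eta.continuous.comp (by fun_prop), fun x => eta_pos _,
    fun x => eta_le_one _, ?_, ⟨r⁻¹, by positivity, fun x => ?_⟩, κ / r, by positivity, ?_⟩
  · exact (integrable_comp_smul_iff volume eta (inv_ne_zero hr0.ne')).2 integrable_eta
  · refine le_trans (le_of_eq ?_) (eta_ge _)
    rw [norm_smul, Real.norm_eq_abs, abs_of_pos (inv_pos.2 hr0)]
  intro C D U w hU hb hw hK hdiv havg
  have hU' : LipschitzWith (C * r.toNNReal) fun x => U (r • x) := by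
    apply LipschitzWith.of_dist_le_mul
    intro x y
    refine (hU.dist_le_mul _ _).trans (le_of_eq ?_)
    rw [dist_smul₀, Real.norm_eq_abs, abs_of_pos hr0, NNReal.coe_mul, Real.coe_toNNReal _ hr0.le]; ring
  have hw' : LipschitzWith (D * r.toNNReal) fun x => w (r • x) := by
    apply LipschitzWith.of_dist_le_mul
    intro x y
    refine (hw.dist_le_mul _ _).trans (le_of_eq ?_)
    rw [dist_smul₀, Real.norm_eq_abs, abs_of_pos hr0, NNReal.coe_mul, Real.coe_toNNReal _ hr0.le]; ring
  have hfr : Module.finrank ℝ (Euc d) = d := by simp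
  have hc : 0 < |(r ^ d)⁻¹| := by positivity
  have h1 : ∀ᵐ x, LinearMap.trace ℝ (Euc d) (fderiv ℝ (fun x => w (r • x)) x).toLinearMap = 0 := by
    filter_upwards [(Measure.quasiMeasurePreserving_smul (volume : Measure (Euc d)) hr0.ne').ae hdiv] with x hx
    rw [fderiv_comp_smul]
    simp [hx]
  have h2 : ∀ x, ‖(ℓ ^ d)⁻¹ • ∫ y in boxQ d ℓ, w (r • (x + y))‖ ≤ a := by
    intro x
    have e : ∫ y in boxQ d ℓ, w (r • (x + y)) = |(r ^ d)⁻¹| • ∫ y in boxQ d L, w (r • x + y) := by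
      have := Measure.integral_comp_smul volume
        ((boxQ d L).indicator fun y : Euc d => w (r • x + y)) r
      rw [hfr, integral_indicator (boxQ_meas d L)] at this
      rw [← this, ← integral_indicator (boxQ_meas d ℓ)]
      congr 1; ext1 y
      have hmem : y ∈ boxQ d ℓ ↔ r • y ∈ boxQ d L := by
        simp only [boxQ, Set.mem_ofPred_eq, Set.mem_Icc, PiLp.smul_apply, smul_eq_mul]
        refine forall_congr' fun i => ?_
        rw [mul_nonneg_iff_of_pos_left hr0, hr, div_mul_eq_mul_div, div_le_iff₀ hℓ,
          mul_le_mul_iff_right₀ hL]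
      by_cases hy : y ∈ boxQ d ℓ
      · rw [Set.indicator_of_mem hy, Set.indicator_of_mem (hmem.1 hy), smul_add]
      · rw [Set.indicator_of_notMem hy, Set.indicator_of_notMem (fun hh => hy (hmem.2 hh))]
    rw [e, smul_smul]
    have : (ℓ ^ d)⁻¹ * |(r ^ d)⁻¹| = (L ^ d)⁻¹ := by
      rw [abs_of_pos (by positivity), hr, div_pow]; field_simp
    rw [this]
    exact havg _
  obtain ⟨p, hp, hle⟩ := h _ _ (fun x => U (r • x)) (fun x => w (r • x)) hU' (fun x => hb _) hw'
    (fun x => hK _) h1 h2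
  · refine ⟨p, hp, ?_⟩
    have e1 : ∫ x, |U (r • x) - p| * eta x = |(r ^ d)⁻¹| * ∫ x, |U x - p| * eta (r⁻¹ • x) := by
      have := Measure.integral_comp_smul volume (fun x : Euc d => |U x - p| * eta (r⁻¹ • x)) r
      rw [hfr, smul_eq_mul] at this
      rw [← this]
      congr 1; ext x; rw [inv_smul_smul₀ hr0.ne']
    have e2 : ∫ x, (b * ‖fderiv ℝ (fun x => U (r • x)) x‖ - fderiv ℝ (fun x => U (r • x)) x (w (r • x))) * eta x
        = r * (|(r ^ d)⁻¹| * ∫ x, (b * ‖fderiv ℝ U x‖ - fderiv ℝ U x (w x)) * eta (r⁻¹ • x)) := by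
      have := Measure.integral_comp_smul volume (fun x : Euc d =>
        (b * ‖fderiv ℝ U x‖ - fderiv ℝ U x (w x)) * eta (r⁻¹ • x)) r
      rw [hfr, smul_eq_mul] at this
      rw [← this, ← integral_const_mul]
      congr 1; ext x
      rw [inv_smul_smul₀ hr0.ne', fderiv_comp_smul, norm_smul, Real.norm_eq_abs, abs_of_pos hr0]
      simp; ring
    rw [e1, e2] at hle
    have h3 : |(r ^ d)⁻¹| * (κ * ∫ x, |U x - p| * eta (r⁻¹ • x)) ≤
       |(r ^ d)⁻¹| * (r * ∫ x, (b * ‖fderiv ℝ U x‖ - fderiv ℝ U x (w x)) * eta (r⁻¹ • x)) := by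
      linarith
    have h4 := le_of_mul_le_mul_left h3 hc
    rw [div_mul_eq_mul_div, div_le_iff₀ hr0]
    linarith

lemma Reachable.refl' {d : ℕ} (c : ℝ → Euc d → ℝ) (v : ℝ → Euc d → Euc d) (t : ℝ) (x : Euc d) :
    Reachable c v t x t x := by
  refine ⟨le_rfl, fun _ => x, fun _ => 0, by simp, ?_, rfl, ?_⟩
  · intro s hs; simp
  · have : volume.restrict (Set.Icc t t) = (0 : Measure ℝ) := by
      rw [Measure.restrict_eq_zero]; simp
    rw [this]; simp

lemma Reachable.trans' {d : ℕ} {c : ℝ → Euc d → ℝ} {v : ℝ → Euc d → Euc d} {t0 t1 t2 : ℝ}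
    {x y z : Euc d} (h1 : Reachable c v t0 x t1 y) (h2 : Reachable c v t1 y t2 z) :
    Reachable c v t0 x t2 z := by
  classical
  obtain ⟨h01, γ1, g1, i1, e1, f1, a1⟩ := h1
  obtain ⟨h12, γ2, g2, i2, e2, f2, a2⟩ := h2
  set γ : ℝ → Euc d := fun t => if t ≤ t1 then γ1 t else γ2 t
  set g : ℝ → Euc d := fun t => if t ≤ t1 then g1 t else g2 t
  have j1 : ∀ t ∈ Set.Icc t0 t1, ∫ s in t0..t, g s = ∫ s in t0..t, g1 s := by
    intro t ht
    apply intervalIntegral.integral_congr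
    intro s hs
    rw [Set.uIcc_of_le ht.1] at hs
    simp [g, hs.2.trans ht.2]
  have j2 : ∀ t, t1 ≤ t → ∫ s in t1..t, g s = ∫ s in t1..t, g2 s := by
    intro t ht
    apply intervalIntegral.integral_congr_ae
    refine ae_of_all _ fun s hs => ?_
    rw [Set.uIoc_of_le ht] at hs
    simp [g, hs.1]
  have ii1 : IntervalIntegrable g volume t0 t1 := by
    refine i1.congr ?_
    intro s hs
    rw [Set.uIoc_of_le h01] at hs
    simp [g, hs.2]
  have ii2 : IntervalIntegrable g volume t1 t2 := by
    refine i2.congr ?_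
    intro s hs
    rw [Set.uIoc_of_le h12] at hs
    simp [g, hs.1]
  have hy : x + ∫ s in t0..t1, g1 s = y := by rw [← e1 t1 ⟨h01, le_rfl⟩, f1]
  refine ⟨h01.trans h12, γ, g, ii1.trans ii2, ?_, ?_, ?_⟩
  · intro t ht
    by_cases h : t ≤ t1
    · rw [j1 t ⟨ht.1, h⟩, ← e1 t ⟨ht.1, h⟩]; simp [γ, h]
    · push Not at h
      have hs : IntervalIntegrable g volume t1 t :=
        ii2.mono_set (by rw [Set.uIcc_of_le h.le, Set.uIcc_of_le h12]; exact Set.Icc_subset_Icc le_rfl ht.2)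
      rw [← intervalIntegral.integral_add_adjacent_intervals ii1 hs, j1 t1 ⟨h01, le_rfl⟩, j2 t h.le,
        ← add_assoc, hy, ← e2 t ⟨h.le, ht.2⟩]
      simp [γ, h]
  · by_cases h : t2 ≤ t1
    · have : t1 = t2 := le_antisymm h12 h
      subst this
      simp only [γ, le_refl, if_true]
      rw [f1, ← f2, e2 t1 ⟨le_rfl, le_rfl⟩]; simp
    · simp [γ, h, f2]
  · rw [ae_restrict_iff' measurableSet_Icc] at *
    filter_upwards [a1, a2] with s h1 h2 hs
    by_cases h : s ≤ t1
    · simpa [γ, g, h] using h1 ⟨hs.1, h⟩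
    · push Not at h
      simpa [γ, g, h.not_ge] using h2 ⟨h.le, hs.2⟩

lemma Reachable.shift {d : ℕ} {c : ℝ → Euc d → ℝ} {v : ℝ → Euc d → Euc d} {t0 t1 : ℝ}
    {x0 x1 : Euc d} (s : ℝ) (y : Euc d)
    (h : Reachable (fun t x => c (t + s) (x + y)) (fun t x => v (t + s) (x + y)) t0 x0 t1 x1) :
    Reachable c v (t0 + s) (x0 + y) (t1 + s) (x1 + y) := by
  obtain ⟨h01, γ, g, i, e, f, a⟩ := h
  refine ⟨by linarith, fun t => γ (t - s) + y, fun t => g (t - s), ?_, ?_, ?_, ?_⟩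
  · simpa using i.comp_sub_right s
  · intro t ht
    have : t - s ∈ Set.Icc t0 t1 := ⟨by linarith [ht.1], by linarith [ht.2]⟩
    simp only
    rw [e _ this, intervalIntegral.integral_comp_sub_right]
    simp; abel
  · simp [f]
  · rw [ae_restrict_iff' measurableSet_Icc] at *
    have := (measurePreserving_sub_right (volume : Measure ℝ) s).quasiMeasurePreserving.ae a
    filter_upwards [this] with t h1 ht
    simpa using h1 ⟨by linarith [ht.1], by linarith [ht.2]⟩

lemma Reachable.reverse {d : ℕ} {c : ℝ → Euc d → ℝ} {v : ℝ → Euc d → Euc d} {t0 t1 : ℝ}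
    {x0 x1 : Euc d} (T : ℝ)
    (h : Reachable (fun t x => c (T - t) x) (fun t x => - v (T - t) x) t0 x0 t1 x1) :
    Reachable c v (T - t1) x1 (T - t0) x0 := by
  obtain ⟨h01, γ, g, i, e, f, a⟩ := h
  have hx : x0 + ∫ s in t0..t1, g s = x1 := by rw [← e t1 ⟨h01, le_rfl⟩, f]
  refine ⟨by linarith, fun t => γ (T - t), fun t => - g (T - t), ?_, ?_, ?_, ?_⟩
  · have := (i.comp_sub_left T).neg.symm
    exact this
  · intro t ht
    have : T - t ∈ Set.Icc t0 t1 := ⟨by linarith [ht.2], by linarith [ht.1]⟩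
    simp only
    rw [e _ this, intervalIntegral.integral_neg, intervalIntegral.integral_comp_sub_left, ← hx]
    simp only [sub_sub_cancel]
    have i1 : IntervalIntegrable g volume t0 (T - t) :=
      i.mono_set (by rw [Set.uIcc_of_le this.1, Set.uIcc_of_le h01]; exact Set.Icc_subset_Icc le_rfl this.2)
    have i2 : IntervalIntegrable g volume (T - t) t1 :=
      i.mono_set (by rw [Set.uIcc_of_le this.2, Set.uIcc_of_le h01]; exact Set.Icc_subset_Icc this.1 le_rfl)
    rw [← intervalIntegral.integral_add_adjacent_intervals i1 i2]
    abel
  · simp only [sub_sub_cancel]; rw [e t0 ⟨le_rfl, h01⟩]; simp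
  · rw [ae_restrict_iff' measurableSet_Icc] at *
    have := (Measure.measurePreserving_sub_left (volume : Measure ℝ) T).quasiMeasurePreserving.ae a
    filter_upwards [this] with t h1 ht
    have h2 := h1 ⟨by linarith [ht.2], by linarith [ht.1]⟩
    simp only [sub_sub_cancel, sub_neg_eq_add] at h2
    rw [← norm_neg, neg_sub, sub_neg_eq_add, add_comm]
    exact h2

structure Env {d : ℕ} (K Lp a b L : ℝ) (md : ℝ → ℝ) (c : ℝ → Euc d → ℝ) (v : ℝ → Euc d → Euc d) :
    Prop where
  cK : ∀ t x, c t x ≤ K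
  vK : ∀ t x, ‖v t x‖ ≤ K
  uc : ∀ ε, 0 < ε → ∀ t t', |t - t'| ≤ md ε → ∀ x, |c t x - c t' x| ≤ ε ∧ ‖v t x - v t' x‖ ≤ ε
  lip : ∀ t x x', |c t x - c t x'| ≤ Lp * ‖x - x'‖ ∧ ‖v t x - v t x'‖ ≤ Lp * ‖x - x'‖
  dv : ∀ t, ∀ᵐ x ∂(volume : Measure (Euc d)),
      LinearMap.trace ℝ (Euc d) (fderiv ℝ (fun y => v t y) x).toLinearMap = 0
  av : ∀ t x, ‖(L ^ d)⁻¹ • ∫ y in boxQ d L, v t (x + y)‖ ≤ a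
  cb : ∀ t x, b ≤ c t x

lemma Env.shift {d : ℕ} {K Lp a b L : ℝ} {md : ℝ → ℝ} {c : ℝ → Euc d → ℝ} {v : ℝ → Euc d → Euc d}
    (h : Env K Lp a b L md c v) (s : ℝ) (y : Euc d) :
    Env K Lp a b L md (fun t x => c (t + s) (x + y)) (fun t x => v (t + s) (x + y)) where
  cK t x := h.cK _ _
  vK t x := h.vK _ _
  uc ε hε t t' ht x := h.uc ε hε _ _ (by simpa using ht) _
  lip t x x' := by simpa using h.lip (t + s) (x + y) (x' + y)
  dv t := by
    have := (measurePreserving_add_right (volume : Measure (Euc d)) y).quasiMeasurePreserving.ae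
      (h.dv (t + s))
    filter_upwards [this] with x hx
    rwa [fderiv_comp_add_right (f := fun x => v (t + s) x)]
  av t x := by
    have := h.av (t + s) (x + y)
    simp_rw [add_right_comm x y] at this
    exact this
  cb t x := h.cb _ _

lemma Env.reverse {d : ℕ} {K Lp a b L : ℝ} {md : ℝ → ℝ} {c : ℝ → Euc d → ℝ} {v : ℝ → Euc d → Euc d}
    (h : Env K Lp a b L md c v) (T : ℝ) :
    Env K Lp a b L md (fun t x => c (T - t) x) (fun t x => - v (T - t) x) where
  cK t x := h.cK _ _
  vK t x := by rw [norm_neg]; exact h.vK _ _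
  uc ε hε t t' ht x := by
    have := h.uc ε hε (T - t) (T - t') (by rw [abs_sub_comm]; simpa using ht) x
    rwa [← neg_sub', norm_neg]
  lip t x x' := by
    have := h.lip (T - t) x x'
    rwa [← neg_sub', norm_neg]
  dv t := by
    filter_upwards [h.dv (T - t)] with x hx
    rw [fderiv_fun_neg]
    simp [hx]
  av t x := by
    rw [integral_neg, smul_neg, norm_neg]; exact h.av _ _
  cb t x := h.cb _ _

lemma reach_line {d : ℕ} {K Lp a b L : ℝ} {md : ℝ → ℝ} {c : ℝ → Euc d → ℝ} {v : ℝ → Euc d → Euc d}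
    (H : Env K Lp a b L md c v) {b' h0 : ℝ} (hLp : 0 ≤ Lp) (hb : 0 ≤ b') (hbb : b' < b)
    (h1 : h0 ≤ md ((b - b') / 2)) (h2 : Lp * (h0 * (K + b')) ≤ (b - b') / 2)
    {t h : ℝ} {x x' p : Euc d} (hh : 0 < h) (hh0 : h ≤ h0) (hp : p = x ∨ p = x')
    (hx : ‖x' - x - h • v t p‖ ≤ h * b') : Reachable c v t x (t + h) x' := by
  have hK : 0 ≤ K := (norm_nonneg _).trans (H.vK 0 0)
  have hg : ‖h⁻¹ • (x' - x) - v t p‖ ≤ b' := by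
    have : h⁻¹ • (x' - x) - v t p = h⁻¹ • (x' - x - h • v t p) := by
      rw [smul_sub h⁻¹ (x' - x), inv_smul_smul₀ hh.ne']
    rw [this, norm_smul, norm_inv, Real.norm_eq_abs, abs_of_pos hh, inv_mul_le_iff₀ hh]
    exact hx
  have hd : ‖x' - x‖ ≤ h0 * (K + b') := by
    have e : x' - x = (x' - x - h • v t p) + h • v t p := by abel
    rw [e]
    refine (norm_add_le _ _).trans ?_
    rw [norm_smul, Real.norm_eq_abs, abs_of_pos hh]
    have := H.vK t p
    calc _ ≤ h * b' + h * K := by gcongr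
      _ = h * (K + b') := by ring
      _ ≤ _ := by gcongr
  refine ⟨by linarith, fun s => x + ((s - t) / h) • (x' - x), fun _ => h⁻¹ • (x' - x), by simp, ?_, ?_, ?_⟩
  · intro s hs
    simp [div_eq_mul_inv]
    rw [← smul_sub, smul_smul, mul_comm]
  · simp [hh.ne']
  · rw [ae_restrict_iff' measurableSet_Icc]
    refine ae_of_all _ fun s hs => ?_
    set q := x + ((s - t) / h) • (x' - x) with hq
    have h01 : 0 ≤ (s - t) / h := div_nonneg (by linarith [hs.1]) hh.le
    have h02 : (s - t) / h ≤ 1 := by rw [div_le_one hh]; linarith [hs.2]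
    have hqp : ‖p - q‖ ≤ h0 * (K + b') := by
      refine le_trans ?_ hd
      rcases hp with rfl | rfl
      · rw [hq, sub_add_cancel_left, norm_neg, norm_smul, Real.norm_eq_abs, abs_of_nonneg h01]
        exact mul_le_of_le_one_left (norm_nonneg _) h02
      · have : p - q = (1 - (s - t) / h) • (p - x) := by rw [hq, sub_smul, one_smul]; abel
        rw [this, norm_smul, Real.norm_eq_abs, abs_of_nonneg (by linarith)]
        exact mul_le_of_le_one_left (norm_nonneg _) (by linarith)
    have a1 := (H.uc ((b - b') / 2) (by linarith) t s
      (by rw [abs_sub_comm, abs_of_nonneg (by linarith [hs.1])]; linarith [hs.2]) p).2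
    have a2 := (H.lip s p q).2
    have a3 : Lp * ‖p - q‖ ≤ Lp * (h0 * (K + b')) := by gcongr
    have e : h⁻¹ • (x' - x) - v s q = (h⁻¹ • (x' - x) - v t p) + (v t p - v s p) + (v s p - v s q) := by
      abel
    have := H.cb s q
    show ‖h⁻¹ • (x' - x) - v s q‖ ≤ c s q
    rw [e]
    refine (norm_add₃_le).trans ?_
    linarith

inductive Chain {d : ℕ} (v : ℝ → Euc d → Euc d) (b' h0 t0 : ℝ) (y : Euc d) : ℝ → Euc d → Prop
  | refl : Chain v b' h0 t0 y t0 y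
  | step {t h : ℝ} {x x' : Euc d} (hc : Chain v b' h0 t0 y t x) (hh : 0 < h) (hh0 : h ≤ h0)
      (hx : ‖x' - x - h • v t x'‖ ≤ h * b') : Chain v b' h0 t0 y (t + h) x'

section chain
variable {d : ℕ} {K Lp a b L : ℝ} {md : ℝ → ℝ} {c : ℝ → Euc d → ℝ} {v : ℝ → Euc d → Euc d}
  {b' h0 t0 t : ℝ} {x y : Euc d}

lemma Chain.reach (H : Env K Lp a b L md c v) (hLp : 0 ≤ Lp) (hb : 0 ≤ b') (hbb : b' < b)
    (h1 : h0 ≤ md ((b - b') / 2)) (h2 : Lp * (h0 * (K + b')) ≤ (b - b') / 2)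
    (hc : Chain v b' h0 t0 y t x) : Reachable c v t0 y t x := by
  induction hc with
  | refl => exact Reachable.refl' _ _ _ _
  | step hc hh hh0 hx ih =>
    exact ih.trans' (reach_line H hLp hb hbb h1 h2 hh hh0 (Or.inr rfl) hx)

lemma Chain.le (hc : Chain v b' h0 t0 y t x) : t0 ≤ t := by
  induction hc with
  | refl => exact le_rfl
  | step hc hh hh0 hx ih => linarith

lemma Chain.pert (H : Env K Lp a b L md c v)
    (hc : Chain v b' h0 t0 y t x) : ∀ x', ∃ y', ‖y' - y‖ ≤ Real.exp (Lp * (t - t0)) * ‖x' - x‖ ∧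
      Chain v b' h0 t0 y' t x' := by
  induction hc with
  | refl => exact fun x' => ⟨x', by simp, Chain.refl⟩
  | @step t h x z hc hh hh0 hx ih =>
    intro z'
    obtain ⟨y', hy, hcy⟩ := ih (x + (z' - z) - h • (v t z' - v t z))
    refine ⟨y', hy.trans ?_, hcy.step hh hh0 ?_⟩
    · have : x + (z' - z) - h • (v t z' - v t z) - x = (z' - z) - h • (v t z' - v t z) := by abel
      rw [this]
      have h1 : ‖(z' - z) - h • (v t z' - v t z)‖ ≤ (1 + Lp * h) * ‖z' - z‖ := by
        refine (norm_sub_le _ _).trans ?_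
        rw [norm_smul, Real.norm_eq_abs, abs_of_pos hh]
        nlinarith [(H.lip t z' z).2]
      have h2 : 1 + Lp * h ≤ Real.exp (Lp * h) := by linarith [Real.add_one_le_exp (Lp * h)]
      have e : Lp * (t + h - t0) = Lp * (t - t0) + Lp * h := by ring
      rw [e, Real.exp_add, mul_assoc]
      gcongr
      exact h1.trans (by gcongr)
    · have : z' - (x + (z' - z) - h • (v t z' - v t z)) - h • v t z' = z - x - h • v t z := by
        rw [smul_sub]; abel
      rw [this]; exact hx

def Uc {d : ℕ} (v : ℝ → Euc d → Euc d) (b' h0 t0 : ℝ) (f : Euc d → ℝ) (t : ℝ) (x : Euc d) : ℝ :=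
  sSup {r | ∃ y, Chain v b' h0 t0 y t x ∧ r = f y}

variable {f : Euc d → ℝ}

lemma Uc_bdd (hf : ∀ x, f x ∈ Set.Icc (0:ℝ) 1) :
    BddAbove {r | ∃ y, Chain v b' h0 t0 y t x ∧ r = f y} :=
  ⟨1, by rintro r ⟨y, _, rfl⟩; exact (hf y).2⟩

lemma le_Uc (hf : ∀ x, f x ∈ Set.Icc (0:ℝ) 1) (hc : Chain v b' h0 t0 y t x) :
    f y ≤ Uc v b' h0 t0 f t x := le_csSup (Uc_bdd hf) ⟨y, hc, rfl⟩

lemma Uc_mem (hf : ∀ x, f x ∈ Set.Icc (0:ℝ) 1) (t : ℝ) (x : Euc d) :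
    Uc v b' h0 t0 f t x ∈ Set.Icc (0:ℝ) 1 := by
  constructor
  · apply Real.sSup_nonneg; rintro r ⟨y, _, rfl⟩; exact (hf y).1
  · apply Real.sSup_le _ zero_le_one; rintro r ⟨y, _, rfl⟩; exact (hf y).2

lemma Uc_pos (hpos : 0 < Uc v b' h0 t0 f t x) : ∃ y, Chain v b' h0 t0 y t x ∧ 0 < f y := by
  by_contra hcon
  push Not at hcon
  have : Uc v b' h0 t0 f t x ≤ 0 := by
    apply Real.sSup_le _ le_rfl; rintro r ⟨y, hy, rfl⟩; exact hcon y hy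
  linarith

lemma Uc_zero (hf : ∀ x, f x ∈ Set.Icc (0:ℝ) 1) (x : Euc d) : f x ≤ Uc v b' h0 t0 f t0 x :=
  le_Uc hf Chain.refl

lemma Uc_step (hf : ∀ x, f x ∈ Set.Icc (0:ℝ) 1) {h : ℝ} {x x' : Euc d} (hh : 0 < h) (hh0 : h ≤ h0)
    (hx : ‖x' - x - h • v t x'‖ ≤ h * b') : Uc v b' h0 t0 f t x ≤ Uc v b' h0 t0 f (t + h) x' := by
  apply Real.sSup_le _ (Uc_mem hf _ _).1
  rintro r ⟨y, hy, rfl⟩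
  exact le_Uc hf (hy.step hh hh0 hx)

lemma Uc_lip (H : Env K Lp a b L md c v) (hf : ∀ x, f x ∈ Set.Icc (0:ℝ) 1) {Λ : NNReal}
    (hfl : LipschitzWith Λ f) (t : ℝ) :
    LipschitzWith (Λ * (Real.exp (Lp * (t - t0))).toNNReal) (Uc v b' h0 t0 f t) := by
  have key : ∀ x x', Uc v b' h0 t0 f t x ≤ Uc v b' h0 t0 f t x' +
      Λ * Real.exp (Lp * (t - t0)) * ‖x' - x‖ := by
    intro x x'
    apply Real.sSup_le
    · rintro r ⟨y, hy, rfl⟩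
      obtain ⟨y', hy1, hy2⟩ := hy.pert H x'
      have h1 := le_Uc hf hy2
      have h2 := hfl.dist_le_mul y y'
      rw [Real.dist_eq, dist_eq_norm, norm_sub_rev] at h2
      have h3 := (le_abs_self _).trans h2
      have h4 : (Λ:ℝ) * ‖y' - y‖ ≤ Λ * (Real.exp (Lp * (t - t0)) * ‖x' - x‖) := by gcongr
      linarith
    · have := (Uc_mem (v := v) (b' := b') (h0 := h0) (t0 := t0) hf t x').1
      positivity
  apply LipschitzWith.of_dist_le_mul
  intro x x'
  rw [NNReal.coe_mul, Real.coe_toNNReal _ (Real.exp_pos _).le, Real.dist_eq, dist_eq_norm, abs_le]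
  have h1 := key x x'
  have h2 := key x' x
  rw [norm_sub_rev] at h1
  constructor <;> linarith

end chain

/-- Dini type lemma. -/
lemma dini (m : ℝ → ℝ) (t1 t2 C s : ℝ) (h12 : t1 ≤ t2) (hC : 0 ≤ C)
    (h1 : ∀ t u, t1 ≤ t → t ≤ u → u ≤ t2 → m t - C * (u - t) ≤ m u)
    (h2 : ∀ t, t1 ≤ t → t < t2 → ∀ ε, 0 < ε → ∃ h, 0 < h ∧ t + h ≤ t2 ∧ m t + h * (s - ε) ≤ m (t + h)) :
    m t1 + s * (t2 - t1) ≤ m t2 := by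
  have key : ∀ ε, 0 < ε → m t1 + (s - ε) * (t2 - t1) ≤ m t2 := by
    intro ε hε
    set S := {t | t1 ≤ t ∧ t ≤ t2 ∧ m t1 + (s - ε) * (t - t1) ≤ m t} with hS
    have hne : t1 ∈ S := ⟨le_rfl, h12, by simp⟩
    have hbd : BddAbove S := ⟨t2, fun t ht => ht.2.1⟩
    set T := sSup S with hT
    have hT1 : t1 ≤ T := le_csSup hbd hne
    have hT2 : T ≤ t2 := csSup_le ⟨t1, hne⟩ fun t ht => ht.2.1
    have hTS : m t1 + (s - ε) * (T - t1) ≤ m T := by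
      refine le_of_forall_pos_le_add fun δ hδ => ?_
      set D := C + |s - ε| + 1 with hD
      have hDp : 0 < D := by positivity
      obtain ⟨t, ht, hlt⟩ := exists_lt_of_lt_csSup ⟨t1, hne⟩ (show T - δ / D < T by
        have : 0 < δ / D := by positivity
        linarith)
      have htT : t ≤ T := le_csSup hbd ht
      have a1 := h1 t T ht.1 htT hT2
      have a2 := ht.2.2
      have a3 : (T - t) * D ≤ δ := by
        have : T - t ≤ δ / D := by linarith
        rwa [le_div_iff₀ hDp] at this
      have a4 : (s - ε) * (T - t) ≤ |s - ε| * (T - t) :=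
        mul_le_mul_of_nonneg_right (le_abs_self _) (by linarith)
      nlinarith
    rcases hT2.lt_or_eq with h | h
    · obtain ⟨u, hu, hu2, hu3⟩ := h2 T hT1 h ε hε
      have : T + u ∈ S := ⟨by linarith, hu2, by nlinarith⟩
      have := le_csSup hbd this
      linarith
    · rw [← h]; exact hTS
  refine le_of_forall_pos_le_add fun δ hδ => ?_
  have := key (δ / (t2 - t1 + 1)) (by have : 0 < t2 - t1 + 1 := by linarith
                                      positivity)
  have h3 : δ / (t2 - t1 + 1) * (t2 - t1) ≤ δ := by
    rw [div_mul_eq_mul_div, div_le_iff₀ (by linarith)]; nlinarith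
  nlinarith

section mono
variable {d : ℕ} {K Lp a b L : ℝ} {md : ℝ → ℝ} {c : ℝ → Euc d → ℝ} {v : ℝ → Euc d → Euc d}
  {b' h0 t0 : ℝ} {f : Euc d → ℝ} {Λ : NNReal} {ζ : Euc d → ℝ}

lemma Uc_drift (H : Env K Lp a b L md c v) (hLp : 0 ≤ Lp) (hb' : 0 ≤ b') (hh0 : 0 < h0)
    (hf : ∀ x, f x ∈ Set.Icc (0:ℝ) 1)
    (hfl : LipschitzWith Λ f) (T : ℝ) (x : Euc d) : ∀ n : ℕ, ∀ t u, t0 ≤ t → t ≤ u → u ≤ t0 + T →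
    u - t ≤ n * h0 →
    Uc v b' h0 t0 f t x - Λ * Real.exp (Lp * T) * K * (u - t) ≤ Uc v b' h0 t0 f u x := by
  have hK : 0 ≤ K := (norm_nonneg _).trans (H.vK 0 0)
  have one : ∀ t u, t0 ≤ t → t < u → u ≤ t0 + T → u - t ≤ h0 →
    Uc v b' h0 t0 f t x - Λ * Real.exp (Lp * T) * K * (u - t) ≤ Uc v b' h0 t0 f u x := by
    intro t u h1 h2 h3 h4
    have s1 := Uc_step (v := v) (b' := b') (h0 := h0) (t0 := t0) (t := t) hf (h := u - t)
      (x := x - (u - t) • v t x) (x' := x) (by linarith) h4 (by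
        simp only [sub_sub_cancel, sub_self, norm_zero]
        exact mul_nonneg (by linarith) hb')
    have s2 := (Uc_lip (b' := b') (h0 := h0) (t0 := t0) H hf hfl t).dist_le_mul x (x - (u - t) • v t x)
    rw [Real.dist_eq, dist_eq_norm, sub_sub_cancel, norm_smul, Real.norm_eq_abs,
      abs_of_pos (sub_pos.2 h2), NNReal.coe_mul, Real.coe_toNNReal _ (Real.exp_pos _).le] at s2
    have s3 := (le_abs_self _).trans s2
    rw [add_sub_cancel] at s1
    have s4 : (Λ:ℝ) * Real.exp (Lp * (t - t0)) * ((u - t) * ‖v t x‖) ≤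
        Λ * Real.exp (Lp * T) * ((u - t) * K) := by
      have : 0 ≤ u - t := by linarith
      have := H.vK t x
      gcongr
      linarith
    nlinarith
  intro n
  induction n with
  | zero =>
    intro t u h1 h2 h3 h4
    have : u = t := by simp at h4; linarith
    subst this; simp
  | succ n ih =>
    intro t u h1 h2 h3 h4
    by_cases h : u - t ≤ h0
    · rcases h2.eq_or_lt with h5 | h5
      · subst h5; simp
      · exact one t u h1 h5 h3 h
    · push Not at h
      have e1 := ih (t + h0) u (by linarith) (by linarith) h3 (by push_cast at h4; linarith)
      have e2 := one t (t + h0) h1 (by linarith) (by linarith) (by linarith)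
      nlinarith

lemma int_Uz (H : Env K Lp a b L md c v)
    (hf : ∀ x, f x ∈ Set.Icc (0:ℝ) 1)
    (hfl : LipschitzWith Λ f) (hζ : Integrable ζ) (t : ℝ) :
    Integrable (fun x => Uc v b' h0 t0 f t x * ζ x) := by
  refine hζ.bdd_mul (c := 1) (Uc_lip H hf hfl t).continuous.aestronglyMeasurable (ae_of_all _ fun x => ?_)
  rw [Real.norm_eq_abs, abs_of_nonneg (Uc_mem hf t x).1]
  exact (Uc_mem hf t x).2

lemma m_drift (H : Env K Lp a b L md c v) (hLp : 0 ≤ Lp) (hb' : 0 ≤ b') (hh0 : 0 < h0)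
    (hf : ∀ x, f x ∈ Set.Icc (0:ℝ) 1)
    (hfl : LipschitzWith Λ f) (hζ : Integrable ζ) (hζ0 : ∀ x, 0 < ζ x) (T : ℝ) (t u : ℝ)
    (h1 : t0 ≤ t) (h2 : t ≤ u) (h3 : u ≤ t0 + T) :
    (∫ x, Uc v b' h0 t0 f t x * ζ x) - Λ * Real.exp (Lp * T) * K * (∫ x, ζ x) * (u - t) ≤
      ∫ x, Uc v b' h0 t0 f u x * ζ x := by
  obtain ⟨n, hn⟩ := exists_nat_ge ((u - t) / h0)
  rw [div_le_iff₀ hh0] at hn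
  have e : (∫ x, Uc v b' h0 t0 f t x * ζ x) - Λ * Real.exp (Lp * T) * K * (∫ x, ζ x) * (u - t)
      = ∫ x, (Uc v b' h0 t0 f t x * ζ x - Λ * Real.exp (Lp * T) * K * (u - t) * ζ x) := by
    rw [integral_sub (int_Uz H hf hfl hζ t) (hζ.const_mul _), integral_const_mul]; ring
  rw [e]
  refine integral_mono ((int_Uz H hf hfl hζ t).sub (hζ.const_mul _)) (int_Uz H hf hfl hζ u) fun x => ?_
  have := Uc_drift (b' := b') H hLp hb' hh0 hf hfl T x n t u h1 h2 h3 hn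
  have := hζ0 x
  simp only
  nlinarith

lemma m_deriv (H : Env K Lp a b L md c v) (hb' : 0 ≤ b') (hh0 : 0 < h0)
    (hf : ∀ x, f x ∈ Set.Icc (0:ℝ) 1)
    (hfl : LipschitzWith Λ f) (hζ : Integrable ζ) (hζc : Continuous ζ) (hζ0 : ∀ x, 0 < ζ x) (t : ℝ)
    (ε δ : ℝ) (hε : 0 < ε) (hδ : 0 < δ) : ∃ h, 0 < h ∧ h ≤ δ ∧
    (∫ x, Uc v b' h0 t0 f t x * ζ x) + h *
      ((∫ x, (b' * ‖fderiv ℝ (Uc v b' h0 t0 f t) x‖ - fderiv ℝ (Uc v b' h0 t0 f t) x (v t x)) * ζ x) - ε)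
      ≤ ∫ x, Uc v b' h0 t0 f (t + h) x * ζ x := by
  have hK : 0 ≤ K := (norm_nonneg _).trans (H.vK 0 0)
  set U := Uc v b' h0 t0 f t with hU
  set C : NNReal := (Λ * (Real.exp (Lp * (t - t0))).toNNReal) with hC
  have hUl : LipschitzWith C U := Uc_lip H hf hfl t
  have hvc : Continuous (v t) := by
    have : LipschitzWith Lp.toNNReal (v t) := by
      apply LipschitzWith.of_dist_le_mul
      intro x y
      rw [dist_eq_norm, dist_eq_norm]
      exact ((H.lip t x y).2).trans (mul_le_mul_of_nonneg_right (Real.le_coe_toNNReal _) (norm_nonneg _))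
    exact this.continuous
  set g : Euc d → Euc d := fun x => (InnerProductSpace.toDual ℝ (Euc d)).symm (fderiv ℝ U x) with hg
  have hgm : Measurable g :=
    (InnerProductSpace.toDual ℝ (Euc d)).symm.continuous.measurable.comp (measurable_fderiv ℝ U)
  have hgn : ∀ x, ‖g x‖ = ‖fderiv ℝ U x‖ := fun x => by simp [hg]
  set n : Euc d → Euc d := fun x => ‖g x‖⁻¹ • g x with hn
  have hnm : Measurable n := hgm.norm.inv.smul hgm
  have hn1 : ∀ x, ‖n x‖ ≤ 1 := by
    intro x
    simp only [hn, norm_smul, norm_inv, norm_norm]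
    exact inv_mul_le_one
  have hDn : ∀ x, fderiv ℝ U x (n x) = ‖fderiv ℝ U x‖ := by
    intro x
    have : fderiv ℝ U x (g x) = ‖g x‖ * ‖g x‖ := by
      rw [← real_inner_self_eq_norm_mul_norm]
      simp only [hg]
      rw [InnerProductSpace.toDual_symm_apply]
    simp only [hn, map_smul, smul_eq_mul, this, ← hgn]
    by_cases h : ‖g x‖ = 0
    · simp [h]
    · field_simp
  set w : Euc d → Euc d := fun x => b' • n x - v t x with hw
  have hwm : Measurable w := (hnm.const_smul b').sub hvc.measurable
  have hwn : ∀ x, ‖w x‖ ≤ b' + K := by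
    intro x
    refine (norm_sub_le _ _).trans (add_le_add ?_ (H.vK t x))
    rw [norm_smul, Real.norm_eq_abs, abs_of_nonneg hb']
    nlinarith [hn1 x]
  have hDw : ∀ x, fderiv ℝ U x (w x) = b' * ‖fderiv ℝ U x‖ - fderiv ℝ U x (v t x) := by
    intro x; simp [hw, hDn]
  set h : ℕ → ℝ := fun k => 1 / ((k:ℝ) + 1) with hh
  have hhp : ∀ k, 0 < h k := fun k => by positivity
  have hht : Tendsto h atTop (nhds 0) := tendsto_one_div_add_atTop_nhds_zero_nat
  have lim : Tendsto (fun k => ∫ x, (U (x + h k • w x) - U x) / h k * ζ x) atTop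
      (nhds (∫ x, (b' * ‖fderiv ℝ U x‖ - fderiv ℝ U x (v t x)) * ζ x)) := by
    apply tendsto_integral_of_dominated_convergence (fun x => C * (b' + K) * ζ x)
    · intro k
      have m1 : Measurable fun x => U (x + h k • w x) :=
        hUl.continuous.measurable.comp (measurable_id.add (show Measurable (fun x => h k • w x) from hwm.const_smul (h k)))
      exact (((m1.sub hUl.continuous.measurable).div_const _).mul hζc.measurable).aestronglyMeasurable
    · exact hζ.const_mul _
    · intro k
      refine ae_of_all _ fun x => ?_
      rw [norm_mul, norm_div, Real.norm_eq_abs (ζ x), abs_of_pos (hζ0 x)]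
      refine mul_le_mul_of_nonneg_right ?_ (hζ0 x).le
      rw [Real.norm_eq_abs (h k), abs_of_pos (hhp k), div_le_iff₀ (hhp k)]
      have := hUl.dist_le_mul (x + h k • w x) x
      rw [dist_eq_norm, dist_eq_norm, add_sub_cancel_left, norm_smul, Real.norm_eq_abs (h k),
        abs_of_pos (hhp k)] at this
      refine this.trans ?_
      rw [mul_assoc, mul_comm (b' + K)]
      have := hhp k
      gcongr
      exact hwn x
    · filter_upwards [hUl.ae_differentiableAt (μ := volume)] with x hx
      refine Tendsto.mul_const _ ?_
      rw [← hDw]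
      have hl := (hx.hasFDerivAt.hasLineDerivAt (w x)).tendsto_slope_zero
      have := hl.comp (tendsto_nhdsWithin_iff.2 ⟨hht, Eventually.of_forall fun k => (hhp k).ne'⟩)
      refine this.congr fun k => ?_
      simp [div_eq_inv_mul]
  have ev := (lim.eventually (lt_mem_nhds (sub_lt_self _ hε))).and
    (hht.eventually (gt_mem_nhds (lt_min hδ hh0)))
  obtain ⟨k, hk1, hk2⟩ := ev.exists
  refine ⟨h k, hhp k, hk2.le.trans (min_le_left _ _), ?_⟩
  have i1 : Integrable fun x => U x * ζ x := int_Uz H hf hfl hζ t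
  have i2 : Integrable fun x => U (x + h k • w x) * ζ x := by
    have m1 : Measurable fun x => U (x + h k • w x) :=
        hUl.continuous.measurable.comp (measurable_id.add (show Measurable (fun x => h k • w x) from hwm.const_smul (h k)))
    refine hζ.bdd_mul (c := 1) m1.aestronglyMeasurable (ae_of_all _ fun x => ?_)
    rw [Real.norm_eq_abs, abs_of_nonneg (Uc_mem hf t _).1]
    exact (Uc_mem hf t _).2
  have e : ∫ x, (U (x + h k • w x) - U x) / h k * ζ x
      = (h k)⁻¹ * ((∫ x, U (x + h k • w x) * ζ x) - ∫ x, U x * ζ x) := by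
    rw [← integral_sub i2 i1, ← integral_const_mul]
    congr 1; ext x; field_simp
  rw [e, ← div_eq_inv_mul, lt_div_iff₀ (hhp k)] at hk1
  have fin : ∫ x, U (x + h k • w x) * ζ x ≤ ∫ x, Uc v b' h0 t0 f (t + h k) x * ζ x := by
    refine integral_mono i2 (int_Uz H hf hfl hζ _) fun x => ?_
    refine mul_le_mul_of_nonneg_right ?_ (hζ0 x).le
    refine Uc_step hf (hhp k) (hk2.le.trans (min_le_right _ _)) ?_
    have : x - (x + h k • w x) - h k • v t x = - (h k • (b' • n x)) := by
      simp only [hw, smul_sub]; abel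
    rw [this, norm_neg, norm_smul, norm_smul, Real.norm_eq_abs, Real.norm_eq_abs, abs_of_pos (hhp k),
      abs_of_nonneg hb']
    have := hn1 x
    have := hhp k
    gcongr
    nlinarith
  linarith
end mono

section mono
variable {d : ℕ} {K Lp a b L : ℝ} {md : ℝ → ℝ} {c : ℝ → Euc d → ℝ} {v : ℝ → Euc d → Euc d}
  {b' h0 t0 κ : ℝ} {f : Euc d → ℝ} {Λ : NNReal} {ζ : Euc d → ℝ}

def CoreH {d : ℕ} (K a b' L κ : ℝ) (ζ : Euc d → ℝ) : Prop :=
  ∀ (C D : NNReal) (U : Euc d → ℝ) (w : Euc d → Euc d), LipschitzWith C U →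
      (∀ x, U x ∈ Set.Icc (0:ℝ) 1) → LipschitzWith D w → (∀ x, ‖w x‖ ≤ K) →
      (∀ᵐ x, LinearMap.trace ℝ (Euc d) (fderiv ℝ w x).toLinearMap = 0) →
      (∀ x, ‖(L ^ d)⁻¹ • ∫ y in boxQ d L, w (x + y)‖ ≤ a) →
      ∃ p ∈ Set.Icc (0:ℝ) 1, κ * ∫ x, |U x - p| * ζ x ≤
        ∫ x, (b' * ‖fderiv ℝ U x‖ - fderiv ℝ U x (w x)) * ζ x

lemma core_app (H : Env K Lp a b L md c v) (hco : CoreH K a b' L κ ζ)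
    (hf : ∀ x, f x ∈ Set.Icc (0:ℝ) 1) (hfl : LipschitzWith Λ f) (t : ℝ) :
    ∃ p ∈ Set.Icc (0:ℝ) 1, κ * ∫ x, |Uc v b' h0 t0 f t x - p| * ζ x ≤
        ∫ x, (b' * ‖fderiv ℝ (Uc v b' h0 t0 f t) x‖ - fderiv ℝ (Uc v b' h0 t0 f t) x (v t x)) * ζ x := by
  have : LipschitzWith Lp.toNNReal (v t) := by
    apply LipschitzWith.of_dist_le_mul
    intro x y
    rw [dist_eq_norm, dist_eq_norm]
    exact ((H.lip t x y).2).trans (mul_le_mul_of_nonneg_right (Real.le_coe_toNNReal _) (norm_nonneg _))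
  exact hco _ _ _ _ (Uc_lip H hf hfl t) (fun x => Uc_mem hf t x) this (H.vK t) (H.dv t) (H.av t)

lemma m_grow (H : Env K Lp a b L md c v) (hLp : 0 ≤ Lp) (hb' : 0 ≤ b') (hh0 : 0 < h0)
    (hf : ∀ x, f x ∈ Set.Icc (0:ℝ) 1)
    (hfl : LipschitzWith Λ f) (hζ : Integrable ζ) (hζc : Continuous ζ) (hζ0 : ∀ x, 0 < ζ x)
    {t1 t2 s : ℝ} (h1 : t0 ≤ t1) (h12 : t1 ≤ t2)
    (hs : ∀ t, t1 ≤ t → t < t2 → s ≤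
      ∫ x, (b' * ‖fderiv ℝ (Uc v b' h0 t0 f t) x‖ - fderiv ℝ (Uc v b' h0 t0 f t) x (v t x)) * ζ x) :
    (∫ x, Uc v b' h0 t0 f t1 x * ζ x) + s * (t2 - t1) ≤ ∫ x, Uc v b' h0 t0 f t2 x * ζ x := by
  have hK : 0 ≤ K := (norm_nonneg _).trans (H.vK 0 0)
  have hI : 0 ≤ ∫ x, ζ x := integral_nonneg fun x => (hζ0 x).le
  refine dini (fun t => ∫ x, Uc v b' h0 t0 f t x * ζ x) t1 t2
    (Λ * Real.exp (Lp * (t2 - t0)) * K * (∫ x, ζ x)) s h12 (by positivity) ?_ ?_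
  · intro t u h3 h4 h5
    exact m_drift H hLp hb' hh0 hf hfl hζ hζ0 (t2 - t0) t u (by linarith) h4 (by linarith)
  · intro t h3 h4 ε hε
    obtain ⟨h, hp, hle, hh⟩ := m_deriv (t0 := t0) H hb' hh0 hf hfl hζ hζc hζ0 t ε (t2 - t) hε (by linarith)
    refine ⟨h, hp, by linarith, le_trans ?_ hh⟩
    have := hs t h3 h4
    gcongr

lemma m_mono (H : Env K Lp a b L md c v) (hLp : 0 ≤ Lp) (hb' : 0 ≤ b') (hh0 : 0 < h0)
    (hco : CoreH K a b' L κ ζ) (hκ : 0 < κ)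
    (hf : ∀ x, f x ∈ Set.Icc (0:ℝ) 1)
    (hfl : LipschitzWith Λ f) (hζ : Integrable ζ) (hζc : Continuous ζ) (hζ0 : ∀ x, 0 < ζ x)
    {t1 t2 : ℝ} (h1 : t0 ≤ t1) (h12 : t1 ≤ t2) :
    (∫ x, Uc v b' h0 t0 f t1 x * ζ x) ≤ ∫ x, Uc v b' h0 t0 f t2 x * ζ x := by
  have := m_grow (s := 0) H hLp hb' hh0 hf hfl hζ hζc hζ0 h1 h12 (fun t _ _ => by
    obtain ⟨p, hp, hh⟩ := core_app (h0 := h0) (t0 := t0) H hco hf hfl t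
    refine le_trans ?_ hh
    have : 0 ≤ ∫ x, |Uc v b' h0 t0 f t x - p| * ζ x :=
      integral_nonneg fun x => mul_nonneg (abs_nonneg _) (hζ0 x).le
    positivity)
  simpa using this

lemma F_mono (H : Env K Lp a b L md c v) (hLp : 0 ≤ Lp) (hb' : 0 ≤ b') (hh0 : 0 < h0)
    (hco : CoreH K a b' L κ ζ) (hκ : 0 < κ)
    (hf : ∀ x, f x ∈ Set.Icc (0:ℝ) 1)
    (hfl : LipschitzWith Λ f) (hζ : Integrable ζ) (hζc : Continuous ζ) (hζ0 : ∀ x, 0 < ζ x)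
    {t1 t2 : ℝ} (h1 : t0 ≤ t1) (h12 : t1 ≤ t2) :
    ∫ x in {x | 0 < Uc v b' h0 t0 f t1 x}, ζ x ≤ ∫ x in {x | 0 < Uc v b' h0 t0 f t2 x}, ζ x := by
  have mF : ∀ t, MeasurableSet {x | 0 < Uc v b' h0 t0 f t x} := fun t =>
    (isOpen_lt continuous_const (Uc_lip H hf hfl t).continuous).measurableSet
  set fk : ℕ → Euc d → ℝ := fun k x => min 1 (k * f x) with hfk
  have hk : ∀ k x, fk k x ∈ Set.Icc (0:ℝ) 1 := fun k x =>
    ⟨le_min zero_le_one (mul_nonneg (by positivity) (hf x).1), min_le_left _ _⟩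
  have hkl : ∀ k : ℕ, LipschitzWith ((k : NNReal) * Λ) (fk k) := by
    intro k
    have : LipschitzWith ((k : NNReal) * Λ) fun x => (k:ℝ) * f x := by
      apply LipschitzWith.of_dist_le_mul
      intro x y
      rw [dist_eq_norm, ← mul_sub, norm_mul, NNReal.coe_mul, mul_assoc, ← dist_eq_norm]
      simp only [RCLike.norm_natCast, NNReal.coe_natCast]
      gcongr
      exact hfl.dist_le_mul x y
    exact this.const_min 1
  have up : ∀ k, ∫ x, Uc v b' h0 t0 (fk k) t2 x * ζ x ≤ ∫ x in {x | 0 < Uc v b' h0 t0 f t2 x}, ζ x := by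
    intro k
    rw [← integral_indicator (mF t2)]
    refine integral_mono (int_Uz H (hk k) (hkl k) hζ t2) (hζ.indicator (mF t2)) fun x => ?_
    by_cases hx : 0 < Uc v b' h0 t0 f t2 x
    · rw [Set.indicator_of_mem (by exact hx)]
      have := (Uc_mem (v := v) (b' := b') (h0 := h0) (t0 := t0) (hk k) t2 x).2
      have := hζ0 x
      simp only
      nlinarith
    · rw [Set.indicator_of_notMem (by exact hx)]
      have : Uc v b' h0 t0 (fk k) t2 x ≤ 0 := by
        by_contra hcon
        push Not at hcon
        obtain ⟨y, hy, hy2⟩ := Uc_pos hcon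
        have h3 : 0 < f y := by
          have := lt_of_lt_of_le hy2 (min_le_right _ _)
          by_contra h4
          have h5 : f y = 0 := le_antisymm (not_lt.1 h4) (hf y).1
          simp [h5] at this
        exact hx (lt_of_lt_of_le h3 (le_Uc hf hy))
      have := hζ0 x
      simp only
      nlinarith
  have low : Tendsto (fun k => ∫ x in {x | 0 < Uc v b' h0 t0 f t1 x}, Uc v b' h0 t0 (fk k) t1 x * ζ x)
      atTop (nhds (∫ x in {x | 0 < Uc v b' h0 t0 f t1 x}, ζ x)) := by
    apply tendsto_integral_of_dominated_convergence ζ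
    · intro k
      exact (int_Uz H (hk k) (hkl k) hζ t1).aestronglyMeasurable.restrict
    · exact hζ.restrict
    · intro k
      refine ae_of_all _ fun x => ?_
      have := (Uc_mem (v := v) (b' := b') (h0 := h0) (t0 := t0) (hk k) t1 x)
      rw [norm_mul, Real.norm_eq_abs, Real.norm_eq_abs, abs_of_pos (hζ0 x), abs_of_nonneg this.1]
      have := this.2
      have := hζ0 x
      nlinarith
    · rw [ae_restrict_iff' (mF t1)]
      refine ae_of_all _ fun x hx => ?_
      obtain ⟨y, hy, hy2⟩ := Uc_pos hx
      obtain ⟨n, hn⟩ := exists_nat_ge (1 / f y)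
      refine tendsto_const_nhds.congr' ?_
      filter_upwards [eventually_ge_atTop n] with k hkn
      have h1 : fk k y = 1 := by
        apply min_eq_left
        rw [← div_le_iff₀ hy2]
        exact hn.trans (by exact_mod_cast hkn)
      have h2 := le_Uc (hk k) hy
      rw [h1] at h2
      rw [le_antisymm (Uc_mem (hk k) _ _).2 h2, one_mul]
  refine le_of_tendsto low (Eventually.of_forall fun k => ?_)
  refine le_trans ?_ ((m_mono (t0 := t0) H hLp hb' hh0 hco hκ (hk k) (hkl k) hζ hζc hζ0 h1 h12).trans (up k))
  exact setIntegral_le_integral (int_Uz H (hk k) (hkl k) hζ t1) (ae_of_all _ fun x =>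
    mul_nonneg (Uc_mem (hk k) _ _).1 (hζ0 x).le)

lemma m_double (H : Env K Lp a b L md c v) (hLp : 0 ≤ Lp) (hb' : 0 ≤ b') (hh0 : 0 < h0)
    (hco : CoreH K a b' L κ ζ) (hκ : 0 < κ)
    (hf : ∀ x, f x ∈ Set.Icc (0:ℝ) 1)
    (hfl : LipschitzWith Λ f) (hζ : Integrable ζ) (hζc : Continuous ζ) (hζ0 : ∀ x, 0 < ζ x)
    {S : ℝ} (hS : ∫ x in {x | 0 < Uc v b' h0 t0 f (t0 + S) x}, ζ x ≤ (∫ x, ζ x) / 2) (j : ℕ)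
    (hj : j / κ ≤ S) : 2 ^ j * ∫ x, f x * ζ x ≤ ∫ x, ζ x := by
  have mF : ∀ t, MeasurableSet {x | 0 < Uc v b' h0 t0 f t x} := fun t =>
    (isOpen_lt continuous_const (Uc_lip H hf hfl t).continuous).measurableSet
  have low : ∀ t, t0 ≤ t → t ≤ t0 + S → κ * (∫ x, Uc v b' h0 t0 f t x * ζ x) ≤
      ∫ x, (b' * ‖fderiv ℝ (Uc v b' h0 t0 f t) x‖ - fderiv ℝ (Uc v b' h0 t0 f t) x (v t x)) * ζ x := by
    intro t h1 h2
    obtain ⟨p, hp, hh⟩ := core_app (h0 := h0) (t0 := t0) H hco hf hfl t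
    refine le_trans (mul_le_mul_of_nonneg_left ?_ hκ.le) hh
    have hF := (F_mono (t0 := t0) H hLp hb' hh0 hco hκ hf hfl hζ hζc hζ0 h1 h2).trans hS
    have i1 := int_Uz (b' := b') (h0 := h0) (t0 := t0) H hf hfl hζ t
    have i2 : Integrable fun x => p * ζ x := hζ.const_mul p
    have i3 : Integrable fun x => 2 * p * ({x | 0 < Uc v b' h0 t0 f t x}.indicator ζ x) :=
      (hζ.indicator (mF t)).const_mul _
    have i4 : Integrable fun x => |Uc v b' h0 t0 f t x - p| * ζ x := by
      refine hζ.bdd_mul (c := 1)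
        (((Uc_lip H hf hfl t).continuous.sub continuous_const).abs).aestronglyMeasurable (ae_of_all _ fun x => ?_)
      have := Uc_mem (v := v) (b' := b') (h0 := h0) (t0 := t0) hf t x
      rw [Real.norm_eq_abs, abs_abs, abs_le]
      constructor <;> linarith [this.1, this.2, hp.1, hp.2]
    have : ∫ x, ((Uc v b' h0 t0 f t x * ζ x + p * ζ x) -
        2 * p * ({x | 0 < Uc v b' h0 t0 f t x}.indicator ζ x)) ≤ ∫ x, |Uc v b' h0 t0 f t x - p| * ζ x := by
      refine integral_mono ((i1.add i2).sub i3) i4 fun x => ?_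
      have hz := hζ0 x
      by_cases hx : 0 < Uc v b' h0 t0 f t x
      · simp only
        rw [Set.indicator_of_mem (by exact hx)]
        have := le_abs_self (Uc v b' h0 t0 f t x - p)
        nlinarith
      · simp only
        rw [Set.indicator_of_notMem (by exact hx)]
        have : Uc v b' h0 t0 f t x = 0 := le_antisymm (not_lt.1 hx) (Uc_mem hf t x).1
        rw [this]
        have := neg_le_abs (0 - p)
        nlinarith
    have i12 : Integrable fun x => Uc v b' h0 t0 f t x * ζ x + p * ζ x := i1.add i2
    rw [integral_sub i12 i3, integral_add i1 i2, integral_const_mul, integral_const_mul,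
      integral_indicator (mF t)] at this
    nlinarith [hp.1]
  have ind : ∀ i : ℕ, i / κ ≤ S → 2 ^ i * (∫ x, f x * ζ x) ≤ ∫ x, Uc v b' h0 t0 f (t0 + i / κ) x * ζ x := by
    intro i
    induction i with
    | zero =>
      intro _
      simp only [pow_zero, one_mul, Nat.cast_zero, zero_div, add_zero]
      have i0 : Integrable fun x => f x * ζ x := by
        refine hζ.bdd_mul (c := 1) hfl.continuous.aestronglyMeasurable (ae_of_all _ fun x => ?_)
        rw [Real.norm_eq_abs, abs_of_nonneg (hf x).1]; exact (hf x).2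
      exact integral_mono i0 (int_Uz H hf hfl hζ t0) fun x =>
        mul_le_mul_of_nonneg_right (Uc_zero hf x) (hζ0 x).le
    | succ i ih =>
      intro hi
      have e : ((i + 1 : ℕ) : ℝ) / κ = i / κ + 1 / κ := by push_cast; ring
      have h1κ : 0 < 1 / κ := by positivity
      have hiκ : 0 ≤ i / κ := by positivity
      rw [e] at hi ⊢
      have ih' := ih (by linarith)
      have := m_grow (t0 := t0) (s := κ * ∫ x, Uc v b' h0 t0 f (t0 + i / κ) x * ζ x) H hLp hb' hh0 hf hfl hζ hζc hζ0
        (t1 := t0 + i / κ) (t2 := t0 + (i / κ + 1 / κ)) (by linarith) (by linarith) (fun t h1 h2 => by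
          refine le_trans (mul_le_mul_of_nonneg_left ?_ hκ.le) (low t (by linarith) (by linarith))
          exact m_mono (t0 := t0) H hLp hb' hh0 hco hκ hf hfl hζ hζc hζ0 (by linarith) h1)
      have e2 : κ * (∫ x, Uc v b' h0 t0 f (t0 + i / κ) x * ζ x) * (t0 + (i / κ + 1 / κ) - (t0 + i / κ))
          = ∫ x, Uc v b' h0 t0 f (t0 + i / κ) x * ζ x := by
        field_simp; ring
      rw [e2] at this
      rw [pow_succ]
      linarith
  refine (ind j hj).trans (integral_mono (int_Uz H hf hfl hζ _) hζ fun x => ?_)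
  have := (Uc_mem (v := v) (b' := b') (h0 := h0) (t0 := t0) hf (t0 + j / κ) x).2
  have := hζ0 x
  simp only
  nlinarith
end mono

lemma half_arith {A lg l n B J : ℝ} (q1 : 0 < l) (q2 : 0 ≤ n) (q3 : 0 ≤ A) (q4 : 0 < B) (q5 : lg ≤ A)
    (q6 : J * l + -(B * n) ≤ lg) (q7 : (2 * l + (A + B)) * (n + 1) < (J + 1) * l) : False := by
  nlinarith [mul_nonneg q3 q2, mul_nonneg q1.le q2]

set_option maxHeartbeats 800000 in
lemma half (d : ℕ) (K Lp a b L : ℝ) (md : ℝ → ℝ) (hK : 0 ≤ K) (hLp : 0 ≤ Lp) (ha : 0 ≤ a)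
    (hab : a < b) (hL : 0 < L) (hmd : ∀ ε, 0 < ε → 0 < md ε) :
    ∃ ζ : Euc d → ℝ, Integrable ζ ∧ (∀ x, 0 < ζ x) ∧ ∃ C : ℝ, 0 < C ∧
      ∀ (c : ℝ → Euc d → ℝ) (v : ℝ → Euc d → Euc d), Env K Lp a b L md c v → ∀ t0 x0 T,
        C * (‖x0‖ + 1) ≤ T → ∃ F : Set (Euc d), MeasurableSet F ∧
          (∀ x ∈ F, Reachable c v t0 x0 (t0 + T) x) ∧ (∫ x, ζ x) / 2 < ∫ x in F, ζ x := by
  set b' := (a + b) / 2 with hb'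
  have hb0 : 0 < b' := by rw [hb']; linarith
  have hbb : b' < b := by rw [hb']; linarith
  obtain ⟨ζ, hζc, hζ0, hζ1, hζ, ⟨β, hβ, hβζ⟩, κ, hκ, hco⟩ := coreL d K a b' L hK (by rw [hb']; linarith) hL
  have hco : CoreH K a b' L κ ζ := hco
  set h0 : ℝ := min (md ((b - b') / 2)) ((b - b') / 2 / (Lp * (K + b') + 1)) with hh0
  have hbb2 : 0 < (b - b') / 2 := by linarith
  have hden : 0 < Lp * (K + b') + 1 := by positivity
  have h0p : 0 < h0 := lt_min (hmd _ hbb2) (by positivity)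
  have c1 : h0 ≤ md ((b - b') / 2) := min_le_left _ _
  have c2 : Lp * (h0 * (K + b')) ≤ (b - b') / 2 := by
    have : h0 ≤ (b - b') / 2 / (Lp * (K + b') + 1) := min_le_right _ _
    rw [le_div_iff₀ hden] at this
    nlinarith
  set ρ := min 1 (h0 * b') with hρ
  have hρ0 : 0 < ρ := lt_min one_pos (by positivity)
  set V := volume.real (ball (0 : Euc d) (ρ / 2)) with hV
  have hV0 : 0 < V := by
    rw [hV, Measure.real, ENNReal.toReal_pos_iff]
    exact ⟨measure_ball_pos _ _ (by positivity), measure_ball_lt_top⟩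
  set I := ∫ x, ζ x with hI
  set q := ρ / 2 * Real.exp (-(1 + β * (h0 * K + 1))) * V with hq
  have hq0 : 0 < q := by positivity
  have hI0 : 0 < I := by
    rw [hI, integral_pos_iff_support_of_nonneg (fun x => (hζ0 x).le) hζ]
    have : Function.support ζ = Set.univ := by
      ext x; simp [(hζ0 x).ne']
    rw [this]
    exact lt_of_lt_of_le (measure_ball_pos volume (0 : Euc d) one_pos) (measure_mono (Set.subset_univ _))
  set C := h0 + (2 + (|Real.log (I / q)| + β) / Real.log 2) / κ with hC
  have hl2 : 0 < Real.log 2 := Real.log_pos (by norm_num)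
  have hC0 : 0 < C := by positivity
  refine ⟨ζ, hζ, hζ0, C, hC0, ?_⟩
  intro c v H t0 x0 T hT
  set z0 := x0 + h0 • v t0 x0 with hz0
  set f : Euc d → ℝ := fun y => max 0 (min 1 (h0 * b' - dist y z0)) with hf'
  have hf : ∀ x, f x ∈ Set.Icc (0:ℝ) 1 := fun x => ⟨le_max_left _ _, max_le zero_le_one (min_le_left _ _)⟩
  have hfl : LipschitzWith 1 f := by
    have h1 : LipschitzWith 1 fun y => h0 * b' - dist y z0 := by
      apply LipschitzWith.of_dist_le_mul
      intro x y
      rw [Real.dist_eq]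
      simp only [sub_sub_sub_cancel_left, NNReal.coe_one, one_mul]
      rw [abs_sub_comm]
      exact abs_dist_sub_le x y z0
    exact (h1.const_min 1).const_max 0
  have hint : q * Real.exp (-(β * ‖x0‖)) ≤ ∫ x, f x * ζ x := by
    have i0 : Integrable fun x => f x * ζ x := by
      refine hζ.bdd_mul (c := 1) hfl.continuous.aestronglyMeasurable (ae_of_all _ fun x => ?_)
      rw [Real.norm_eq_abs, abs_of_nonneg (hf x).1]; exact (hf x).2
    have h1 : ∫ x in ball z0 (ρ / 2), f x * ζ x ≤ ∫ x, f x * ζ x :=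
      setIntegral_le_integral i0 (ae_of_all _ fun x => mul_nonneg (hf x).1 (hζ0 x).le)
    refine le_trans ?_ h1
    have h2 : ∫ x in ball z0 (ρ / 2), (ρ / 2 * Real.exp (-(1 + β * (h0 * K + 1)) + -(β * ‖x0‖)))
        ≤ ∫ x in ball z0 (ρ / 2), f x * ζ x := by
      refine setIntegral_mono_on (integrableOn_const measure_ball_lt_top.ne) i0.integrableOn
        measurableSet_ball fun x hx => ?_
      rw [mem_ball] at hx
      have hr1 : ρ ≤ 1 := min_le_left _ _
      have hr2 : ρ ≤ h0 * b' := min_le_right _ _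
      have a1 : ρ / 2 ≤ f x := by
        refine le_max_of_le_right (le_min (by linarith) (by linarith))
      have hz : ‖z0‖ ≤ ‖x0‖ + h0 * K := by
        refine (norm_add_le _ _).trans ?_
        rw [norm_smul, Real.norm_eq_abs, abs_of_pos h0p]
        have := H.vK t0 x0
        gcongr
      have hxn : ‖x‖ ≤ ‖x0‖ + h0 * K + 1 := by
        have := norm_le_norm_add_norm_sub' x z0
        rw [dist_eq_norm] at hx
        linarith
      have a2 : Real.exp (-(1 + β * (h0 * K + 1)) + -(β * ‖x0‖)) ≤ ζ x := by
        refine le_trans (Real.exp_le_exp.2 ?_) (hβζ x)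
        nlinarith
      exact mul_le_mul a1 a2 (Real.exp_pos _).le (hf x).1
    rw [setIntegral_const, smul_eq_mul, Real.exp_add, Measure.real, Measure.addHaar_ball_center,
      ← Measure.real, ← hV] at h2
    refine le_trans (le_of_eq ?_) h2
    rw [hq]; ring
  set S := T - h0 with hS
  refine ⟨{x | 0 < Uc v b' h0 (t0 + h0) f (t0 + h0 + S) x}, ?_, ?_, ?_⟩
  · exact (isOpen_lt continuous_const (Uc_lip H hf hfl _).continuous).measurableSet
  · intro x hx
    obtain ⟨y, hy, hy2⟩ := Uc_pos hx
    have r1 := hy.reach H hLp hb0.le hbb c1 c2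
    have hd : dist y z0 ≤ h0 * b' := by
      by_contra hcon
      push Not at hcon
      have : f y = 0 := max_eq_left ((min_le_right _ _).trans (by linarith))
      linarith
    have r2 : Reachable c v t0 x0 (t0 + h0) y := by
      refine reach_line H hLp hb0.le hbb c1 c2 h0p le_rfl (Or.inl rfl) ?_
      rw [sub_sub, ← dist_eq_norm]
      exact hd
    have e : t0 + T = t0 + h0 + S := by rw [hS]; ring
    rw [e]
    exact r2.trans' r1
  · by_contra hcon
    push Not at hcon
    have hSb : (2 + (|Real.log (I / q)| + β) / Real.log 2) / κ * (‖x0‖ + 1) ≤ S := by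
      have := norm_nonneg x0
      have : h0 * (‖x0‖ + 1) ≥ h0 := by nlinarith
      rw [hS]; rw [hC] at hT
      nlinarith
    have hκS : (2 + (|Real.log (I / q)| + β) / Real.log 2) * (‖x0‖ + 1) ≤ κ * S := by
      rw [div_mul_eq_mul_div, div_le_iff₀ hκ] at hSb
      linarith
    have hSpos : 0 ≤ κ * S := le_trans (by positivity) hκS
    set j := ⌊κ * S⌋₊ with hj
    have hj1 : (j : ℝ) ≤ κ * S := Nat.floor_le hSpos
    have hj2 : κ * S < j + 1 := Nat.lt_floor_add_one _
    have dbl := m_double H hLp hb0.le h0p hco hκ hf hfl hζ hζc hζ0 hcon j (by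
      rw [div_le_iff₀ hκ]; linarith)
    have h1 : 2 ^ j * (q * Real.exp (-(β * ‖x0‖))) ≤ I :=
      le_trans (by gcongr) dbl
    have h2 : (2:ℝ) ^ j * Real.exp (-(β * ‖x0‖)) ≤ I / q := by
      rw [le_div_iff₀ hq0]; linarith
    have h3 := Real.log_le_log (by positivity) h2
    rw [Real.log_mul (by positivity) (by positivity), Real.log_pow, Real.log_exp] at h3
    have h4 := le_abs_self (Real.log (I / q))
    have h5 : (2 + (|Real.log (I / q)| + β) / Real.log 2) * (‖x0‖ + 1) * Real.log 2
      = (2 * Real.log 2 + (|Real.log (I / q)| + β)) * (‖x0‖ + 1) := by field_simp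
    have h6 : (2 + (|Real.log (I / q)| + β) / Real.log 2) * (‖x0‖ + 1) * Real.log 2 < (j + 1) * Real.log 2 :=
      mul_lt_mul_of_pos_right (by linarith) hl2
    rw [h5] at h6
    have h7 := norm_nonneg x0
    have h8 := abs_nonneg (Real.log (I / q))
    exact half_arith hl2 h7 h8 hβ h4 h3 h6

/-- uniform reachability -/
theorem T1 (d : ℕ) (K Lp a b L : ℝ) (md : ℝ → ℝ) (hK : 0 ≤ K) (hLp : 0 ≤ Lp) (ha : 0 ≤ a)
    (hab : a < b) (hL : 0 < L) (hmd : ∀ ε, 0 < ε → 0 < md ε) :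
    ∃ C : ℝ, 0 < C ∧
      ∀ (c : ℝ → Euc d → ℝ) (v : ℝ → Euc d → Euc d), Env K Lp a b L md c v → ∀ t0 x y T,
        C * (‖x - y‖ + 1) ≤ T → Reachable c v t0 x (t0 + T) y := by
  obtain ⟨ζ, hζ, hζ0, C, hC, hh⟩ := half d K Lp a b L md hK hLp ha hab hL hmd
  have base : ∀ (c : ℝ → Euc d → ℝ) (v : ℝ → Euc d → Euc d), Env K Lp a b L md c v → ∀ t0 x T,
      2 * C * (‖x‖ + 1) ≤ T → Reachable c v t0 x (t0 + T) 0 := by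
    intro c v H t0 x T hT
    have hxn := norm_nonneg x
    obtain ⟨F, hF, hFr, hFi⟩ := hh c v H t0 x (C * (‖x‖ + 1)) le_rfl
    have hT1 : C * (‖(0 : Euc d)‖ + 1) ≤ T - C * (‖x‖ + 1) := by
      rw [norm_zero]; nlinarith [mul_nonneg hC.le hxn]
    obtain ⟨G, hG, hGr, hGi⟩ := hh _ _ (H.reverse (t0 + T)) 0 0 _ hT1
    have hne : (F ∩ G).Nonempty := by
      by_contra hcon
      rw [Set.not_nonempty_iff_eq_empty, ← Set.disjoint_iff_inter_eq_empty] at hcon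
      have h1 := setIntegral_union hcon hG hζ.integrableOn hζ.integrableOn
      have h2 : ∫ x in F ∪ G, ζ x ≤ ∫ x, ζ x :=
        setIntegral_le_integral hζ (ae_of_all _ fun x => (hζ0 x).le)
      linarith
    obtain ⟨z, hz1, hz2⟩ := hne
    have r1 := hFr z hz1
    have r2 := (hGr z hz2).reverse (t0 + T)
    have e : t0 + T - (0 + (T - C * (‖x‖ + 1))) = t0 + C * (‖x‖ + 1) := by ring
    rw [e, sub_zero] at r2
    exact r1.trans' r2
  refine ⟨2 * C, by positivity, fun c v H t0 x y T hT => ?_⟩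
  have := (base _ _ (H.shift 0 y) t0 (x - y) T hT).shift 0 y
  simpa using this

lemma lip_deriv_int {d : ℕ} {γ : ℝ → Euc d} {Λ : NNReal} (hγ : LipschitzWith Λ γ) (a b : ℝ) :
    IntervalIntegrable (deriv γ) volume a b := by
  rw [intervalIntegrable_iff]
  refine Measure.integrableOn_of_bounded (M := Λ) (by rw [Set.uIoc]; exact measure_Ioc_lt_top.ne)
    (measurable_deriv γ).aestronglyMeasurable
    (ae_of_all _ fun x => norm_deriv_le_of_lipschitz hγ)

lemma lip_ftc {d : ℕ} {γ : ℝ → Euc d} {Λ : NNReal} (hγ : LipschitzWith Λ γ) (a b : ℝ) :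
    ∫ s in a..b, deriv γ s = γ b - γ a := by
  ext i
  have h1 : ∫ s in a..b, deriv γ s i = (∫ s in a..b, deriv γ s) i :=
    (EuclideanSpace.proj (𝕜 := ℝ) i : Euc d →L[ℝ] ℝ).intervalIntegral_comp_comm
    (lip_deriv_int hγ a b)
  rw [← h1]
  have hl : LipschitzWith (‖(EuclideanSpace.proj (𝕜 := ℝ) i : Euc d →L[ℝ] ℝ)‖₊ * Λ) fun s => γ s i :=
    (EuclideanSpace.proj (𝕜 := ℝ) i : Euc d →L[ℝ] ℝ).lipschitz.comp hγ
  have h2 := (hl.lipschitzOnWith (s := Set.uIcc a b)).absolutelyContinuousOnInterval.integral_deriv_eq_sub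
  rw [PiLp.sub_apply, ← h2]
  apply intervalIntegral.integral_congr_ae
  filter_upwards [hγ.ae_differentiableAt (μ := volume)] with s hs _
  have := (EuclideanSpace.proj (𝕜 := ℝ) i : Euc d →L[ℝ] ℝ).hasFDerivAt.comp_hasDerivAt s hs.hasDerivAt
  exact this.deriv.symm

lemma reach_of_lip {d : ℕ} {c : ℝ → Euc d → ℝ} {v : ℝ → Euc d → Euc d} {γ : ℝ → Euc d} {Λ : NNReal}
    (hγ : LipschitzWith Λ γ) {t0 t1 : ℝ} (h01 : t0 ≤ t1)
    (h : ∀ n : ℕ, ∃ η : ℝ, 0 < η ∧ ∀ s s', t0 < s → s < s' → s' < t1 → s' - s < η →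
      ‖γ s' - γ s - (s' - s) • v s (γ s)‖ ≤ (s' - s) * (c s (γ s) + 1 / ((n:ℝ) + 1))) :
    Reachable c v t0 (γ t0) t1 (γ t1) := by
  refine ⟨h01, γ, deriv γ, lip_deriv_int hγ _ _, ?_, rfl, ?_⟩
  · intro t ht; rw [lip_ftc hγ]; abel
  · have hr : volume.restrict (Set.Icc t0 t1) = (volume.restrict (Set.Ioo t0 t1) : Measure ℝ) :=
      Measure.restrict_congr_set Ioo_ae_eq_Icc.symm
    rw [hr, ae_restrict_iff' measurableSet_Ioo]
    filter_upwards [hγ.ae_differentiableAt (μ := volume)] with s hs hst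
    have key : ∀ n : ℕ, ‖deriv γ s - v s (γ s)‖ ≤ c s (γ s) + 1 / ((n:ℝ) + 1) := by
      intro n
      obtain ⟨η, hη, hh⟩ := h n
      have hd := hs.hasDerivAt.tendsto_slope_zero_right
      have hd2 := (hd.sub_const (v s (γ s))).norm
      refine le_of_tendsto hd2 ?_
      have e1 : ∀ᶠ u in nhdsWithin (0:ℝ) (Set.Ioi 0), u < min η (t1 - s) :=
        nhdsWithin_le_nhds (gt_mem_nhds (lt_min hη (sub_pos.2 hst.2)))
      filter_upwards [e1, self_mem_nhdsWithin] with u hu hu0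
      have hu0 : 0 < u := hu0
      have h1 := lt_of_lt_of_le hu (min_le_left _ _)
      have h2 := lt_of_lt_of_le hu (min_le_right _ _)
      have := hh s (s + u) hst.1 (by linarith) (by linarith) (by linarith)
      rw [add_sub_cancel_left] at this
      have e : u⁻¹ • (γ (s + u) - γ s) - v s (γ s) = u⁻¹ • (γ (s + u) - γ s - u • v s (γ s)) := by
        rw [smul_sub u⁻¹ (γ (s + u) - γ s), inv_smul_smul₀ hu0.ne']
      rw [e, norm_smul, norm_inv, Real.norm_eq_abs, abs_of_pos hu0, inv_mul_le_iff₀ hu0]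
      exact this
    have hl : Tendsto (fun n : ℕ => c s (γ s) + 1 / ((n:ℝ) + 1)) atTop (nhds (c s (γ s) + 0)) :=
      tendsto_one_div_add_atTop_nhds_zero_nat.const_add _
    rw [add_zero] at hl
    exact ge_of_tendsto' hl key

/-- modulus hypothesis -/
structure Mdl {d : ℕ} (K : ℝ) (δ : ℕ → ℝ) (c : ℝ → Euc d → ℝ) (v : ℝ → Euc d → Euc d) : Prop where
  c0 : ∀ t x, 0 ≤ c t x
  cK : ∀ t x, c t x ≤ K
  vK : ∀ t x, ‖v t x‖ ≤ K
  md : ∀ n s s' x x', |s - s'| ≤ δ n → ‖x - x'‖ ≤ 2 * K * δ n →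
    |c s x - c s' x'| ≤ 1 / (2 * ((n:ℝ) + 1)) ∧ ‖v s x - v s' x'‖ ≤ 1 / (2 * ((n:ℝ) + 1))

lemma Mdl.path {d : ℕ} {K : ℝ} {δ : ℕ → ℝ} {c : ℝ → Euc d → ℝ} {v : ℝ → Euc d → Euc d}
    (H : Mdl K δ c v) {t0 t1 : ℝ} {x0 x : Euc d} (hr : Reachable c v t0 x0 t1 x) :
    ∃ γ : ℝ → Euc d, γ t0 = x0 ∧ γ t1 = x ∧
      (∀ s s', t0 ≤ s → s ≤ s' → s' ≤ t1 → ‖γ s' - γ s‖ ≤ 2 * K * (s' - s)) ∧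
      (∀ n : ℕ, ∀ s s', t0 ≤ s → s ≤ s' → s' ≤ t1 → s' - s ≤ δ n →
      ‖γ s' - γ s - (s' - s) • v s (γ s)‖ ≤ (s' - s) * (c s (γ s) + 1 / ((n:ℝ) + 1))) := by
  obtain ⟨h01, γ, g, hi, he, hx, ha⟩ := hr
  have hK : 0 ≤ K := (norm_nonneg _).trans (H.vK 0 0)
  have isub : ∀ s s', t0 ≤ s → s ≤ s' → s' ≤ t1 → IntervalIntegrable g volume s s' := by
    intro s s' h1 h2 h3
    refine hi.mono_set ?_
    rw [Set.uIcc_of_le h2, Set.uIcc_of_le h01]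
    exact Set.Icc_subset_Icc h1 h3
  have dif : ∀ s s', t0 ≤ s → s ≤ s' → s' ≤ t1 → γ s' - γ s = ∫ r in s..s', g r := by
    intro s s' h1 h2 h3
    rw [he s' ⟨h1.trans h2, h3⟩, he s ⟨h1, h2.trans h3⟩,
      ← intervalIntegral.integral_add_adjacent_intervals (isub t0 s le_rfl h1 (h2.trans h3)) (isub s s' h1 h2 h3)]
    abel
  rw [ae_restrict_iff' measurableSet_Icc] at ha
  have lip : ∀ s s', t0 ≤ s → s ≤ s' → s' ≤ t1 → ‖γ s' - γ s‖ ≤ 2 * K * (s' - s) := by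
    intro s s' h1 h2 h3
    rw [dif s s' h1 h2 h3]
    refine (intervalIntegral.norm_integral_le_of_norm_le_const_ae (C := 2 * K) ?_).trans (by
      rw [abs_of_nonneg (by linarith)])
    filter_upwards [ha] with r hr hrs
    rw [Set.uIoc_of_le h2] at hrs
    have q1 := hr ⟨by linarith [hrs.1], by linarith [hrs.2]⟩
    have q2 := norm_le_norm_add_norm_sub' (g r) (v r (γ r))
    linarith [H.cK r (γ r), H.vK r (γ r)]
  refine ⟨γ, by rw [he t0 ⟨le_rfl, h01⟩]; simp, hx, lip, ?_⟩
  intro n s s' h1 h2 h3 h4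
  have e : γ s' - γ s - (s' - s) • v s (γ s) = ∫ r in s..s', (g r - v s (γ s)) := by
    rw [intervalIntegral.integral_sub (isub s s' h1 h2 h3) intervalIntegrable_const, dif s s' h1 h2 h3,
      intervalIntegral.integral_const]
  rw [e]
  refine (intervalIntegral.norm_integral_le_of_norm_le_const_ae (C := c s (γ s) + 1 / ((n:ℝ) + 1)) ?_).trans (by
      rw [abs_of_nonneg (by linarith), mul_comm])
  filter_upwards [ha] with r hr hrs
  rw [Set.uIoc_of_le h2] at hrs
  have q1 := hr ⟨by linarith [hrs.1], by linarith [hrs.2]⟩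
  have q2 := lip s r h1 hrs.1.le (by linarith [hrs.2])
  have q3 := H.md n r s (γ r) (γ s) (by rw [abs_of_pos (by linarith [hrs.1])]; linarith [hrs.2]) (q2.trans (by
    gcongr; linarith [hrs.2]))
  have q4 : g r - v s (γ s) = (g r - v r (γ r)) + (v r (γ r) - v s (γ s)) := by abel
  rw [q4]
  refine (norm_add_le _ _).trans ?_
  have q5 := (abs_le.1 q3.1).2
  have q6 : 1 / ((n:ℝ) + 1) = 1 / (2 * ((n:ℝ) + 1)) + 1 / (2 * ((n:ℝ) + 1)) := by field_simp; norm_num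
  linarith [q3.2]

/-- compact projection -/
lemma meas_proj {X Ω ι : Type*} [TopologicalSpace X] [CompactSpace X] [TopologicalSpace.SeparableSpace X]
    [Nonempty X] [Countable ι] [Nonempty ι] [MeasurableSpace Ω] (F : ι → X → Ω → ℝ)
    (hc : ∀ i ω, Continuous fun p => F i p ω) (hm : ∀ i p, Measurable (F i p)) :
    MeasurableSet {ω | ∃ p, ∀ i, F i p ω ≤ 0} := by
  obtain ⟨e, he⟩ := exists_surjective_nat ι
  have : {ω | ∃ p, ∀ i, F i p ω ≤ 0} = ⋂ m : ℕ, ⋃ k : ℕ, ⋂ n : ℕ, ⋂ (_ : n ≤ m),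
      {ω | F (e n) (TopologicalSpace.denseSeq X k) ω < 1 / ((m:ℝ) + 1)} := by
    ext ω
    simp only [Set.mem_iInter, Set.mem_iUnion]
    constructor
    · rintro ⟨p, hp⟩ m
      have ho : IsOpen (⋂ n ∈ Finset.range (m + 1), {p | F (e n) p ω < 1 / ((m:ℝ) + 1)}) := by
        apply isOpen_biInter_finset
        intro n _
        exact isOpen_lt (hc _ _) continuous_const
      obtain ⟨k, hk⟩ := (TopologicalSpace.denseRange_denseSeq X).exists_mem_open ho ⟨p, by
        simp only [Set.mem_iInter]
        intro n _
        exact lt_of_le_of_lt (hp _) (by positivity)⟩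
      simp only [Set.mem_iInter] at hk
      exact ⟨k, fun n hn => hk n (Finset.mem_range.2 (by omega))⟩
    · intro h
      have ne : (⋂ m : ℕ, {p : X | ∀ n ≤ m, F (e n) p ω ≤ 1 / ((m:ℝ) + 1)}).Nonempty := by
        apply IsCompact.nonempty_iInter_of_sequence_nonempty_isCompact_isClosed
        · intro m p hp n hn
          refine (hp n (by omega)).trans ?_
          apply one_div_le_one_div_of_le (by positivity)
          push_cast; linarith
        · intro m
          obtain ⟨k, hk⟩ := h m
          exact ⟨_, fun n hn => (hk n hn).le⟩
        · apply IsClosed.isCompact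
          simp only [Set.ofPred_forall]
          exact isClosed_iInter fun n => isClosed_iInter fun _ => isClosed_le (hc _ _) continuous_const
        · intro m
          simp only [Set.ofPred_forall]
          exact isClosed_iInter fun n => isClosed_iInter fun _ => isClosed_le (hc _ _) continuous_const
      obtain ⟨p, hp⟩ := ne
      rw [Set.mem_iInter] at hp
      refine ⟨p, fun i => ?_⟩
      obtain ⟨n, rfl⟩ := he i
      refine ge_of_tendsto (tendsto_one_div_add_atTop_nhds_zero_nat (𝕜 := ℝ)) ?_
      filter_upwards [eventually_ge_atTop n] with m hm
      exact hp m n hm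
  rw [this]
  refine MeasurableSet.iInter fun m => MeasurableSet.iUnion fun k => MeasurableSet.iInter fun n =>
    MeasurableSet.iInter fun _ => measurableSet_lt (hm _ _) measurable_const

abbrev QI : Type := {θ : ℚ // 0 ≤ θ ∧ θ ≤ 1}
def QI0 : QI := ⟨0, le_rfl, zero_le_one⟩
def QI1 : QI := ⟨1, zero_le_one, le_rfl⟩
def QI.r (θ : QI) : ℝ := ((θ.1 : ℚ) : ℝ)

lemma Mdl.cont {d : ℕ} {K : ℝ} {δ : ℕ → ℝ} {c : ℝ → Euc d → ℝ} {v : ℝ → Euc d → Euc d}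
    (H : Mdl K δ c v) (hK : 0 < K) (hδ : ∀ n, 0 < δ n) :
    Continuous (fun p : ℝ × Euc d => c p.1 p.2) ∧ Continuous (fun p : ℝ × Euc d => v p.1 p.2) := by
  have key : ∀ ε > 0, ∃ η > 0, ∀ p q : ℝ × Euc d, dist p q < η → |c p.1 p.2 - c q.1 q.2| < ε ∧
      ‖v p.1 p.2 - v q.1 q.2‖ < ε := by
    intro ε hε
    obtain ⟨n, hn⟩ := exists_nat_one_div_lt hε
    refine ⟨min (δ n) (2 * K * δ n), lt_min (hδ n) (by have := hδ n; positivity), fun p q hpq => ?_⟩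
    have h1 : dist p.1 q.1 ≤ δ n := (le_max_left _ _).trans (hpq.le.trans (min_le_left _ _))
    have h2 : dist p.2 q.2 ≤ 2 * K * δ n := (le_max_right _ _).trans (hpq.le.trans (min_le_right _ _))
    rw [Real.dist_eq] at h1
    rw [dist_eq_norm] at h2
    have := H.md n p.1 q.1 p.2 q.2 h1 h2
    have h3 : 1 / (2 * ((n:ℝ) + 1)) ≤ 1 / ((n:ℝ) + 1) := by
      apply one_div_le_one_div_of_le (by positivity); linarith
    exact ⟨by linarith [this.1], by linarith [this.2]⟩
  constructor <;> rw [Metric.continuous_iff] <;> intro p ε hε <;> obtain ⟨η, hη, h⟩ := key ε hε <;>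
    refine ⟨η, hη, fun q hq => ?_⟩
  · rw [Real.dist_eq]; exact (h _ _ hq).1
  · rw [dist_eq_norm]; exact (h _ _ hq).2

lemma ext_path {d : ℕ} {K : ℝ} {δ : ℕ → ℝ} {c : ℝ → Euc d → ℝ} {v : ℝ → Euc d → Euc d}
    (H : Mdl K δ c v) (hK : 0 < K) (hδ : ∀ n, 0 < δ n) {t0 t u : ℝ} (ht : 0 ≤ t) (htu : t ≤ u)
    (q : QI → Euc d) (hq : ∀ n : ℕ, ∀ θ θ' : QI, θ < θ' → u * (θ'.r - θ.r) ≤ δ n →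
      ‖q θ' - q θ - (t * (θ'.r - θ.r)) • v (t0 + t * θ.r) (q θ)‖ ≤
        t * (θ'.r - θ.r) * (c (t0 + t * θ.r) (q θ) + 1 / ((n:ℝ) + 1))) :
    Reachable c v t0 (q QI0) (t0 + t) (q QI1) := by
  have hu : 0 ≤ u := ht.trans htu
  set B := t * (2 * K + 1) with hB
  have hB0 : 0 ≤ B := by positivity
  have hlt : ∀ θ θ' : QI, θ < θ' → θ.r < θ'.r := fun θ θ' h => by
    have : θ.1 < θ'.1 := h
    exact Rat.cast_lt.2 this
  have near : ∀ θ θ' : QI, θ < θ' → u * (θ'.r - θ.r) ≤ δ 0 → ‖q θ' - q θ‖ ≤ B * (θ'.r - θ.r) := by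
    intro θ θ' h1 h2
    have h3 := hq 0 θ θ' h1 h2
    have h4 := hlt _ _ h1
    have h5 : ‖(t * (θ'.r - θ.r)) • v (t0 + t * θ.r) (q θ)‖ ≤ t * (θ'.r - θ.r) * K := by
      rw [norm_smul, Real.norm_eq_abs, abs_of_nonneg (mul_nonneg ht (by linarith))]
      exact mul_le_mul_of_nonneg_left (H.vK _ _) (mul_nonneg ht (by linarith))
    have h6 := norm_le_norm_add_norm_sub' (q θ' - q θ) ((t * (θ'.r - θ.r)) • v (t0 + t * θ.r) (q θ))
    have h7 : t * (θ'.r - θ.r) * (c (t0 + t * θ.r) (q θ) + 1 / (((0:ℕ):ℝ) + 1)) ≤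
        t * (θ'.r - θ.r) * (K + 1) := by
      refine mul_le_mul_of_nonneg_left ?_ (mul_nonneg ht (by linarith))
      have := H.cK (t0 + t * θ.r) (q θ)
      norm_num; linarith
    rw [hB]
    nlinarith
  obtain ⟨η, hη1, hη2⟩ := exists_rat_btwn (show (0:ℝ) < δ 0 / (u + 1) from div_pos (hδ 0) (by linarith))
  have hη3 : (η:ℝ) * (u + 1) < δ 0 := by rwa [lt_div_iff₀ (by linarith)] at hη2
  have hη0 : 0 < η := by exact_mod_cast hη1
  have ind : ∀ k : ℕ, ∀ θ θ' : QI, θ ≤ θ' → θ'.r - θ.r ≤ k * η → ‖q θ' - q θ‖ ≤ B * (θ'.r - θ.r) := by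
    intro k
    induction k with
    | zero =>
      intro θ θ' h1 h2
      rcases h1.eq_or_lt with h | h
      · subst h; simp
      · have := hlt _ _ h
        simp at h2; linarith
    | succ k ih =>
      intro θ θ' h1 h2
      rcases h1.eq_or_lt with h | h
      · subst h; simp
      have hl := hlt _ _ h
      by_cases h3 : θ'.r - θ.r ≤ η
      · exact near θ θ' h (by nlinarith)
      · push Not at h3
        have h4 : θ.1 + η < θ'.1 := by
          have : (θ.1:ℝ) + η < θ'.1 := by simp only [QI.r] at h3; linarith
          exact_mod_cast this
        set φ : QI := ⟨θ.1 + η, by linarith [θ.2.1], by linarith [θ'.2.2]⟩ with hφ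
        have hφr : φ.r = θ.r + η := by simp [QI.r, hφ]
        have a1 := near θ φ (show θ.1 < θ.1 + η by linarith) (by rw [hφr]; nlinarith)
        have a2 := ih φ θ' h4.le (by rw [hφr]; push_cast at h2; linarith)
        have a3 : q θ' - q θ = (q θ' - q φ) + (q φ - q θ) := by abel
        rw [a3]
        refine (norm_add_le _ _).trans ?_
        nlinarith
  have lip : ∀ θ θ' : QI, ‖q θ' - q θ‖ ≤ B * |θ'.r - θ.r| := by
    have : ∀ θ θ' : QI, θ ≤ θ' → ‖q θ' - q θ‖ ≤ B * (θ'.r - θ.r) := by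
      intro θ θ' h
      obtain ⟨k, hk⟩ := exists_nat_ge ((θ'.r - θ.r) / η)
      rw [div_le_iff₀ hη1] at hk
      exact ind k θ θ' h hk
    intro θ θ'
    rcases le_total θ θ' with h | h
    · exact (this _ _ h).trans (mul_le_mul_of_nonneg_left (le_abs_self _) hB0)
    · rw [norm_sub_rev, abs_sub_comm]
      exact (this _ _ h).trans (mul_le_mul_of_nonneg_left (le_abs_self _) hB0)
  have inj : Function.Injective QI.r := fun θ θ' h => by
    apply Subtype.ext; simp only [QI.r] at h; exact_mod_cast h
  have lipon : LipschitzOnWith B.toNNReal (Function.extend QI.r q 0) (Set.range QI.r) := by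
    apply LipschitzOnWith.of_dist_le_mul
    rintro _ ⟨θ, rfl⟩ _ ⟨θ', rfl⟩
    rw [inj.extend_apply, inj.extend_apply, Real.coe_toNNReal _ hB0, dist_eq_norm, Real.dist_eq]
    exact lip θ' θ
  obtain ⟨Q, hQl, hQe⟩ := lipon.extend_finite_dimension
  have hQ : ∀ θ : QI, Q θ.r = q θ := fun θ => by
    rw [← hQe ⟨θ, rfl⟩, inj.extend_apply]
  have r0 : QI0.r = 0 := by simp [QI.r, QI0]
  have r1 : QI1.r = 1 := by simp [QI.r, QI1]
  rcases ht.eq_or_lt with h | hpos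
  · have : q QI1 = q QI0 := by
      have := lip QI0 QI1
      rw [hB, ← h] at this
      simp at this
      exact sub_eq_zero.1 this
    rw [this, ← h, add_zero]; exact Reachable.refl' _ _ _ _
  obtain ⟨cc, vc⟩ := H.cont hK hδ
  have dens : ∀ n : ℕ, ∀ α α' : ℝ, 0 < α → α < α' → α' < 1 → u * (α' - α) < δ n →
      ‖Q α' - Q α - (t * (α' - α)) • v (t0 + t * α) (Q α)‖ ≤
        t * (α' - α) * (c (t0 + t * α) (Q α) + 1 / ((n:ℝ) + 1)) := by
    intro n α α' h1 h2 h3 h4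
    by_contra hcon
    push Not at hcon
    have hQc := hQl.continuous
    have vc2 : Continuous fun p : ℝ × ℝ => v (t0 + t * p.1) (Q p.1) :=
      vc.comp (f := fun p : ℝ × ℝ => (t0 + t * p.1, Q p.1)) (by fun_prop)
    have cc2 : Continuous fun p : ℝ × ℝ => c (t0 + t * p.1) (Q p.1) :=
      cc.comp (f := fun p : ℝ × ℝ => (t0 + t * p.1, Q p.1)) (by fun_prop)
    have ho : IsOpen {p : ℝ × ℝ | (0 < p.1 ∧ p.1 < p.2 ∧ p.2 < 1 ∧ u * (p.2 - p.1) < δ n) ∧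
        t * (p.2 - p.1) * (c (t0 + t * p.1) (Q p.1) + 1 / ((n:ℝ) + 1)) <
        ‖Q p.2 - Q p.1 - (t * (p.2 - p.1)) • v (t0 + t * p.1) (Q p.1)‖} := by
      refine IsOpen.and (IsOpen.and ?_ (IsOpen.and ?_ (IsOpen.and ?_ ?_))) ?_ <;>
        apply isOpen_lt <;> fun_prop
    have hd : DenseRange (Prod.map ((↑) : ℚ → ℝ) ((↑) : ℚ → ℝ)) :=
      Rat.denseRange_cast.prodMap Rat.denseRange_cast
    obtain ⟨⟨θ, θ'⟩, ⟨g1, g2, g3, g4⟩, g5⟩ := hd.exists_mem_open ho ⟨(α, α'), ⟨h1, h2, h3, h4⟩, hcon⟩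
    simp only [Prod.map] at g1 g2 g3 g4 g5
    have f1 : 0 < θ := by exact_mod_cast g1
    have f2 : θ < θ' := by exact_mod_cast g2
    have f3 : θ' < 1 := by exact_mod_cast g3
    have := hq n ⟨θ, f1.le, by linarith⟩ ⟨θ', by linarith, f3.le⟩ f2 g4.le
    rw [← hQ, ← hQ] at this
    simp only [QI.r] at this
    linarith
  set γ : ℝ → Euc d := fun s => Q ((s - t0) / t) with hγ
  have hγl : LipschitzWith (lipschitzExtensionConstant (Euc d) * B.toNNReal * (1 / t).toNNReal) γ := by
    refine hQl.comp (LipschitzWith.of_dist_le_mul fun x y => ?_)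
    rw [Real.dist_eq, Real.dist_eq, Real.coe_toNNReal _ (by positivity), ← sub_div, abs_div, abs_of_pos hpos]
    simp only [sub_sub_sub_cancel_right]
    exact le_of_eq (by ring)
  have e0 : γ t0 = q QI0 := by rw [← hQ, r0]; simp [hγ]
  have e1 : γ (t0 + t) = q QI1 := by rw [← hQ, r1]; simp [hγ, hpos.ne']
  rw [← e0, ← e1]
  refine reach_of_lip hγl (by linarith) fun n => ⟨t * δ n / (u + 1), by have := hδ n; positivity, ?_⟩
  intro s s' h1 h2 h3 h4
  have k1 : 0 < (s - t0) / t := div_pos (by linarith) hpos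
  have k2 : (s - t0) / t < (s' - t0) / t := div_lt_div_of_pos_right (by linarith) hpos
  have k3 : (s' - t0) / t < 1 := by rw [div_lt_one hpos]; linarith
  have k4 : t * ((s' - t0) / t - (s - t0) / t) = s' - s := by field_simp; ring
  have k5 : t0 + t * ((s - t0) / t) = s := by field_simp; ring
  have k6 : u * ((s' - t0) / t - (s - t0) / t) < δ n := by
    rw [lt_div_iff₀ (by linarith), ← k4, mul_assoc, mul_lt_mul_iff_right₀ hpos] at h4
    nlinarith
  have := dens n _ _ k1 k2 k3 k6
  rw [k4, k5] at this
  exact this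

open Classical in
def FF {d : ℕ} {Ω : Type*} (δ : ℕ → ℝ) (c : ℝ → Euc d → Ω → ℝ) (v : ℝ → Euc d → Ω → Euc d) (t0 u R : ℝ)
    (x0 x : Euc d) (i : ℕ × QI × QI) (p : Set.Icc (0:ℝ) u × (QI → closedBall x0 R)) (ω : Ω) : ℝ :=
  max (dist (p.2 QI0).1 x0) (max (dist (p.2 QI1).1 x)
    (if i.2.1 < i.2.2 ∧ u * (i.2.2.r - i.2.1.r) ≤ δ i.1 then
      ‖(p.2 i.2.2).1 - (p.2 i.2.1).1 -
        (p.1.1 * (i.2.2.r - i.2.1.r)) • v (t0 + p.1.1 * i.2.1.r) (p.2 i.2.1).1 ω‖ -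
        p.1.1 * (i.2.2.r - i.2.1.r) * (c (t0 + p.1.1 * i.2.1.r) (p.2 i.2.1).1 ω + 1 / ((i.1:ℝ) + 1))
    else 0))

lemma QI.r_nonneg (θ : QI) : 0 ≤ θ.r := by have := θ.2.1; simp only [QI.r]; exact_mod_cast this
lemma QI.r_le_one (θ : QI) : θ.r ≤ 1 := by have := θ.2.2; simp only [QI.r]; exact_mod_cast this

lemma meas_reach {d : ℕ} {Ω : Type*} [MeasurableSpace Ω] {K : ℝ} {δ : ℕ → ℝ}
    {c : ℝ → Euc d → Ω → ℝ} {v : ℝ → Euc d → Ω → Euc d}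
    (H : ∀ ω, Mdl K δ (fun a b => c a b ω) (fun a b => v a b ω)) (hK : 0 < K) (hδ : ∀ n, 0 < δ n)
    {t0 u : ℝ} (hu : 0 ≤ u) (x0 x : Euc d)
    (hm : ∀ s ∈ Set.Icc t0 (t0 + u), ∀ y, Measurable (c s y) ∧ Measurable (v s y)) :
    MeasurableSet {ω | ∃ t ∈ Set.Icc 0 u,
      Reachable (fun a b => c a b ω) (fun a b => v a b ω) t0 x0 (t0 + t) x} := by
  classical
  set R := 2 * K * u with hR
  have hR0 : 0 ≤ R := by positivity
  have hlt : ∀ θ θ' : QI, θ < θ' → θ.r < θ'.r := fun θ θ' h => by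
    have : θ.1 < θ'.1 := h
    exact Rat.cast_lt.2 this
  have eq : {ω | ∃ t ∈ Set.Icc 0 u,
      Reachable (fun a b => c a b ω) (fun a b => v a b ω) t0 x0 (t0 + t) x} =
      {ω | ∃ p, ∀ i, FF δ c v t0 u R x0 x i p ω ≤ 0} := by
    ext ω
    constructor
    · rintro ⟨t, ht, hr⟩
      obtain ⟨γ, g0, g1, gl, ge⟩ := (H ω).path hr
      have hmem : ∀ θ : QI, t0 ≤ t0 + t * θ.r ∧ t0 + t * θ.r ≤ t0 + t := fun θ =>
        ⟨by nlinarith [θ.r_nonneg, ht.1], by nlinarith [θ.r_le_one, ht.1]⟩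
      refine ⟨⟨⟨t, ht⟩, fun θ => ⟨γ (t0 + t * θ.r), ?_⟩⟩, ?_⟩
      · rw [mem_closedBall, dist_eq_norm]
        have := gl t0 (t0 + t * θ.r) le_rfl (hmem θ).1 (hmem θ).2
        rw [g0] at this
        refine this.trans ?_
        rw [hR]
        have : t0 + t * θ.r - t0 ≤ u := by linarith [(hmem θ).2, ht.2]
        gcongr
      · rintro ⟨n, θ, θ'⟩
        simp only [FF]
        have e0 : γ (t0 + t * QI0.r) = x0 := by simp [QI.r, QI0, g0]
        have e1 : γ (t0 + t * QI1.r) = x := by simp [QI.r, QI1, g1]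
        rw [e0, e1]
        refine max_le (by simp) (max_le (by simp) ?_)
        split_ifs with hh
        · have hl := hlt _ _ hh.1
          have k : t0 + t * θ'.r - (t0 + t * θ.r) = t * (θ'.r - θ.r) := by ring
          have := ge n (t0 + t * θ.r) (t0 + t * θ'.r) (hmem θ).1 (by nlinarith [ht.1]) (hmem θ').2 (by
            rw [k]; refine le_trans ?_ hh.2
            exact mul_le_mul_of_nonneg_right ht.2 (by linarith))
          rw [k] at this
          linarith
        · exact le_rfl
    · rintro ⟨⟨⟨t, ht⟩, q⟩, hp⟩
      refine ⟨t, ht, ?_⟩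
      have a0 := (max_le_iff.1 (hp (0, QI0, QI0))).1
      have a1 := (max_le_iff.1 (max_le_iff.1 (hp (0, QI0, QI0))).2).1
      simp only at a0 a1
      have b0 : (q QI0).1 = x0 := dist_le_zero.1 a0
      have b1 : (q QI1).1 = x := dist_le_zero.1 a1
      have := ext_path (t0 := t0) (H ω) hK hδ ht.1 ht.2 (fun θ => (q θ).1) (by
        intro n θ θ' h1 h2
        have := (max_le_iff.1 (max_le_iff.1 (hp (n, θ, θ'))).2).2
        simp only [h1, h2, and_self, if_true] at this
        linarith)
      simp only [b0, b1] at this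
      exact this
  rw [eq]
  have : Nonempty (Set.Icc (0:ℝ) u) := ⟨⟨0, le_rfl, hu⟩⟩
  have : Nonempty (closedBall x0 R) := ⟨⟨x0, mem_closedBall_self hR0⟩⟩
  have : CompactSpace (closedBall x0 R) := isCompact_iff_compactSpace.1 (isCompact_closedBall x0 R)
  have : Nonempty QI := ⟨QI0⟩
  refine meas_proj _ ?_ ?_
  · rintro ⟨n, θ, θ'⟩ ω
    obtain ⟨cc, vc⟩ := (H ω).cont hK hδ
    have q1 : ∀ φ : QI, Continuous fun p : Set.Icc (0:ℝ) u × (QI → closedBall x0 R) => (p.2 φ).1 :=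
      fun φ => continuous_subtype_val.comp ((continuous_apply φ).comp continuous_snd)
    have q2 : Continuous fun p : Set.Icc (0:ℝ) u × (QI → closedBall x0 R) => p.1.1 :=
      continuous_subtype_val.comp continuous_fst
    have vc2 : Continuous fun p : Set.Icc (0:ℝ) u × (QI → closedBall x0 R) =>
        v (t0 + p.1.1 * θ.r) (p.2 θ).1 ω :=
      vc.comp ((continuous_const.add (q2.mul continuous_const)).prodMk (q1 θ))
    have cc2 : Continuous fun p : Set.Icc (0:ℝ) u × (QI → closedBall x0 R) =>
        c (t0 + p.1.1 * θ.r) (p.2 θ).1 ω :=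
      cc.comp ((continuous_const.add (q2.mul continuous_const)).prodMk (q1 θ))
    simp only [FF]
    refine ((q1 _).dist continuous_const).max (((q1 _).dist continuous_const).max ?_)
    split_ifs
    · exact ((((q1 _).sub (q1 _)).sub ((q2.mul continuous_const).smul vc2)).norm).sub
        ((q2.mul continuous_const).mul (cc2.add continuous_const))
    · exact continuous_const
  · rintro ⟨n, θ, θ'⟩ ⟨⟨t, ht⟩, q⟩
    have hs : t0 + t * θ.r ∈ Set.Icc t0 (t0 + u) :=
      ⟨by nlinarith [θ.r_nonneg, ht.1], by nlinarith [θ.r_le_one, ht.1, ht.2]⟩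
    have hmm := hm _ hs (q θ).1
    have m1 : Measurable (fun ω => (t * (θ'.r - θ.r)) • v (t0 + t * θ.r) (q θ).1 ω) :=
      hmm.2.const_smul (t * (θ'.r - θ.r))
    have m2 : Measurable (fun ω => ‖(q θ').1 - (q θ).1 -
        (t * (θ'.r - θ.r)) • v (t0 + t * θ.r) (q θ).1 ω‖) := (m1.const_sub _).norm
    have m3 : Measurable (fun ω => t * (θ'.r - θ.r) * (c (t0 + t * θ.r) (q θ).1 ω + 1 / ((n:ℝ) + 1))) :=
      (hmm.1.add_const _).const_mul _
    unfold FF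
    refine measurable_const.max (measurable_const.max ?_)
    split_ifs
    · exact m2.sub m3
    · exact measurable_const

lemma tt_lt {d : ℕ} {c : ℝ → Euc d → ℝ} {v : ℝ → Euc d → Euc d} {t0 u : ℝ} {x0 x : Euc d}
    {T : ℝ} (hT : 0 ≤ T) (hr : Reachable c v t0 x0 (t0 + T) x) :
    travelTime c v t0 x0 x < u ↔ ∃ t, 0 ≤ t ∧ t < u ∧ Reachable c v t0 x0 (t0 + t) x := by
  have hne : {t | 0 ≤ t ∧ x ∈ reachSet c v t t0 x0}.Nonempty := ⟨T, hT, hr⟩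
  have hbd : BddBelow {t | 0 ≤ t ∧ x ∈ reachSet c v t t0 x0} := ⟨0, fun t ht => ht.1⟩
  unfold travelTime
  rw [csInf_lt_iff hbd hne]
  constructor
  · rintro ⟨t, ⟨h1, h2⟩, h3⟩; exact ⟨t, h1, h3, h2⟩
  · rintro ⟨t, h1, h3, h2⟩; exact ⟨t, ⟨h1, h2⟩, h3⟩

lemma tt_le {d : ℕ} {c : ℝ → Euc d → ℝ} {v : ℝ → Euc d → Euc d} {t0 : ℝ} {x0 x : Euc d}
    {t : ℝ} (ht : 0 ≤ t) (hr : Reachable c v t0 x0 (t0 + t) x) : travelTime c v t0 x0 x ≤ t :=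
  csInf_le ⟨0, fun t ht => ht.1⟩ ⟨ht, hr⟩

lemma tt_nonneg {d : ℕ} (c : ℝ → Euc d → ℝ) (v : ℝ → Euc d → Euc d) (t0 : ℝ) (x0 x : Euc d) :
    0 ≤ travelTime c v t0 x0 x := Real.sInf_nonneg fun _ h => h.1

/-- all deterministic travel time facts -/
structure Ctl {d : ℕ} (C κ : ℝ) (c : ℝ → Euc d → ℝ) (v : ℝ → Euc d → Euc d) : Prop where
  hC : 0 < C
  up : ∀ t0 x y T, C * (‖x - y‖ + 1) ≤ T → Reachable c v t0 x (t0 + T) y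
  low : ∀ t0 x y t, Reachable c v t0 x (t0 + t) y → ‖y - x‖ ≤ κ * t

namespace Ctl
variable {d : ℕ} {C κ : ℝ} {c : ℝ → Euc d → ℝ} {v : ℝ → Euc d → Euc d}

lemma lt_iff (H : Ctl C κ c v) {t0 u : ℝ} {x0 x : Euc d} :
    travelTime c v t0 x0 x < u ↔ ∃ t, 0 ≤ t ∧ t < u ∧ Reachable c v t0 x0 (t0 + t) x :=
  tt_lt (T := C * (‖x0 - x‖ + 1)) (by have := H.hC; positivity) (H.up _ _ _ _ le_rfl)

lemma tt_up (H : Ctl C κ c v) (t0 : ℝ) (x0 x : Euc d) :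
    travelTime c v t0 x0 x ≤ C * (‖x - x0‖ + 1) := by
  rw [norm_sub_rev]
  exact tt_le (by have := H.hC; positivity) (H.up _ _ _ _ le_rfl)

lemma tt_low (H : Ctl C κ c v) (hκ : 0 < κ) (t0 : ℝ) (x0 x : Euc d) :
    ‖x - x0‖ ≤ κ * travelTime c v t0 x0 x := by
  refine le_of_forall_gt_imp_ge_of_dense fun z hz => ?_
  have : travelTime c v t0 x0 x < z / κ := by rw [lt_div_iff₀ hκ]; linarith
  obtain ⟨t, h0, h1, hr⟩ := H.lt_iff.1 this
  have := H.low _ _ _ _ hr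
  rw [lt_div_iff₀ hκ] at h1
  linarith

lemma tri (H : Ctl C κ c v) {t0 k G : ℝ} {x0 x y : Euc d} (hk : travelTime c v t0 x0 y < k)
    (hG : C ≤ G) : travelTime c v t0 x0 x ≤ k + G + travelTime c v (t0 + (k + G)) y x := by
  obtain ⟨t, h0, h1, hr⟩ := H.lt_iff.1 hk
  refine le_of_forall_gt_imp_ge_of_dense fun z hz => ?_
  have : travelTime c v (t0 + (k + G)) y x < z - (k + G) := by linarith
  obtain ⟨t', h0', h1', hr'⟩ := H.lt_iff.1 this
  have w : Reachable c v (t0 + t) y (t0 + t + (k + G - t)) y := H.up _ _ _ _ (by simp; linarith)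
  rw [show t0 + t + (k + G - t) = t0 + (k + G) by ring] at w
  have := (hr.trans' w).trans' hr'
  rw [show t0 + (k + G) + t' = t0 + (k + G + t') by ring] at this
  have := tt_le (by have := H.hC; linarith) this
  linarith

lemma tri2 (H : Ctl C κ c v) {t0 : ℝ} {x0 x y : Euc d} :
    travelTime c v t0 x0 x ≤ travelTime c v t0 x0 y + C * (‖x - y‖ + 1) := by
  refine le_of_forall_gt_imp_ge_of_dense fun z hz => ?_
  have : travelTime c v t0 x0 y < z - C * (‖x - y‖ + 1) := by linarith
  obtain ⟨t', h0', h1', hr'⟩ := H.lt_iff.1 this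
  have w := H.up (t0 + t') y x _ le_rfl
  have := hr'.trans' w
  rw [add_assoc] at this
  have := tt_le (by have := H.hC; positivity) this
  rw [norm_sub_rev y x] at this
  linarith

end Ctl

lemma tt_shift {d : ℕ} (c : ℝ → Euc d → ℝ) (v : ℝ → Euc d → Euc d) (t0 : ℝ) (x0 y : Euc d) :
    travelTime c v t0 x0 (x0 + y) =
      travelTime (fun t x => c (t + t0) (x + x0)) (fun t x => v (t + t0) (x + x0)) 0 0 y := by
  unfold travelTime reachSet
  congr 1
  ext t
  refine and_congr_right fun _ => ⟨fun h => ?_, fun h => ?_⟩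
  · have := Reachable.shift (c := fun t x => c (t + t0) (x + x0)) (v := fun t x => v (t + t0) (x + x0))
      (t0 := t0) (t1 := t0 + t) (x0 := x0) (x1 := x0 + y) (-t0) (-x0) (by simpa using h)
    simpa using this
  · have := Reachable.shift (c := c) (v := v) (t0 := 0) (t1 := 0 + t) (x0 := 0) (x1 := y) t0 x0 h
    rw [zero_add, zero_add, zero_add, add_comm t, add_comm y] at this
    exact this

lemma meas_tt {d : ℕ} {Ω : Type*} [MeasurableSpace Ω] {K C κ : ℝ} {δ : ℕ → ℝ}
    {c : ℝ → Euc d → Ω → ℝ} {v : ℝ → Euc d → Ω → Euc d}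
    (H : ∀ ω, Mdl K δ (fun a b => c a b ω) (fun a b => v a b ω)) (hK : 0 < K) (hδ : ∀ n, 0 < δ n)
    (H2 : ∀ ω, Ctl C κ (fun a b => c a b ω) (fun a b => v a b ω))
    {t0 u : ℝ} (x0 x : Euc d)
    (hm : ∀ s, t0 ≤ s → s ≤ t0 + u → ∀ y, Measurable (c s y) ∧ Measurable (v s y)) :
    MeasurableSet {ω | travelTime (fun a b => c a b ω) (fun a b => v a b ω) t0 x0 x < u} := by
  have eq : {ω | travelTime (fun a b => c a b ω) (fun a b => v a b ω) t0 x0 x < u} =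
      ⋃ q : ℚ, ⋃ _ : 0 ≤ (q:ℝ) ∧ (q:ℝ) < u, {ω | ∃ t ∈ Set.Icc 0 (q:ℝ),
      Reachable (fun a b => c a b ω) (fun a b => v a b ω) t0 x0 (t0 + t) x} := by
    ext ω
    simp only [Set.mem_iUnion, Set.mem_ofPred_eq, (H2 ω).lt_iff]
    constructor
    · rintro ⟨t, h0, h1, hr⟩
      obtain ⟨q, hq1, hq2⟩ := exists_rat_btwn h1
      exact ⟨q, ⟨by linarith, hq2⟩, t, ⟨h0, hq1.le⟩, hr⟩
    · rintro ⟨q, hq, t, ht, hr⟩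
      exact ⟨t, ht.1, ht.2.trans_lt hq.2, hr⟩
  rw [eq]
  refine MeasurableSet.iUnion fun q => MeasurableSet.iUnion fun hq => ?_
  exact meas_reach H hK hδ hq.1 x0 x fun s hs y => hm s hs.1 (by linarith [hs.2, hq.2]) y

lemma meas_minus {d : ℕ} {Ω : Type*} [MeasurableSpace Ω] 
    (c : ℝ → Euc d → Ω → ℝ) (v : ℝ → Euc d → Ω → Euc d) {s t : ℝ} (h : s ≤ t) (y : Euc d) :
    Measurable[sigmaMinus c v t] (c s y) ∧ Measurable[sigmaMinus c v t] (v s y) := by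
  have : Measurable[sigmaMinus c v t] (fun ω => (c s y ω, v s y ω)) := by
    rw [measurable_iff_comap_le]
    exact le_iSup_of_le s (le_iSup_of_le h (le_iSup_of_le y le_rfl))
  exact ⟨measurable_fst.comp this, measurable_snd.comp this⟩

lemma meas_plus {d : ℕ} {Ω : Type*} [MeasurableSpace Ω] 
    (c : ℝ → Euc d → Ω → ℝ) (v : ℝ → Euc d → Ω → Euc d) {s t : ℝ} (h : t ≤ s) (y : Euc d) :
    Measurable[sigmaPlus c v t] (c s y) ∧ Measurable[sigmaPlus c v t] (v s y) := by
  have : Measurable[sigmaPlus c v t] (fun ω => (c s y ω, v s y ω)) := by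
    rw [measurable_iff_comap_le]
    exact le_iSup_of_le s (le_iSup_of_le h (le_iSup_of_le y le_rfl))
  exact ⟨measurable_fst.comp this, measurable_snd.comp this⟩

lemma mix_set {d : ℕ} {Ω : Type*} [MeasurableSpace Ω] (P : Measure Ω) [IsProbabilityMeasure P]
    (c : ℝ → Euc d → Ω → ℝ) (v : ℝ → Euc d → Ω → Euc d) {t s : ℝ} {E F : Set Ω}
    (hE : MeasurableSet[sigmaMinus c v t] E) (hF : MeasurableSet[sigmaPlus c v (t + s)] F) :
    P.real (F ∩ E) ≤ P.real E * (P.real F + phiH P c v s) := by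
  by_cases h : P E = 0
  · have h1 : P.real E = 0 := by simp [Measure.real, h]
    have h2 : P.real (F ∩ E) ≤ P.real E := measureReal_mono Set.inter_subset_right
    rw [h1] at h2 ⊢; linarith
  · have hpos : 0 < P.real E := by
      simp only [Measure.real]; exact ENNReal.toReal_pos h (measure_ne_top _ _)
    have : |P.real (F ∩ E) / P.real E - P.real F| ≤ phiH P c v s := by
      refine le_csSup ⟨1, ?_⟩ ⟨t, E, F, hE, hF, pos_iff_ne_zero.2 h, rfl⟩
      rintro r ⟨t, E, F, -, -, hp, rfl⟩
      have a1 : (P (F ∩ E)).toReal ≤ (P E).toReal :=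
        ENNReal.toReal_mono (measure_ne_top _ _) (measure_mono Set.inter_subset_right)
      have a2 : (P (F ∩ E)).toReal / (P E).toReal ≤ 1 := div_le_one_of_le₀ a1 ENNReal.toReal_nonneg
      have a3 : 0 ≤ (P (F ∩ E)).toReal / (P E).toReal := by positivity
      have a4 : (P F).toReal ≤ 1 := by
        have : P F ≤ 1 := prob_le_one
        simpa using ENNReal.toReal_mono (by simp) this
      have a5 : 0 ≤ (P F).toReal := ENNReal.toReal_nonneg
      rw [abs_le]; constructor <;> linarith
    have := (abs_le.1 this).2
    have h3 : P.real (F ∩ E) / P.real E ≤ P.real F + phiH P c v s := by linarith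
    rw [div_le_iff₀ hpos] at h3
    linarith

lemma near_subadd {g : ℝ → ℝ} {C : ℝ} (hC : 0 < C) (h0 : ∀ r, 0 ≤ r → 0 ≤ g r)
    (h1 : ∀ r, 0 ≤ r → g r ≤ C * (r + 1))
    (hs : ∀ ε, 0 < ε → ∃ D, 0 ≤ D ∧ ∀ r s, 0 ≤ r → 0 ≤ s → g (r + s) ≤ g r + g s + D + ε * s) :
    ∃ l, Tendsto (fun r => g r / r) atTop (nhds l) := by
  have key : ∀ ε, 0 < ε → ∃ S : ℝ, 1 ≤ S ∧ ∀ s, S ≤ s → ∃ R, ∀ r, R ≤ r → g r / r ≤ g s / s + 3 * ε := by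
    intro ε hε
    obtain ⟨D, hD, hsub⟩ := hs ε hε
    refine ⟨max 1 (D / ε), le_max_left _ _, fun s hSs => ?_⟩
    have hs1 : 1 ≤ s := (le_max_left _ _).trans hSs
    have hs0 : 0 < s := by linarith
    have hDs : D ≤ ε * s := by
      have := (le_max_right _ _).trans hSs
      rw [div_le_iff₀ hε] at this; linarith
    have ind : ∀ n : ℕ, ∀ u, 0 ≤ u → g (u + n * s) ≤ g u + n * (g s + D + ε * s) := by
      intro n u hu
      induction n with
      | zero => simp
      | succ n ih =>
        have := hsub (u + n * s) s (by positivity) hs0.le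
        rw [show u + ((n + 1 : ℕ) : ℝ) * s = u + n * s + s by push_cast; ring]
        push_cast
        linarith
    refine ⟨max 1 (C * (s + 1) / ε), fun r hr => ?_⟩
    have hr1 : 1 ≤ r := (le_max_left _ _).trans hr
    have hr0 : 0 < r := by linarith
    have hCr : C * (s + 1) ≤ ε * r := by
      have := (le_max_right _ _).trans hr
      rw [div_le_iff₀ hε] at this; linarith
    set n := ⌊r / s⌋₊ with hn
    have n1 : (n : ℝ) ≤ r / s := Nat.floor_le (by positivity)
    have n2 : r / s < n + 1 := Nat.lt_floor_add_one _
    have n1' : n * s ≤ r := by rwa [le_div_iff₀ hs0] at n1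
    have n2' : r < (n + 1) * s := by rwa [div_lt_iff₀ hs0] at n2
    have hu : 0 ≤ r - n * s := by linarith
    have a1 := ind n (r - n * s) hu
    rw [sub_add_cancel] at a1
    have a2 := h1 _ hu
    have a3 : C * (r - n * s + 1) ≤ C * (s + 1) := by gcongr; linarith
    have a4 : (n:ℝ) * (g s + D + ε * s) ≤ r / s * (g s + D + ε * s) := by
      have := h0 s hs0.le
      gcongr
    have a5 : r / s * (g s + D + ε * s) ≤ r / s * (g s + 2 * (ε * s)) := by
      exact mul_le_mul_of_nonneg_left (by linarith) (by positivity)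
    have a6 : r / s * (g s + 2 * (ε * s)) = r * (g s / s + 2 * ε) := by field_simp
    rw [div_le_iff₀ hr0]
    nlinarith
  have hb0 : ∀ᶠ r in atTop, 0 ≤ g r / r := by
    filter_upwards [eventually_ge_atTop 1] with r hr
    exact div_nonneg (h0 r (by linarith)) (by linarith)
  have hb1 : ∀ᶠ r in atTop, g r / r ≤ 2 * C := by
    filter_upwards [eventually_ge_atTop (1:ℝ)] with r hr
    rw [div_le_iff₀ (by linarith)]
    have := h1 r (by linarith)
    nlinarith
  have B1 : IsBoundedUnder (· ≥ ·) atTop (fun r => g r / r) := ⟨0, by simpa using hb0⟩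
  have B2 : IsBoundedUnder (· ≤ ·) atTop (fun r => g r / r) := ⟨2 * C, by simpa using hb1⟩
  set l := liminf (fun r => g r / r) atTop with hl
  refine ⟨l, ?_⟩
  rw [Metric.tendsto_atTop']
  intro ε hε
  have e1 : ∀ᶠ r in atTop, l - ε < g r / r :=
    eventually_lt_of_lt_liminf (by linarith) B1
  have e2 : ∃ᶠ r in atTop, g r / r < l + ε / 8 :=
    frequently_lt_of_liminf_lt B2.isCoboundedUnder_ge (by linarith)
  obtain ⟨S, hS, hk⟩ := key (ε / 8) (by linarith)
  obtain ⟨s, hs1, hs2⟩ := (e2.and_eventually (eventually_ge_atTop S)).exists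
  obtain ⟨R, hR⟩ := hk s hs2
  obtain ⟨R', hR'⟩ := eventually_atTop.1 e1
  refine ⟨max R R', fun r hr => ?_⟩
  have := hR r ((le_max_left _ _).trans hr.le)
  have := hR' r ((le_max_right _ _).trans hr.le)
  rw [Real.dist_eq, abs_lt]
  constructor <;> linarith

lemma half_tendsto {w : ℝ → ℝ} {A : ℝ} (h0 : ∀ r, 1 ≤ r → 0 ≤ w r)
    (h1 : ∀ r, 1 ≤ r → w r ≤ A)
    (hs : ∀ ε, 0 < ε → ∃ R, ∀ r, R ≤ r → w (2 * r) ≤ w r / 2 + ε) :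
    Tendsto w atTop (nhds 0) := by
  have hA : 0 ≤ A := (h0 1 le_rfl).trans (h1 1 le_rfl)
  rw [Metric.tendsto_atTop]
  intro ε hε
  obtain ⟨R0, hR0⟩ := hs (ε / 8) (by linarith)
  set R := max 1 R0 with hR
  have R1 : 1 ≤ R := le_max_left _ _
  have ind : ∀ n : ℕ, ∀ r, R * 2 ^ n ≤ r → w r ≤ A / 2 ^ n + 2 * (ε / 8) := by
    intro n
    induction n with
    | zero => intro r hr; simp at hr ⊢; have := h1 r (by linarith); linarith
    | succ n ih =>
      intro r hr
      have hr2 : R * 2 ^ n ≤ r / 2 := by rw [pow_succ] at hr; linarith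
      have hRr : R ≤ r / 2 := le_trans (le_mul_of_one_le_right (by linarith) (one_le_pow₀ (by norm_num))) hr2
      have a := hR0 (r / 2) ((le_max_right _ _).trans hRr)
      have b := ih _ hr2
      rw [show 2 * (r / 2) = r by ring] at a
      rw [pow_succ, ← div_div]
      linarith
  obtain ⟨n, hn⟩ := exists_pow_lt_of_lt_one (show 0 < ε / (4 * (A + 1)) by positivity) (show (1/2:ℝ) < 1 by norm_num)
  have hn' : A / 2 ^ n ≤ ε / 4 := by
    have : A / 2 ^ n = A * (1/2) ^ n := by rw [one_div, inv_pow]; rfl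
    rw [this]
    have : A * (1/2)^n ≤ (A + 1) * (ε / (4 * (A + 1))) := by gcongr; linarith
    have e : (A + 1) * (ε / (4 * (A + 1))) = ε / 4 := by field_simp
    linarith
  refine ⟨R * 2 ^ n, fun r hr => ?_⟩
  have hr1 : 1 ≤ r := R1.trans ((le_mul_of_one_le_right (by linarith) (one_le_pow₀ (by norm_num))).trans hr)
  rw [Real.dist_eq, sub_zero, abs_of_nonneg (h0 r hr1)]
  have := ind n r hr
  linarith

lemma layer_mix {Ω : Type*} [MeasurableSpace Ω] (P : Measure Ω) [IsProbabilityMeasure P]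
    {W : Ω → ℝ} (hW : Measurable W) {B φ : ℝ} (hB : 0 ≤ B) (W0 : ∀ ω, 0 ≤ W ω) (WB : ∀ ω, W ω ≤ B) {E : Set Ω}
    (hm : ∀ w, 0 < w → P.real ({ω | w ≤ W ω} ∩ E) ≤ P.real E * (P.real {ω | w ≤ W ω} + φ)) :
    ∫ ω in E, W ω ∂P ≤ P.real E * (∫ ω, W ω ∂P + φ * B) := by
  have hi : Integrable W P := Integrable.of_bound hW.aestronglyMeasurable B
    (Eventually.of_forall fun ω => by rw [Real.norm_eq_abs, abs_of_nonneg (W0 ω)]; exact WB ω)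
  rw [hi.integral_eq_integral_Ioc_meas_le (M := B) (Eventually.of_forall W0) (Eventually.of_forall WB),
    hi.restrict.integral_eq_integral_Ioc_meas_le (M := B) (Eventually.of_forall W0) (Eventually.of_forall WB)]
  have int : ∀ μ : Measure Ω, IsFiniteMeasure μ → IntegrableOn (fun t : ℝ => μ.real {a | t ≤ W a}) (Set.Ioc 0 B) := by
    intro μ hμ
    have anti : Antitone (fun t : ℝ => μ.real {a | t ≤ W a}) := fun s t hst =>
      measureReal_mono (fun a (ha : t ≤ W a) => hst.trans ha)
    exact (anti.antitoneOn _).integrableOn_isCompact (s := Set.Icc 0 B) isCompact_Icc |>.mono_set Set.Ioc_subset_Icc_self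
  have e : P.real E * ((∫ t in Set.Ioc 0 B, P.real {a | t ≤ W a}) + φ * B) =
      ∫ t in Set.Ioc 0 B, P.real E * (P.real {a | t ≤ W a} + φ) := by
    rw [integral_const_mul, integral_add (int P inferInstance) (integrable_const _)]
    simp [hB]
    left; ring
  rw [e]
  refine setIntegral_mono_on (int _ inferInstance)
    (((int P inferInstance).add (integrable_const _)).const_mul _) measurableSet_Ioc fun t ht => ?_
  rw [measureReal_restrict_apply (measurableSet_le measurable_const hW)]
  exact hm t ht.1

lemma sum_cells {Ω : Type*} [MeasurableSpace Ω] (P : Measure Ω) [IsProbabilityMeasure P]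
    {X F G : Ω → ℝ} (hX : Measurable X) (X0 : ∀ ω, 0 ≤ X ω)
    (hF : Integrable F P) (hG : Integrable G P)
    (h : ∀ k : ℕ, ∫ ω in {ω | (k:ℝ) ≤ X ω ∧ X ω < k + 1}, F ω ∂P ≤
      ∫ ω in {ω | (k:ℝ) ≤ X ω ∧ X ω < k + 1}, G ω ∂P) : ∫ ω, F ω ∂P ≤ ∫ ω, G ω ∂P := by
  have hm : ∀ k : ℕ, MeasurableSet {ω | (k:ℝ) ≤ X ω ∧ X ω < k + 1} := fun k =>
    (measurableSet_le measurable_const hX).inter (measurableSet_lt hX measurable_const)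
  have hd : Pairwise (Function.onFun Disjoint fun k : ℕ => {ω | (k:ℝ) ≤ X ω ∧ X ω < k + 1}) := by
    intro i j hij
    rw [Function.onFun, Set.disjoint_left]
    rintro ω ⟨h1, h2⟩ ⟨h3, h4⟩
    apply hij
    have a : (i:ℝ) < j + 1 := by linarith
    have b : (j:ℝ) < i + 1 := by linarith
    have a' : i < j + 1 := by exact_mod_cast a
    have b' : j < i + 1 := by exact_mod_cast b
    omega
  have hu : ⋃ k : ℕ, {ω | (k:ℝ) ≤ X ω ∧ X ω < k + 1} = Set.univ := by
    ext ω
    simp only [Set.mem_iUnion, Set.mem_univ, iff_true]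
    exact ⟨⌊X ω⌋₊, Nat.floor_le (X0 ω), Nat.lt_floor_add_one _⟩
  have s1 := hasSum_integral_iUnion hm hd hF.integrableOn
  have s2 := hasSum_integral_iUnion hm hd hG.integrableOn
  rw [hu, setIntegral_univ] at s1 s2
  exact hasSum_le h s1 s2

section
open MeasureTheory Filter Metric ProbabilityTheory

structure Lln {d : ℕ} {Ω : Type*} [MeasurableSpace Ω] (P : Measure Ω) (τ : ℝ → Euc d → Euc d → Ω → ℝ)
    (C κ : ℝ) (φ : ℝ → ℝ) : Prop where
  hC : 0 < C
  hκ : 0 < κ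
  meas : ∀ t x y, Measurable (τ t x y)
  nn : ∀ t x y ω, 0 ≤ τ t x y ω
  up : ∀ t x y ω, τ t x y ω ≤ C * (‖y - x‖ + 1)
  low : ∀ t x y ω, ‖y - x‖ ≤ κ * τ t x y ω
  tri : ∀ k G x y ω, τ 0 0 x ω < k → C ≤ G → τ 0 0 y ω ≤ k + G + τ (k + G) x y ω
  tri2 : ∀ x y ω, τ 0 0 x ω ≤ τ 0 0 y ω + C * (‖x - y‖ + 1)
  idd : ∀ t x y, IdentDistrib (τ t x (x + y)) (τ 0 0 y) P P
  mix : ∀ x y z a b G w, a ≤ b → P.real ({ω | w ≤ τ (b + G) y z ω} ∩ {ω | a ≤ τ 0 0 x ω ∧ τ 0 0 x ω < b}) ≤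
    P.real {ω | a ≤ τ 0 0 x ω ∧ τ 0 0 x ω < b} * (P.real {ω | w ≤ τ (b + G) y z ω} + φ G)

namespace Lln
variable {d : ℕ} {Ω : Type*} [MeasurableSpace Ω] {P : Measure Ω} [IsProbabilityMeasure P]
  {τ : ℝ → Euc d → Euc d → Ω → ℝ} {C κ : ℝ} {φ : ℝ → ℝ}

lemma int1 (H : Lln P τ C κ φ) (t : ℝ) (x y : Euc d) : Integrable (τ t x y) P :=
  Integrable.of_bound (H.meas t x y).aestronglyMeasurable (C * (‖y - x‖ + 1))
    (Eventually.of_forall fun ω => by rw [Real.norm_eq_abs, abs_of_nonneg (H.nn _ _ _ _)]; exact H.up _ _ _ _)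

lemma up2 (H : Lln P τ C κ φ) (t : ℝ) (x y : Euc d) (ω : Ω) : τ t x y ω ^ 2 ≤ (C * (‖y - x‖ + 1)) ^ 2 :=
  pow_le_pow_left₀ (H.nn _ _ _ _) (H.up _ _ _ _) 2

lemma int2 (H : Lln P τ C κ φ) (t : ℝ) (x y : Euc d) : Integrable (fun ω => τ t x y ω ^ 2) P :=
  Integrable.of_bound ((H.meas t x y).pow_const 2).aestronglyMeasurable ((C * (‖y - x‖ + 1)) ^ 2)
    (Eventually.of_forall fun ω => by
      rw [Real.norm_eq_abs, abs_of_nonneg (sq_nonneg _)]; exact H.up2 _ _ _ _)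

lemma cell1 (H : Lln P τ C κ φ) (x y : Euc d) (a b G : ℝ) (hab : a ≤ b) :
    ∫ ω in {ω | a ≤ τ 0 0 x ω ∧ τ 0 0 x ω < b}, τ (b + G) x (x + y) ω ∂P ≤
      P.real {ω | a ≤ τ 0 0 x ω ∧ τ 0 0 x ω < b} * (∫ ω, τ 0 0 y ω ∂P + φ G * (C * (‖y‖ + 1))) := by
  rw [← (H.idd (b + G) x y).integral_eq]
  have hC := H.hC
  refine layer_mix P (H.meas _ _ _) (by positivity) (H.nn _ _ _) (fun ω => ?_) (fun w _ => H.mix _ _ _ _ _ _ _ hab)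
  simpa using H.up (b + G) x (x + y) ω

lemma cell2 (H : Lln P τ C κ φ) (x y : Euc d) (a b G : ℝ) (hab : a ≤ b) :
    ∫ ω in {ω | a ≤ τ 0 0 x ω ∧ τ 0 0 x ω < b}, τ (b + G) x (x + y) ω ^ 2 ∂P ≤
      P.real {ω | a ≤ τ 0 0 x ω ∧ τ 0 0 x ω < b} *
        (∫ ω, τ 0 0 y ω ^ 2 ∂P + φ G * (C * (‖y‖ + 1)) ^ 2) := by
  have e : ∫ ω, τ 0 0 y ω ^ 2 ∂P = ∫ ω, τ (b + G) x (x + y) ω ^ 2 ∂P :=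
    ((H.idd (b + G) x y).comp (measurable_id.pow_const 2)).integral_eq.symm
  rw [e]
  refine layer_mix P ((H.meas _ _ _).pow_const 2) (by positivity) (fun ω => sq_nonneg _) (fun ω => ?_) (fun w hw => ?_)
  · simpa using H.up2 (b + G) x (x + y) ω
  · have : {ω | w ≤ τ (b + G) x (x + y) ω ^ 2} = {ω | √w ≤ τ (b + G) x (x + y) ω} := by
      ext ω; exact (Real.sqrt_le_left (H.nn _ _ _ _)).symm
    rw [this]
    exact H.mix _ _ _ _ _ _ _ hab

lemma block1 (H : Lln P τ C κ φ) (x y : Euc d) (G : ℝ) (hG : C ≤ G) :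
    ∫ ω, τ 0 0 (x + y) ω ∂P ≤
      ∫ ω, τ 0 0 x ω ∂P + (1 + G + (∫ ω, τ 0 0 y ω ∂P + φ G * (C * (‖y‖ + 1)))) := by
  set m1 := ∫ ω, τ 0 0 y ω ∂P + φ G * (C * (‖y‖ + 1)) with hm1
  have i1 := H.int1 0 0 x
  have : ∫ ω, τ 0 0 x ω ∂P + (1 + G + m1) = ∫ ω, (τ 0 0 x ω + (1 + G + m1)) ∂P := by
    rw [integral_add i1 (integrable_const _)]; simp
  rw [this]
  refine sum_cells P (H.meas 0 0 x) (H.nn 0 0 x) (H.int1 _ _ _) (i1.add (integrable_const _)) fun k => ?_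
  set A := {ω | (k:ℝ) ≤ τ 0 0 x ω ∧ τ 0 0 x ω < k + 1} with hA
  have hAm : MeasurableSet A := (measurableSet_le measurable_const (H.meas 0 0 x)).inter
    (measurableSet_lt (H.meas 0 0 x) measurable_const)
  have c1 := H.cell1 x y k (k + 1) G (by linarith)
  have iz : Integrable (τ ((k:ℝ) + 1 + G) x (x + y)) (P.restrict A) := (H.int1 _ _ _).restrict
  calc ∫ ω in A, τ 0 0 (x + y) ω ∂P ≤ ∫ ω in A, ((k:ℝ) + 1 + G + τ ((k:ℝ) + 1 + G) x (x + y) ω) ∂P := by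
        refine setIntegral_mono_on (H.int1 _ _ _).restrict ((integrable_const _).add iz) hAm fun ω hω => ?_
        exact H.tri (k + 1) G x (x + y) ω hω.2 hG
    _ = P.real A * ((k:ℝ) + 1 + G) + ∫ ω in A, τ ((k:ℝ) + 1 + G) x (x + y) ω ∂P := by
        rw [integral_add (integrable_const _) iz]; simp
    _ ≤ P.real A * ((k:ℝ) + 1 + G) + P.real A * m1 := by linarith
    _ = ∫ ω in A, ((k:ℝ) + (1 + G + m1)) ∂P := by simp; ring
    _ ≤ _ := by
        refine setIntegral_mono_on (integrable_const _) (i1.add (integrable_const _)).restrict hAm fun ω hω => ?_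
        have := hω.1
        linarith

lemma block2 (H : Lln P τ C κ φ) (x y : Euc d) (G : ℝ) (hG : C ≤ G) (hφ : 0 ≤ φ G) :
    ∫ ω, τ 0 0 (x + y) ω ^ 2 ∂P ≤
      ∫ ω, τ 0 0 x ω ^ 2 ∂P + 2 * (1 + G + (∫ ω, τ 0 0 y ω ∂P + φ G * (C * (‖y‖ + 1)))) * ∫ ω, τ 0 0 x ω ∂P
      + ((1 + G) ^ 2 + 2 * (1 + G) * (∫ ω, τ 0 0 y ω ∂P + φ G * (C * (‖y‖ + 1))) +
        (∫ ω, τ 0 0 y ω ^ 2 ∂P + φ G * (C * (‖y‖ + 1)) ^ 2)) := by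
  have hC := H.hC
  have hm10 : 0 ≤ ∫ ω, τ 0 0 y ω ∂P + φ G * (C * (‖y‖ + 1)) :=
    add_nonneg (integral_nonneg (H.nn _ _ _)) (by positivity)
  set m1 := ∫ ω, τ 0 0 y ω ∂P + φ G * (C * (‖y‖ + 1)) with hm1
  set m2 := ∫ ω, τ 0 0 y ω ^ 2 ∂P + φ G * (C * (‖y‖ + 1)) ^ 2 with hm2
  have i1 := H.int1 0 0 x
  have i2 := H.int2 0 0 x
  have i3 : Integrable (fun ω => τ 0 0 x ω ^ 2 + 2 * (1 + G + m1) * τ 0 0 x ω) P :=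
    i2.add (i1.const_mul _)
  have i4 : Integrable (fun ω => τ 0 0 x ω ^ 2 + 2 * (1 + G + m1) * τ 0 0 x ω +
      ((1 + G) ^ 2 + 2 * (1 + G) * m1 + m2)) P := i3.add (integrable_const _)
  have : ∫ ω, τ 0 0 x ω ^ 2 ∂P + 2 * (1 + G + m1) * ∫ ω, τ 0 0 x ω ∂P +
      ((1 + G) ^ 2 + 2 * (1 + G) * m1 + m2) = ∫ ω, (τ 0 0 x ω ^ 2 + 2 * (1 + G + m1) * τ 0 0 x ω +
      ((1 + G) ^ 2 + 2 * (1 + G) * m1 + m2)) ∂P := by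
    rw [integral_add i3 (integrable_const _), integral_add i2 (i1.const_mul _), integral_const_mul]; simp
  rw [this]
  refine sum_cells P (H.meas 0 0 x) (H.nn 0 0 x) (H.int2 _ _ _) i4 fun k => ?_
  set A := {ω | (k:ℝ) ≤ τ 0 0 x ω ∧ τ 0 0 x ω < k + 1} with hA
  have hAm : MeasurableSet A := (measurableSet_le measurable_const (H.meas 0 0 x)).inter
    (measurableSet_lt (H.meas 0 0 x) measurable_const)
  have c1 := H.cell1 x y k (k + 1) G (by linarith)
  have c2 := H.cell2 x y k (k + 1) G (by linarith)
  have iz : Integrable (τ ((k:ℝ) + 1 + G) x (x + y)) (P.restrict A) := (H.int1 _ _ _).restrict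
  have iz2 : Integrable (fun ω => τ ((k:ℝ) + 1 + G) x (x + y) ω ^ 2) (P.restrict A) := (H.int2 _ _ _).restrict
  have j1 : Integrable (fun ω => ((k:ℝ) + 1 + G) ^ 2 +
      2 * ((k:ℝ) + 1 + G) * τ ((k:ℝ) + 1 + G) x (x + y) ω) (P.restrict A) :=
    (integrable_const _).add (iz.const_mul _)
  have hk : (0:ℝ) ≤ k := k.cast_nonneg
  have hT : 0 ≤ (k:ℝ) + 1 + G := by linarith
  calc ∫ ω in A, τ 0 0 (x + y) ω ^ 2 ∂P ≤ ∫ ω in A, (((k:ℝ) + 1 + G) ^ 2 +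
      2 * ((k:ℝ) + 1 + G) * τ ((k:ℝ) + 1 + G) x (x + y) ω + τ ((k:ℝ) + 1 + G) x (x + y) ω ^ 2) ∂P := by
        refine setIntegral_mono_on (H.int2 _ _ _).restrict (j1.add iz2) hAm fun ω hω => ?_
        have := pow_le_pow_left₀ (H.nn _ _ _ _) (H.tri (k + 1) G x (x + y) ω hω.2 hG) 2
        linarith
    _ = P.real A * ((k:ℝ) + 1 + G) ^ 2 + 2 * ((k:ℝ) + 1 + G) * ∫ ω in A, τ ((k:ℝ) + 1 + G) x (x + y) ω ∂P +
          ∫ ω in A, τ ((k:ℝ) + 1 + G) x (x + y) ω ^ 2 ∂P := by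
        rw [integral_add j1 iz2, integral_add (integrable_const _) (iz.const_mul _), integral_const_mul]; simp
    _ ≤ P.real A * ((k:ℝ) + 1 + G) ^ 2 + 2 * ((k:ℝ) + 1 + G) * (P.real A * m1) + P.real A * m2 := by
        gcongr
    _ = ∫ ω in A, ((k:ℝ) ^ 2 + 2 * (1 + G + m1) * k + ((1 + G) ^ 2 + 2 * (1 + G) * m1 + m2)) ∂P := by
        simp; ring
    _ ≤ _ := by
        refine setIntegral_mono_on (integrable_const _) i4.restrict hAm fun ω hω => ?_
        have h1 := hω.1
        have : 0 ≤ 1 + G + m1 := by linarith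
        gcongr
end Lln

end

section
open MeasureTheory Filter Metric ProbabilityTheory

lemma var_arith {g q φ C G r : ℝ} (hr : 1 ≤ r) (hC : 0 < C) (hG : 0 ≤ G) (hφ : 0 ≤ φ)
    (g1 : g ≤ C * (r + 1)) :
    q + 2 * (1 + G + (g + φ * (C * (r + 1)))) * g + ((1 + G) ^ 2 + 2 * (1 + G) * (g + φ * (C * (r + 1))) +
      (q + φ * (C * (r + 1)) ^ 2)) ≤ 2 * q + 2 * g ^ 2 + φ * (12 * C ^ 2) * r ^ 2 +
        ((1 + G) ^ 2 + 8 * (1 + G) * C + 4 * (1 + G) * φ * C) * r := by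
  have hB : C * (r + 1) ≤ 2 * C * r := by nlinarith
  have hB0 : 0 ≤ C * (r + 1) := by nlinarith
  have hg : g ≤ 2 * C * r := by linarith
  have hB2 : (C * (r + 1)) ^ 2 ≤ (2 * C * r) ^ 2 := pow_le_pow_left₀ hB0 hB 2
  have a1 : φ * (C * (r + 1)) ^ 2 ≤ φ * (2 * C * r) ^ 2 := mul_le_mul_of_nonneg_left hB2 hφ
  have a2 : φ * ((C * (r + 1)) * g) ≤ φ * (2 * C * r) ^ 2 := by
    refine mul_le_mul_of_nonneg_left ?_ hφ
    refine le_trans ?_ hB2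
    rw [sq]; exact mul_le_mul_of_nonneg_left g1 hB0
  have a3 : (1 + G) * g ≤ (1 + G) * (2 * C * r) := mul_le_mul_of_nonneg_left hg (by linarith)
  have a4 : (1 + G) * φ * (C * (r + 1)) ≤ (1 + G) * φ * (2 * C * r) :=
    mul_le_mul_of_nonneg_left hB (by positivity)
  have a5 : (1 + G) ^ 2 ≤ (1 + G) ^ 2 * r := le_mul_of_one_le_right (by positivity) hr
  nlinarith

namespace Lln
variable {d : ℕ} {Ω : Type*} [MeasurableSpace Ω] {P : Measure Ω} [IsProbabilityMeasure P]
  {τ : ℝ → Euc d → Euc d → Ω → ℝ} {C κ : ℝ} {φ : ℝ → ℝ}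

lemma lim1 (H : Lln P τ C κ φ) (hφ0 : ∀ s, 0 ≤ φ s) (hφ : Tendsto φ atTop (nhds 0))
    {e : Euc d} (he : ‖e‖ = 1) :
    ∃ l, Tendsto (fun r : ℝ => (∫ ω, τ 0 0 (r • e) ω ∂P) / r) atTop (nhds l) := by
  have hC := H.hC
  have hn : ∀ r : ℝ, 0 ≤ r → ‖r • e‖ = r := fun r hr => by rw [norm_smul, he, mul_one, Real.norm_of_nonneg hr]
  refine near_subadd (g := fun r => ∫ ω, τ 0 0 (r • e) ω ∂P) hC (fun r hr => integral_nonneg (H.nn _ _ _)) ?_ ?_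
  · intro r hr
    have : ∫ ω, τ 0 0 (r • e) ω ∂P ≤ ∫ ω, C * (r + 1) ∂P :=
      integral_mono (H.int1 _ _ _) (integrable_const _) fun ω => by
        have := H.up 0 0 (r • e) ω
        rwa [sub_zero, hn r hr] at this
    simpa using this
  · intro ε hε
    obtain ⟨G, hG1, hG2⟩ := ((hφ.eventually (gt_mem_nhds (show 0 < ε / C by positivity))).and
      (eventually_ge_atTop C)).exists
    rw [lt_div_iff₀ hC] at hG1
    refine ⟨1 + G + ε, by linarith, fun r s hr hs => ?_⟩
    have := H.block1 (r • e) (s • e) G hG2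
    rw [← add_smul, hn s hs] at this
    have : φ G * (C * (s + 1)) ≤ ε * (s + 1) := by
      rw [← mul_assoc]; exact mul_le_mul_of_nonneg_right hG1.le (by linarith)
    linarith

lemma lim2 (H : Lln P τ C κ φ) (hφ0 : ∀ s, 0 ≤ φ s) (hφ : Tendsto φ atTop (nhds 0))
    {e : Euc d} (he : ‖e‖ = 1) {l : ℝ}
    (hl : Tendsto (fun r : ℝ => (∫ ω, τ 0 0 (r • e) ω ∂P) / r) atTop (nhds l)) :
    Tendsto (fun r : ℝ => (∫ ω, τ 0 0 (r • e) ω ^ 2 ∂P) / r ^ 2 - ((∫ ω, τ 0 0 (r • e) ω ∂P) / r) ^ 2)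
      atTop (nhds 0) := by
  have hC := H.hC
  have hn : ∀ r : ℝ, 0 ≤ r → ‖r • e‖ = r := fun r hr => by rw [norm_smul, he, mul_one, Real.norm_of_nonneg hr]
  have gup : ∀ r : ℝ, 0 ≤ r → ∫ ω, τ 0 0 (r • e) ω ∂P ≤ C * (r + 1) := by
    intro r hr
    have : ∫ ω, τ 0 0 (r • e) ω ∂P ≤ ∫ ω, C * (r + 1) ∂P :=
      integral_mono (H.int1 _ _ _) (integrable_const _) fun ω => by
        have := H.up 0 0 (r • e) ω
        rwa [sub_zero, hn r hr] at this
    simpa using this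
  have qup : ∀ r : ℝ, 0 ≤ r → ∫ ω, τ 0 0 (r • e) ω ^ 2 ∂P ≤ (C * (r + 1)) ^ 2 := by
    intro r hr
    have : ∫ ω, τ 0 0 (r • e) ω ^ 2 ∂P ≤ ∫ ω, (C * (r + 1)) ^ 2 ∂P :=
      integral_mono (H.int2 _ _ _) (integrable_const _) fun ω => by
        have := H.up2 0 0 (r • e) ω
        rwa [sub_zero, hn r hr] at this
    simpa using this
  have vnn : ∀ r : ℝ, (∫ ω, τ 0 0 (r • e) ω ∂P) ^ 2 ≤ ∫ ω, τ 0 0 (r • e) ω ^ 2 ∂P := by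
    intro r
    set m := ∫ ω, τ 0 0 (r • e) ω ∂P
    have i3 : Integrable (fun ω => τ 0 0 (r • e) ω ^ 2 - 2 * m * τ 0 0 (r • e) ω) P :=
      (H.int2 _ _ _).sub ((H.int1 _ _ _).const_mul _)
    have : 0 ≤ ∫ ω, (τ 0 0 (r • e) ω ^ 2 - 2 * m * τ 0 0 (r • e) ω + m ^ 2) ∂P :=
      integral_nonneg fun ω => by
        have := sq_nonneg (τ 0 0 (r • e) ω - m)
        simp only [Pi.zero_apply]; linarith
    rw [integral_add i3 (integrable_const _), integral_sub (H.int2 _ _ _) ((H.int1 _ _ _).const_mul _),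
      integral_const_mul] at this
    simp only [integral_const, probReal_univ, smul_eq_mul] at this
    change 0 ≤ _ - 2 * m * m + 1 * m ^ 2 at this
    linarith
  have blk := fun (r : ℝ) (hr : 1 ≤ r) (G : ℝ) (hG : C ≤ G) => H.block2 (r • e) (r • e) G hG (hφ0 G)
  generalize hg : (fun r : ℝ => ∫ ω, τ 0 0 (r • e) ω ∂P) = g at *
  have hg' : ∀ r : ℝ, ∫ ω, τ 0 0 (r • e) ω ∂P = g r := fun r => congrFun hg r
  generalize hq : (fun r : ℝ => ∫ ω, τ 0 0 (r • e) ω ^ 2 ∂P) = q at *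
  have hq' : ∀ r : ℝ, ∫ ω, τ 0 0 (r • e) ω ^ 2 ∂P = q r := fun r => congrFun hq r
  simp only [hg', hq', ← add_smul] at *
  refine half_tendsto (A := 4 * C ^ 2) ?_ ?_ ?_
  · intro r hr
    rw [div_pow, ← sub_div]
    exact div_nonneg (by linarith [vnn r]) (by positivity)
  · intro r hr
    have : q r / r ^ 2 ≤ 4 * C ^ 2 := by
      rw [div_le_iff₀ (by positivity)]
      have h1 : C * (r + 1) ≤ 2 * C * r := by nlinarith
      have h2 := pow_le_pow_left₀ (by positivity) h1 2
      have := qup r (by linarith)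
      linarith
    have := sq_nonneg (g r / r)
    linarith
  · intro ε hε
    obtain ⟨G, hG1, hG2⟩ := ((hφ.eventually (gt_mem_nhds (show 0 < ε / (12 * C ^ 2) by positivity))).and
      (eventually_ge_atTop C)).exists
    rw [lt_div_iff₀ (by positivity)] at hG1
    set D := (1 + G) ^ 2 + 8 * (1 + G) * C + 4 * (1 + G) * φ G * C with hD
    have hl2 : Tendsto (fun r : ℝ => (g r / r) ^ 2 - (g (2 * r) / (2 * r)) ^ 2) atTop (nhds 0) := by
      have h2 : Tendsto (fun r : ℝ => 2 * r) atTop atTop := tendsto_id.const_mul_atTop (by norm_num)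
      have := (hl.pow 2).sub ((hl.comp h2).pow 2)
      rw [sub_self] at this
      exact this
    obtain ⟨R, hR⟩ := eventually_atTop.1 (hl2.eventually (gt_mem_nhds (show 0 < ε / 4 by linarith)))
    refine ⟨max (max 1 R) (D / ε), fun r hr => ?_⟩
    have r1 : 1 ≤ r := (le_max_left _ _).trans ((le_max_left _ _).trans hr)
    have r0 : 0 < r := by linarith
    have r2 := hR r ((le_max_right _ _).trans ((le_max_left _ _).trans hr))
    have r3 : D ≤ ε * r := by
      have := (le_max_right _ _).trans hr
      rw [div_le_iff₀ hε] at this; linarith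
    have b := blk r r1 G hG2
    rw [hn r r0.le, show r + r = 2 * r by ring] at b
    have b2 := b.trans (var_arith (q := q r) r1 hC (by linarith) (hφ0 G) (gup r r0.le))
    have b3 : q (2 * r) ≤ 2 * q r + 2 * g r ^ 2 + 2 * ε * r ^ 2 := by
      have : φ G * (12 * C ^ 2) * r ^ 2 ≤ ε * r ^ 2 := mul_le_mul_of_nonneg_right hG1.le (by positivity)
      have : D * r ≤ ε * r * r := mul_le_mul_of_nonneg_right r3 r0.le
      nlinarith
    have b4 : q (2 * r) / (2 * r) ^ 2 ≤ q r / r ^ 2 / 2 + (g r / r) ^ 2 / 2 + ε / 2 := by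
      rw [div_le_iff₀ (by positivity)]
      have : (q r / r ^ 2 / 2 + (g r / r) ^ 2 / 2 + ε / 2) * (2 * r) ^ 2 =
        2 * q r + 2 * g r ^ 2 + 2 * ε * r ^ 2 := by field_simp
      linarith
    linarith
end Lln

end

section
open MeasureTheory Filter Metric ProbabilityTheory

namespace Lln
variable {d : ℕ} {Ω : Type*} [MeasurableSpace Ω] {P : Measure Ω} [IsProbabilityMeasure P]
  {τ : ℝ → Euc d → Euc d → Ω → ℝ} {C κ : ℝ} {φ : ℝ → ℝ}

lemma lim3 (H : Lln P τ C κ φ) (hφ0 : ∀ s, 0 ≤ φ s) (hφ : Tendsto φ atTop (nhds 0))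
    {e : Euc d} (he : ‖e‖ = 1) {l : ℝ}
    (hl : Tendsto (fun r : ℝ => (∫ ω, τ 0 0 (r • e) ω ∂P) / r) atTop (nhds l)) (t0 : ℝ) (x0 : Euc d) :
    TendstoInMeasure P (fun r : ℝ => fun ω => τ t0 x0 (x0 + r • e) ω / r) atTop (fun _ => l) := by
  rw [tendstoInMeasure_iff_measureReal_norm]
  intro ε hε
  have h2 := H.lim2 hφ0 hφ he hl
  have h3 := (h2.add ((hl.sub_const l).pow 2)).div_const (ε ^ 2)
  rw [show ((0 + (l - l) ^ 2) / ε ^ 2 : ℝ) = 0 by simp] at h3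
  refine squeeze_zero' (Eventually.of_forall fun r => measureReal_nonneg) ?_ h3
  filter_upwards [eventually_ge_atTop (1:ℝ)] with r hr
  have r0 : 0 < r := by linarith
  have i1 := H.int1 0 0 (r • e)
  have i2 := H.int2 0 0 (r • e)
  have hset : P.real {ω | ε ≤ ‖τ t0 x0 (x0 + r • e) ω / r - l‖} =
      P.real {ω | ε ^ 2 ≤ τ 0 0 (r • e) ω ^ 2 / r ^ 2 - 2 * l / r * τ 0 0 (r • e) ω + l ^ 2} := by
    have hS : MeasurableSet {z : ℝ | ε ≤ ‖z / r - l‖} :=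
      measurableSet_le measurable_const ((measurable_id.div_const r).sub_const l).norm
    have := (H.idd t0 x0 (r • e)).measure_mem_eq hS
    simp only [Measure.real]
    congr 1
    refine Eq.trans this ?_
    congr 1
    ext ω
    simp only [Set.mem_preimage, Set.mem_ofPred_eq]
    rw [Real.norm_eq_abs, ← abs_of_pos hε, ← sq_le_sq, abs_of_pos hε]
    have : τ 0 0 (r • e) ω ^ 2 / r ^ 2 - 2 * l / r * τ 0 0 (r • e) ω + l ^ 2 =
      (τ 0 0 (r • e) ω / r - l) ^ 2 := by field_simp; ring
    rw [this]
  rw [hset]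
  have i3 : Integrable (fun ω => τ 0 0 (r • e) ω ^ 2 / r ^ 2 - 2 * l / r * τ 0 0 (r • e) ω) P :=
    (i2.div_const _).sub (i1.const_mul _)
  have i4 : Integrable (fun ω => τ 0 0 (r • e) ω ^ 2 / r ^ 2 - 2 * l / r * τ 0 0 (r • e) ω + l ^ 2) P :=
    i3.add (integrable_const _)
  have ch := mul_meas_ge_le_integral_of_nonneg (μ := P) (Eventually.of_forall fun ω => by
    have : τ 0 0 (r • e) ω ^ 2 / r ^ 2 - 2 * l / r * τ 0 0 (r • e) ω + l ^ 2 =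
      (τ 0 0 (r • e) ω / r - l) ^ 2 := by field_simp; ring
    simp only [Pi.zero_apply]
    rw [this]; positivity) i4 (ε ^ 2)
  rw [integral_add i3 (integrable_const _), integral_sub (i2.div_const _) (i1.const_mul _),
      integral_const_mul, integral_div] at ch
  simp only [integral_const, probReal_univ, smul_eq_mul, one_mul] at ch
  rw [le_div_iff₀ (by positivity), mul_comm]
  refine ch.trans (le_of_eq ?_)
  field_simp
  ring

theorem main (H : Lln P τ C κ φ) (hφ0 : ∀ s, 0 ≤ φ s) (hφ : Tendsto φ atTop (nhds 0)) :
    ∃ M : ℝ, 1 ≤ M ∧ ∃ τbar : Euc d → ℝ,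
      (∀ e : Euc d, ‖e‖ = 1 → τbar e ∈ Set.Icc M⁻¹ M) ∧
      (∀ e e1 : Euc d, ‖e‖ = 1 → ‖e1‖ = 1 →
        max |τbar e - τbar e1| |(τbar e)⁻¹ - (τbar e1)⁻¹| ≤ M ^ 3 * ‖e - e1‖) ∧
      ∀ e : Euc d, ‖e‖ = 1 → ∀ t0 : ℝ, ∀ x0 : Euc d,
        TendstoInMeasure P (fun r : ℝ => fun ω => τ t0 x0 (x0 + r • e) ω / r) atTop (fun _ => τbar e) ∧
        Tendsto (fun r : ℝ => (∫ ω, τ t0 x0 (x0 + r • e) ω ∂P) / r) atTop (nhds (τbar e)) := by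
  classical
  have hC := H.hC
  have hκ := H.hκ
  have ex : ∀ e : Euc d, ∃ l, ‖e‖ = 1 →
      Tendsto (fun r : ℝ => (∫ ω, τ 0 0 (r • e) ω ∂P) / r) atTop (nhds l) := by
    intro e
    by_cases he : ‖e‖ = 1
    · obtain ⟨l, hl⟩ := H.lim1 hφ0 hφ he
      exact ⟨l, fun _ => hl⟩
    · exact ⟨0, fun h => absurd h he⟩
  choose τbar hτ using ex
  set M := max 1 (max C κ) with hM
  have M1 : 1 ≤ M := le_max_left _ _
  have M0 : 0 < M := by linarith
  have MC : C ≤ M := (le_max_left _ _).trans (le_max_right _ _)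
  have Mκ : κ ≤ M := (le_max_right _ _).trans (le_max_right _ _)
  have hinv : Tendsto (fun r : ℝ => r⁻¹) atTop (nhds 0) := tendsto_inv_atTop_zero
  have range : ∀ e : Euc d, ‖e‖ = 1 → τbar e ∈ Set.Icc M⁻¹ M := by
    intro e he
    constructor
    · refine ge_of_tendsto (hτ e he) ?_
      filter_upwards [eventually_gt_atTop (0:ℝ)] with r hr
      have : ∫ ω, r / κ ∂P ≤ ∫ ω, τ 0 0 (r • e) ω ∂P :=
        integral_mono (integrable_const _) (H.int1 _ _ _) fun ω => by
          have := H.low 0 0 (r • e) ω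
          rw [sub_zero, norm_smul, he, mul_one, Real.norm_of_nonneg hr.le] at this
          simp only
          rw [div_le_iff₀ hκ]; linarith
      simp only [integral_const, probReal_univ, smul_eq_mul, one_mul] at this
      rw [le_div_iff₀ hr]
      refine le_trans ?_ this
      rw [div_eq_inv_mul]
      have : M⁻¹ ≤ κ⁻¹ := inv_anti₀ hκ Mκ
      exact mul_le_mul_of_nonneg_right this hr.le
    · have lim : Tendsto (fun r : ℝ => C * (1 + r⁻¹)) atTop (nhds (C * (1 + 0))) :=
        (hinv.const_add 1).const_mul C
      have : τbar e ≤ C * (1 + 0) := by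
        refine le_of_tendsto_of_tendsto (hτ e he) lim ?_
        filter_upwards [eventually_gt_atTop (0:ℝ)] with r hr
        have : ∫ ω, τ 0 0 (r • e) ω ∂P ≤ ∫ ω, C * (r + 1) ∂P :=
          integral_mono (H.int1 _ _ _) (integrable_const _) fun ω => by
            have := H.up 0 0 (r • e) ω
            rwa [sub_zero, norm_smul, he, mul_one, Real.norm_of_nonneg hr.le] at this
        simp only [integral_const, probReal_univ, smul_eq_mul, one_mul] at this
        rw [div_le_iff₀ hr]
        refine this.trans (le_of_eq ?_)
        field_simp
      simp at this
      linarith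
  have one : ∀ e e1 : Euc d, ‖e‖ = 1 → ‖e1‖ = 1 → τbar e - τbar e1 ≤ M * ‖e - e1‖ := by
    intro e e1 he he1
    have lim : Tendsto (fun r : ℝ => (∫ ω, τ 0 0 (r • e1) ω ∂P) / r + C * (‖e - e1‖ + r⁻¹)) atTop
        (nhds (τbar e1 + C * (‖e - e1‖ + 0))) :=
      (hτ e1 he1).add ((hinv.const_add _).const_mul C)
    have : τbar e ≤ τbar e1 + C * (‖e - e1‖ + 0) := by
      refine le_of_tendsto_of_tendsto (hτ e he) lim ?_
      filter_upwards [eventually_gt_atTop (0:ℝ)] with r hr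
      have : ∫ ω, τ 0 0 (r • e) ω ∂P ≤ ∫ ω, (τ 0 0 (r • e1) ω + C * (r * ‖e - e1‖ + 1)) ∂P :=
        integral_mono (H.int1 _ _ _) ((H.int1 _ _ _).add (integrable_const _)) fun ω => by
          have := H.tri2 (r • e) (r • e1) ω
          rwa [← smul_sub, norm_smul, Real.norm_of_nonneg hr.le] at this
      rw [integral_add (H.int1 _ _ _) (integrable_const _)] at this
      simp only [integral_const, probReal_univ, smul_eq_mul, one_mul] at this
      rw [div_le_iff₀ hr]
      refine this.trans (le_of_eq ?_)
      field_simp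
    have : C * ‖e - e1‖ ≤ M * ‖e - e1‖ := by gcongr
    linarith
  refine ⟨M, M1, τbar, range, ?_, ?_⟩
  · intro e e1 he he1
    have a : |τbar e - τbar e1| ≤ M * ‖e - e1‖ := by
      rw [abs_le]
      have h1 := one e e1 he he1
      have h2 := one e1 e he1 he
      rw [norm_sub_rev] at h2
      constructor <;> linarith
    have p1 := range e he
    have p2 := range e1 he1
    have q1 : 0 < τbar e := lt_of_lt_of_le (by positivity) p1.1
    have q2 : 0 < τbar e1 := lt_of_lt_of_le (by positivity) p2.1
    have s1 : (τbar e)⁻¹ ≤ M := inv_le_of_inv_le₀ M0 p1.1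
    have s2 : (τbar e1)⁻¹ ≤ M := inv_le_of_inv_le₀ M0 p2.1
    have hne := norm_nonneg (e - e1)
    refine max_le (a.trans ?_) ?_
    · have : M ≤ M ^ 3 := le_self_pow₀ M1 (by norm_num)
      gcongr
    · have : (τbar e)⁻¹ - (τbar e1)⁻¹ = (τbar e)⁻¹ * (τbar e1)⁻¹ * (τbar e1 - τbar e) := by
        field_simp
      rw [this, abs_mul, abs_of_pos (by positivity), abs_sub_comm]
      calc (τbar e)⁻¹ * (τbar e1)⁻¹ * |τbar e - τbar e1| ≤ M * M * (M * ‖e - e1‖) := by gcongr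
        _ = M ^ 3 * ‖e - e1‖ := by ring
  · intro e he t0 x0
    refine ⟨H.lim3 hφ0 hφ he (hτ e he) t0 x0, ?_⟩
    have : ∀ r : ℝ, ∫ ω, τ t0 x0 (x0 + r • e) ω ∂P = ∫ ω, τ 0 0 (r • e) ω ∂P := fun r =>
      (H.idd t0 x0 (r • e)).integral_eq
    simp only [this]
    exact hτ e he
end Lln

end

/-- **In-probability law of large numbers for G-equation travel times.**
Under the G-equation hypotheses and mere decay of the mixing coefficient `φ_H`, there are
`M ≥ 1` and deterministic `τ̄(e) ∈ [M⁻¹, M]` (with `τ̄` and `1/τ̄` `M³`-Lipschitz on the sphere)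
such that `τ^{t₀}(x₀, x₀+re, ·)/r → τ̄(e)` in probability and
`E[τ^{t₀}(x₀, x₀+re, ·)]/r → τ̄(e)`, for every `(t₀,x₀)` and unit `e`. -/
theorem gequation_travel_time_lln_in_probability
    {d : ℕ} {Ω : Type*} [MeasurableSpace Ω] (P : Measure Ω) [IsProbabilityMeasure P]
    (c : ℝ → Euc d → Ω → ℝ) (v : ℝ → Euc d → Ω → Euc d)
    -- `c` is positive, `(c,v)` are bounded
    (hc_pos : ∀ t x ω, 0 < c t x ω)
    (hbdd : ∃ K : ℝ, ∀ t x ω, c t x ω ≤ K ∧ ‖v t x ω‖ ≤ K)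
    -- uniform continuity in `t`, uniformly in `(x,ω)`
    (huct : ∀ ε : ℝ, 0 < ε → ∃ δ : ℝ, 0 < δ ∧ ∀ t t' : ℝ, |t - t'| ≤ δ → ∀ x ω,
      |c t x ω - c t' x ω| ≤ ε ∧ ‖v t x ω - v t' x ω‖ ≤ ε)
    -- uniform Lipschitz continuity in `x`
    (hlip : ∃ L : ℝ, ∀ t : ℝ, ∀ x x' : Euc d, ∀ ω,
      |c t x ω - c t x' ω| ≤ L * ‖x - x'‖ ∧ ‖v t x ω - v t x' ω‖ ≤ L * ‖x - x'‖)
    -- `v(t,·,ω)` is divergence-free (a.e. vanishing trace of the a.e. derivative)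
    (hdiv : ∀ t : ℝ, ∀ ω, ∀ᵐ x ∂(volume : Measure (Euc d)),
      LinearMap.trace ℝ (Euc d) (fderiv ℝ (fun y => v t y ω) x).toLinearMap = 0)
    -- the averaged smallness condition (1.14): inf_L sup |avg of v over L-boxes| < inf c
    (hGc4 : ∃ L : ℝ, 0 < L ∧ ∃ a b : ℝ, a < b ∧
      (∀ t x ω,
        ‖(L ^ d)⁻¹ • ∫ y in {y : Euc d | ∀ i, y i ∈ Set.Icc (0:ℝ) L}, v t (x + y) ω‖ ≤ a) ∧
      (∀ t x ω, b ≤ c t x ω))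
    -- space-time stationarity with respect to a measure-preserving group
    (Υ : ℝ × Euc d → Ω → Ω)
    (hmp : ∀ p, MeasurePreserving (Υ p) P P)
    (hid : Υ 0 = id)
    (hgrp : ∀ p q, Υ p ∘ Υ q = Υ (p + q))
    (hstat : ∀ t s : ℝ, ∀ x y : Euc d, ∀ ω,
      c t x (Υ (s, y) ω) = c (t + s) (x + y) ω ∧ v t x (Υ (s, y) ω) = v (t + s) (x + y) ω)
    -- measurability in ω of the travel times
    (hτmeas : ∀ t0 : ℝ, ∀ x0 x : Euc d,
      Measurable fun ω => travelTime (fun a b => c a b ω) (fun a b => v a b ω) t0 x0 x)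
    -- decay of the mixing coefficient
    (hmix : Tendsto (phiH P c v) atTop (nhds 0)) :
    ∃ M : ℝ, 1 ≤ M ∧ ∃ τbar : Euc d → ℝ,
      (∀ e : Euc d, ‖e‖ = 1 → τbar e ∈ Set.Icc M⁻¹ M) ∧
      (∀ e e1 : Euc d, ‖e‖ = 1 → ‖e1‖ = 1 →
        max |τbar e - τbar e1| |(τbar e)⁻¹ - (τbar e1)⁻¹| ≤ M ^ 3 * ‖e - e1‖) ∧
      ∀ e : Euc d, ‖e‖ = 1 → ∀ t0 : ℝ, ∀ x0 : Euc d,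
        TendstoInMeasure P
          (fun r : ℝ => fun ω =>
            travelTime (fun a b => c a b ω) (fun a b => v a b ω) t0 x0 (x0 + r • e) / r)
          atTop (fun _ => τbar e) ∧
        Tendsto (fun r : ℝ =>
            (∫ ω1, travelTime (fun a b => c a b ω1) (fun a b => v a b ω1)
              t0 x0 (x0 + r • e) ∂P) / r)
          atTop (nhds (τbar e)) := by
  obtain ⟨ω0⟩ : Nonempty Ω := by
    by_contra h
    rw [not_nonempty_iff] at h
    have : P Set.univ = 1 := measure_univ
    rw [Set.univ_eq_empty_iff.2 h, measure_empty] at this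
    exact zero_ne_one this
  obtain ⟨K, hK⟩ := hbdd
  obtain ⟨Lp0, hLp0⟩ := hlip
  obtain ⟨L, hL, a, b, hab, hav, hcb⟩ := hGc4
  have ha : 0 ≤ a := (norm_nonneg _).trans (hav 0 0 ω0)
  have hKpos : 0 < K := by linarith [hcb 0 0 ω0, (hK 0 0 ω0).1]
  have hmdE : ∀ ε : ℝ, ∃ δ : ℝ, 0 < ε → 0 < δ ∧ ∀ t t' : ℝ, |t - t'| ≤ δ → ∀ x ω,
      |c t x ω - c t' x ω| ≤ ε ∧ ‖v t x ω - v t' x ω‖ ≤ ε := by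
    intro ε
    by_cases h : 0 < ε
    · obtain ⟨δ, hδ⟩ := huct ε h
      exact ⟨δ, fun _ => hδ⟩
    · exact ⟨0, fun h' => absurd h' h⟩
  choose md hmd using hmdE
  set Lp := max Lp0 0 with hLpdef
  have hLp : 0 ≤ Lp := le_max_right _ _
  have hLpl : ∀ t : ℝ, ∀ x x' : Euc d, ∀ ω,
      |c t x ω - c t x' ω| ≤ Lp * ‖x - x'‖ ∧ ‖v t x ω - v t x' ω‖ ≤ Lp * ‖x - x'‖ := by
    intro t x x' ω
    have h : Lp0 * ‖x - x'‖ ≤ Lp * ‖x - x'‖ := mul_le_mul_of_nonneg_right (le_max_left _ _) (norm_nonneg _)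
    exact ⟨(hLp0 t x x' ω).1.trans h, (hLp0 t x x' ω).2.trans h⟩
  have henv : ∀ ω, Env K Lp a b L md (fun s y => c s y ω) (fun s y => v s y ω) := fun ω =>
    { cK := fun t x => (hK t x ω).1
      vK := fun t x => (hK t x ω).2
      uc := fun ε hε t t' h x => (hmd ε hε).2 t t' h x ω
      lip := fun t x x' => hLpl t x x' ω
      dv := fun t => hdiv t ω
      av := fun t x => hav t x ω
      cb := fun t x => hcb t x ω }
  obtain ⟨C, hC, hT1⟩ := T1 d K Lp a b L md hKpos.le hLp ha hab hL (fun ε hε => (hmd ε hε).1)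
  -- modulus
  have hpn : ∀ n : ℕ, (0:ℝ) < 1 / (4 * ((n:ℝ) + 1)) := fun n => by positivity
  set δ : ℕ → ℝ := fun n => min (md (1 / (4 * ((n:ℝ) + 1)))) (1 / (4 * ((n:ℝ) + 1)) / (Lp * (2 * K) + 1)) with hδdef
  have hden : 0 < Lp * (2 * K) + 1 := by positivity
  have hδ : ∀ n, 0 < δ n := fun n => lt_min (hmd _ (hpn n)).1 (div_pos (hpn n) hden)
  have hmdl : ∀ ω, Mdl K δ (fun s y => c s y ω) (fun s y => v s y ω) := fun ω =>
    { c0 := fun t x => (hc_pos t x ω).le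
      cK := fun t x => (hK t x ω).1
      vK := fun t x => (hK t x ω).2
      md := by
        intro n s s' x x' h1 h2
        have e1 := (hmd _ (hpn n)).2 s s' (h1.trans (min_le_left _ _)) x ω
        have e2 := hLpl s' x x' ω
        have e3 : Lp * ‖x - x'‖ ≤ 1 / (4 * ((n:ℝ) + 1)) := by
          have h3 : δ n ≤ 1 / (4 * ((n:ℝ) + 1)) / (Lp * (2 * K) + 1) := min_le_right _ _
          rw [le_div_iff₀ hden] at h3
          have h4 : Lp * ‖x - x'‖ ≤ Lp * (2 * K * δ n) := mul_le_mul_of_nonneg_left h2 hLp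
          have h5 := (hδ n).le
          linarith
        have e4 : (1:ℝ) / (2 * ((n:ℝ) + 1)) = 1 / (4 * ((n:ℝ) + 1)) + 1 / (4 * ((n:ℝ) + 1)) := by
          field_simp; norm_num
        rw [e4]
        constructor
        · exact (abs_sub_le _ (c s' x ω) _).trans (add_le_add e1.1 (e2.1.trans e3))
        · exact (norm_sub_le_norm_sub_add_norm_sub _ (v s' x ω) _).trans (add_le_add e1.2 (e2.2.trans e3)) }
  have hctl : ∀ ω, Ctl C (2 * K) (fun s y => c s y ω) (fun s y => v s y ω) := fun ω =>
    { hC := hC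
      up := hT1 _ _ (henv ω)
      low := by
        intro t0 x y t hr
        obtain ⟨γ, g0, g1, gl, -⟩ := (hmdl ω).path hr
        have := gl t0 (t0 + t) le_rfl hr.1 le_rfl
        rw [g0, g1] at this
        simpa using this }
  have hφ0 : ∀ s, 0 ≤ phiH P c v s := fun s => Real.sSup_nonneg (by
    rintro r ⟨t, E, F, -, -, -, rfl⟩; exact abs_nonneg _)
  have H : Lln P (fun t0 x0 x ω => travelTime (fun a b => c a b ω) (fun a b => v a b ω) t0 x0 x)
      C (2 * K) (phiH P c v) :=
    { hC := hC
      hκ := by positivity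
      meas := hτmeas
      nn := fun t x y ω => tt_nonneg _ _ _ _ _
      up := fun t x y ω => (hctl ω).tt_up t x y
      low := fun t x y ω => (hctl ω).tt_low (by positivity) t x y
      tri := fun k G x y ω hk hG => by
        have := (hctl ω).tri (x := y) hk hG
        rwa [zero_add] at this
      tri2 := fun x y ω => (hctl ω).tri2
      idd := fun t x y => by
        have e : (fun ω => travelTime (fun a b => c a b ω) (fun a b => v a b ω) t x (x + y)) =
            (fun ω => travelTime (fun a b => c a b ω) (fun a b => v a b ω) 0 0 y) ∘ Υ (t, x) := by
          funext ω
          rw [tt_shift]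
          simp only [Function.comp, (hstat _ t _ x ω).1, (hstat _ t _ x ω).2]
        refine ⟨(hτmeas t x (x + y)).aemeasurable, (hτmeas 0 0 y).aemeasurable, ?_⟩
        simp only [e]
        rw [← Measure.map_map (hτmeas 0 0 y) (hmp (t, x)).measurable, (hmp (t, x)).map_eq]
      mix := by
        intro x y z a b G w hab
        refine mix_set P c v (t := b) ?_ ?_
        · have m1 := @meas_tt d Ω (sigmaMinus c v b) K C (2 * K) δ c v hmdl hKpos hδ hctl 0 b 0 x
            (fun s _ hs y => meas_minus c v (by linarith) y)
          have m2 := @meas_tt d Ω (sigmaMinus c v b) K C (2 * K) δ c v hmdl hKpos hδ hctl 0 a 0 x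
            (fun s _ hs y => meas_minus c v (by linarith) y)
          have m3 := @MeasurableSet.diff Ω (sigmaMinus c v b) _ _ m1 m2
          convert m3 using 1
          ext ω
          simp only [Set.mem_diff, Set.mem_ofPred_eq, not_lt]
          exact and_comm
        · have m1 := @meas_tt d Ω (sigmaPlus c v (b + G)) K C (2 * K) δ c v hmdl hKpos hδ hctl (b + G) w y z
            (fun s hs _ y => meas_plus c v hs y)
          have m3 := @MeasurableSet.compl Ω _ (sigmaPlus c v (b + G)) m1
          convert m3 using 1
          ext ω
          simp only [Set.mem_compl_iff, Set.mem_ofPred_eq, not_lt] }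
  exact H.main hφ0 hmix
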